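/- arXiv:1507.07690 — 3 statements merged into one kernel-verified Lean document; each statement's English description precedes it below -/
import Mathlib

section
/- Let (μ_t)_{t∈[0,1]} be a right-continuous peacock. Then the set M((μ_t)_{t∈[0,1]}) of càdlàg martingale measures with marginals (μ_t) is nonempty and compact with respect to the topology induced by the functions ω ↦ f(S_{t₁}(ω), …, S_{t_n}(ω)) for t₁,…,t_n ∈ [0,1] and f bounded continuous; moreover this topology does not depend on the choice of countable dense set Q used to define it. -/
open MeasureTheory Set Filter Topology

/-- The convex order on probability measures on `ℝ`. -/
def ConvexOrder (μ ν : Measure ℝ) : Prop :=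
  ∀ φ : ℝ → ℝ, ConvexOn ℝ Set.univ φ → Integrable φ μ → Integrable φ ν →
    ∫ x, φ x ∂μ ≤ ∫ x, φ x ∂ν

/-- `g` is càdlàg on `[0,1]`. -/
def CadlagOn01 (g : ℝ → ℝ) : Prop :=
  (∀ x ∈ Ico (0 : ℝ) 1, Tendsto g (𝓝[>] x) (𝓝 (g x))) ∧
  (∀ x ∈ Ioc (0 : ℝ) 1, ∃ L : ℝ, Tendsto g (𝓝[<] x) (𝓝 L))

/-- The Skorokhod-type space of càdlàg paths `[0,1] → ℝ`. -/
def Dspace : Type := {g : ℝ → ℝ // CadlagOn01 g}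

/-- The canonical σ-algebra on `D`, generated by the evaluations `S_t`, `t ∈ [0,1]`. -/
noncomputable instance : MeasurableSpace Dspace :=
  ⨆ t ∈ Icc (0 : ℝ) 1, MeasurableSpace.comap (fun g : Dspace => g.1 t) inferInstance

/-- The natural filtration `F_t` on `D`. -/
noncomputable def FD (t : ℝ) : MeasurableSpace Dspace :=
  ⨆ r ∈ Icc (0 : ℝ) t, MeasurableSpace.comap (fun g : Dspace => g.1 r) inferInstance

/-- The right-continuous filtration `F⁺` on `D`. -/
noncomputable def FDplus (s : ℝ) : MeasurableSpace Dspace :=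
  if s = 1 then FD 1 else ⨅ t ∈ Ioc s (1 : ℝ), FD t

/-- The set `M((μ_t)_{t∈[0,1]})` of càdlàg martingale measures with marginals `(μ_t)`. -/
def MI (μ : ℝ → ProbabilityMeasure ℝ) : Set (Measure Dspace) :=
  {P | IsProbabilityMeasure P ∧
    (∀ t ∈ Icc (0 : ℝ) 1, P.map (fun g : Dspace => g.1 t) = (μ t : Measure ℝ)) ∧
    (∀ t ∈ Icc (0 : ℝ) 1, Integrable (fun g : Dspace => g.1 t) P) ∧
    (∀ s t : ℝ, 0 ≤ s → s ≤ t → t ≤ 1 →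
      P[(fun g : Dspace => g.1 t) | FDplus s] =ᵐ[P] fun g : Dspace => g.1 s)}

/-- The topology on measures on `D` induced by the finite-dimensional cylinder functionals
`P ↦ ∫ f(S_{t₁}, …, S_{t_n}) dP` for `t₁, …, t_n ∈ [0,1]` and `f` bounded continuous.
(It is defined without reference to any countable dense set `Q`, so it manifestly does not
depend on such a choice.) -/
noncomputable def cylTop : TopologicalSpace (Measure Dspace) :=
  ⨅ (n : ℕ) (t : Fin n → ℝ) (_ : ∀ i, t i ∈ Icc (0 : ℝ) 1)
    (f : BoundedContinuousFunction (Fin n → ℝ) ℝ),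
    TopologicalSpace.induced
      (fun P : Measure Dspace => ∫ g, f (fun i => g.1 (t i)) ∂P) inferInstance


/-! ### Positive extension of linear functionals -/

lemma exists_range_section {T V : Type*} [AddCommGroup T] [Module ℝ T] [AddCommGroup V]
    [Module ℝ V] (Ψ : T →ₗ[ℝ] V) :
    ∃ r : LinearMap.range Ψ →ₗ[ℝ] T, ∀ x : LinearMap.range Ψ, Ψ (r x) = (x : V) := by
  obtain ⟨r, hr⟩ := Ψ.rangeRestrict.exists_rightInverse_of_surjective
    (LinearMap.range_eq_top.2 Ψ.surjective_rangeRestrict)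
  refine ⟨r, fun x => ?_⟩
  have := congrArg (fun f => ((f x : LinearMap.range Ψ) : V)) hr
  simpa using this

lemma pos_extension {Ω T : Type*} [AddCommGroup T] [Module ℝ T]
    (Φ : T →ₗ[ℝ] (Ω → ℝ)) (ℓ : T →ₗ[ℝ] ℝ) (hpos : ∀ τ, 0 ≤ Φ τ → 0 ≤ ℓ τ) :
    ∃ G : (Ω → ℝ) →ₗ[ℝ] ℝ, (∀ τ, G (Φ τ) = ℓ τ) ∧
      ∀ F : Ω → ℝ, 0 ≤ F → (∃ τ, F ≤ Φ τ) → 0 ≤ G F := by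
  classical
  have hker : ∀ τ τ', Φ τ = Φ τ' → ℓ τ = ℓ τ' := by
    intro τ τ' h
    have h1 := hpos (τ - τ') (by rw [map_sub, h, sub_self])
    have h2 := hpos (τ' - τ) (by rw [map_sub, h, sub_self])
    rw [map_sub] at h1 h2
    linarith
  let B : Submodule ℝ (Ω → ℝ) :=
    { carrier := {F | ∃ τ₁ τ₂, Φ τ₁ ≤ F ∧ F ≤ Φ τ₂}
      zero_mem' := ⟨0, 0, by simp, by simp⟩
      add_mem' := by
        rintro F F' ⟨a, b, h1, h2⟩ ⟨a', b', h1', h2'⟩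
        exact ⟨a + a', b + b', by rw [map_add]; exact add_le_add h1 h1',
          by rw [map_add]; exact add_le_add h2 h2'⟩
      smul_mem' := by
        rintro c F ⟨a, b, h1, h2⟩
        rcases le_total 0 c with hc | hc
        · exact ⟨c • a, c • b, by rw [map_smul]; exact smul_le_smul_of_nonneg_left h1 hc,
            by rw [map_smul]; exact smul_le_smul_of_nonneg_left h2 hc⟩
        · refine ⟨c • b, c • a, ?_, ?_⟩
          · rw [map_smul]; intro ω
            exact mul_le_mul_of_nonpos_left (h2 ω) hc
          · rw [map_smul]; intro ω
            exact mul_le_mul_of_nonpos_left (h1 ω) hc }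
  let Ψ : T →ₗ[ℝ] B := Φ.codRestrict B (fun τ => ⟨τ, τ, le_rfl, le_rfl⟩)
  have hΨ : ∀ τ, ((Ψ τ : B) : Ω → ℝ) = Φ τ := fun τ => rfl
  obtain ⟨r, hr'⟩ := exists_range_section Ψ
  let s : PointedCone ℝ B :=
    { carrier := {F | 0 ≤ (F : Ω → ℝ)}
      zero_mem' := by simp
      smul_mem' := by
        rintro ⟨c, hc⟩ x hx
        intro ω
        exact mul_nonneg hc (hx ω)
      add_mem' := by
        intro x y hx hy ω
        exact add_nonneg (hx ω) (hy ω) }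
  let f : B →ₗ.[ℝ] ℝ := ⟨LinearMap.range Ψ, ℓ ∘ₗ r⟩
  obtain ⟨g, hg1, hg2⟩ := riesz_extension s f (by
      intro x hx
      change 0 ≤ ℓ (r x)
      apply hpos
      have : Φ (r x) = ((x : B) : Ω → ℝ) := by rw [← hΨ, hr']
      rw [this]; exact hx) (by
      rintro ⟨F, a, b, h1, h2⟩
      refine ⟨⟨Ψ (-a), ⟨_, rfl⟩⟩, ?_⟩
      intro ω
      have := h1 ω
      change 0 ≤ Φ (-a) ω + F ω
      rw [map_neg, Pi.neg_apply]; linarith)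
  obtain ⟨G, hG⟩ := LinearMap.exists_extend g
  have hG' : ∀ x : B, G x = g x := fun x => by rw [← hG]; rfl
  refine ⟨G, ?_, ?_⟩
  · intro τ
    have h1 := hG' (Ψ τ)
    have h2 := hg1 ⟨Ψ τ, ⟨τ, rfl⟩⟩
    rw [hΨ] at h1
    rw [h1]
    refine h2.trans ?_
    change ℓ (r _) = ℓ τ
    apply hker
    rw [← hΨ, hr', hΨ]
  · rintro F hF ⟨τ, hτ⟩
    have : F ∈ B := ⟨0, τ, by simpa using hF, hτ⟩
    have h1 := hG' ⟨F, this⟩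
    rw [h1]
    exact hg2 _ hF

/-! ### The peacock structure on the whole line -/

/-- A right-continuous peacock indexed by `ℝ`, dominated by its value at `1`. -/
structure Pk (ν : ℝ → Measure ℝ) : Prop where
  prob : ∀ t, IsProbabilityMeasure (ν t)
  int : ∀ t, Integrable (fun x : ℝ => x) (ν t)
  cx : ∀ s t, s ≤ t → ConvexOrder (ν s) (ν t)
  top : ∀ t, ConvexOrder (ν t) (ν 1)
  rc : ∀ t (f : BoundedContinuousFunction ℝ ℝ),
    Tendsto (fun u => ∫ x, f x ∂(ν u)) (𝓝[>] t) (𝓝 (∫ x, f x ∂(ν t)))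

/-- Continuous functions of linear growth. -/
def LG : Submodule ℝ (ℝ → ℝ) where
  carrier := {f | Continuous f ∧ ∃ C, ∀ x, |f x| ≤ C * (1 + |x|)}
  zero_mem' := ⟨continuous_const, 0, by simp⟩
  add_mem' := by
    rintro f g ⟨hf, C, hC⟩ ⟨hg, C', hC'⟩
    refine ⟨hf.add hg, C + C', fun x => ?_⟩
    calc |f x + g x| ≤ |f x| + |g x| := abs_add_le _ _
      _ ≤ _ := by rw [add_mul]; exact add_le_add (hC x) (hC' x)
  smul_mem' := by
    rintro c f ⟨hf, C, hC⟩
    refine ⟨hf.const_smul c, |c| * C, fun x => ?_⟩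
    simp only [Pi.smul_apply, smul_eq_mul, abs_mul, mul_assoc]
    exact mul_le_mul_of_nonneg_left (hC x) (abs_nonneg c)

lemma LG.integrable {ν : ℝ → Measure ℝ} (h : Pk ν) {f : ℝ → ℝ} (hf : f ∈ LG) (t : ℝ) :
    Integrable f (ν t) := by
  have := h.prob t
  obtain ⟨hc, C, hC⟩ := hf
  have h1 : Integrable (fun x : ℝ => C * (1 + |x|)) (ν t) :=
    ((integrable_const 1).add (h.int t).abs).const_mul C
  exact h1.mono' hc.aestronglyMeasurable (Eventually.of_forall fun x => by
    simpa using hC x)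

/-- Elementary zero-cost trading gains with times in `J`. -/
def gains (J : Set ℝ) : Submodule ℝ ((ℝ → ℝ) → ℝ) :=
  Submodule.span ℝ {z | ∃ s ∈ J, ∃ t ∈ J, s ≤ t ∧ ∃ h : (ℝ → ℝ) → ℝ, DependsOn h (Iic s) ∧
    z = fun ω => h ω * (ω t - ω s)}

lemma gains_dependsOn {J : Set ℝ} {n : ℝ} (hJ : ∀ t ∈ J, t ≤ n) {z : (ℝ → ℝ) → ℝ}
    (hz : z ∈ gains J) : DependsOn z (Iic n) := by
  induction hz using Submodule.span_induction with
  | mem z hz =>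
    obtain ⟨s, hs, t, ht, hst, h, hh, rfl⟩ := hz
    intro x y hxy
    simp only
    rw [hxy t (hJ t ht), hxy s (hJ s hs),
      hh (fun i hi => hxy i (le_trans hi (hJ s hs)))]
  | zero => intro x y _; rfl
  | add a b _ _ ha hb => intro x y hxy; simp [ha hxy, hb hxy]
  | smul c a _ ha => intro x y hxy; simp [ha hxy]

lemma gains_decomp {J : Set ℝ} {n m : ℝ} (hn : n ∈ J) (hJ : ∀ t ∈ J, t ≤ n) (hm : n < m)
    {z : (ℝ → ℝ) → ℝ} (hz : z ∈ gains (insert m J)) :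
    ∃ H : (ℝ → ℝ) → ℝ, DependsOn H (Iic n) ∧ ∃ z' ∈ gains J,
      ∀ ω, z ω = H ω * (ω m - ω n) + z' ω := by
  induction hz using Submodule.span_induction with
  | mem z hz =>
    obtain ⟨s, hs, t, ht, hst, h, hh, rfl⟩ := hz
    rcases ht with rfl | ht
    · rcases hs with rfl | hs
      · exact ⟨0, fun _ _ _ => rfl, 0, Submodule.zero_mem _, fun ω => by simp⟩
      · refine ⟨h, fun x y hxy => hh fun i hi => hxy i (le_trans hi (hJ s hs)),
          fun ω => h ω * (ω n - ω s), Submodule.subset_span ⟨s, hs, n, hn, hJ s hs, h, hh, rfl⟩,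
          fun ω => by ring⟩
    · have hs' : s ∈ J := by
        rcases hs with rfl | hs
        · exact absurd (hJ t ht) (by linarith)
        · exact hs
      exact ⟨0, fun _ _ _ => rfl, _, Submodule.subset_span ⟨s, hs', t, ht, hst, h, hh, rfl⟩,
        fun ω => by simp⟩
  | zero => exact ⟨0, fun _ _ _ => rfl, 0, Submodule.zero_mem _, fun ω => by simp⟩
  | add a b _ _ ha hb =>
    obtain ⟨H, hH, z, hz, e⟩ := ha
    obtain ⟨H', hH', z', hz', e'⟩ := hb
    exact ⟨H + H', fun x y hxy => by simp [hH hxy, hH' hxy], z + z', Submodule.add_mem _ hz hz',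
      fun ω => by simp only [Pi.add_apply, e, e']; ring⟩
  | smul c a _ ha =>
    obtain ⟨H, hH, z, hz, e⟩ := ha
    exact ⟨c • H, fun x y hxy => by simp [hH hxy], c • z, Submodule.smul_mem _ _ hz,
      fun ω => by simp only [Pi.smul_apply, smul_eq_mul, e]; ring⟩

lemma no_arbitrage {ν : ℝ → Measure ℝ} (hν : Pk ν) (J : Finset ℝ) :
    ∀ (f : ℝ → ℝ → ℝ) (_ : ∀ t, f t ∈ LG) (z : (ℝ → ℝ) → ℝ) (_ : z ∈ gains (J : Set ℝ))
      (_ : ∀ ω : ℝ → ℝ, 0 ≤ ∑ t ∈ J, f t (ω t) + z ω),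
      0 ≤ ∑ t ∈ J, ∫ x, f t x ∂(ν t) := by
  classical
  induction J using Finset.induction_on_max with
  | empty => intro f hf z hz h; simp
  | insert m J hm ih =>
    intro f hf z hz h
    have hmJ : m ∉ J := fun hh => lt_irrefl _ (hm m hh)
    rcases J.eq_empty_or_nonempty with rfl | hne
    · have hz0 : ∀ ω, z ω = 0 := by
        intro ω
        have : z ∈ (⊥ : Submodule ℝ ((ℝ → ℝ) → ℝ)) := by
          refine (Submodule.span_le.2 ?_) hz
          rintro _ ⟨s, hs, t, ht, hst, k, hk, rfl⟩
          simp at hs ht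
          subst hs; subst ht
          simp only [SetLike.mem_coe, Submodule.mem_bot]
          ext ω; simp
        rw [Submodule.mem_bot] at this
        rw [this]; rfl
      simp only [insert_empty_eq, Finset.sum_singleton] at h ⊢
      refine integral_nonneg fun x => ?_
      simpa [hz0] using h (fun _ => x)
    · set n := J.max' hne with hn
      have hnJ : n ∈ J := J.max'_mem hne
      have hle : ∀ t ∈ (J : Set ℝ), t ≤ n := fun t ht => J.le_max' t ht
      have hnm : n < m := hm n hnJ
      rw [Finset.coe_insert] at hz
      obtain ⟨H, hH, z', hz', e⟩ := gains_decomp (n := n) (m := m) hnJ hle hnm hz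
      set A : (ℝ → ℝ) → ℝ := fun ω => ∑ t ∈ J, f t (ω t) + z' ω with hA
      have hAdep : DependsOn A (Iic n) := by
        intro x y hxy
        simp only [hA]
        rw [gains_dependsOn hle hz' hxy]
        congr 1
        exact Finset.sum_congr rfl fun t ht => by rw [hxy t (hle t ht)]
      have key : ∀ (ω : ℝ → ℝ) (y : ℝ), - A ω - H ω * (y - ω n) ≤ f m y := by
        intro ω y
        have h1 := h (Function.update ω m y)
        have hag : ∀ i ∈ Iic n, Function.update ω m y i = ω i := fun i hi =>
          Function.update_of_ne (ne_of_lt (lt_of_le_of_lt hi hnm)) _ _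
        rw [Finset.sum_insert hmJ, e, hH hag, Function.update_self, hag n (mem_Iic.2 le_rfl)] at h1
        have h2 : A (Function.update ω m y) = A ω := hAdep hag
        simp only [hA] at h2 ⊢
        linarith
      set φ : ℝ → ℝ := fun y => ⨆ ω : ℝ → ℝ, (- A ω - H ω * (y - ω n)) with hφ
      have hbdd : ∀ y, BddAbove (range fun ω : ℝ → ℝ => (- A ω - H ω * (y - ω n))) :=
        fun y => ⟨f m y, by rintro _ ⟨ω, rfl⟩; exact key ω y⟩
      have hφle : ∀ y, φ y ≤ f m y := fun y => ciSup_le fun ω => key ω y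
      have hφge : ∀ ω y, - A ω - H ω * (y - ω n) ≤ φ y := fun ω y => le_ciSup (hbdd y) ω
      have hconv : ConvexOn ℝ univ φ := by
        refine ⟨convex_univ, fun x _ y _ a b ha hb hab => ?_⟩
        refine ciSup_le fun ω => ?_
        have h1 := mul_le_mul_of_nonneg_left (hφge ω x) ha
        have h2 := mul_le_mul_of_nonneg_left (hφge ω y) hb
        simp only [smul_eq_mul]
        have : -A ω - H ω * (a * x + b * y - ω n) =
          a * (-A ω - H ω * (x - ω n)) + b * (-A ω - H ω * (y - ω n)) := by
          have hb' : b = 1 - a := by linarith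
          subst hb'; ring
        linarith
      have hcont : Continuous φ := by
        rw [← continuousOn_univ]
        exact hconv.continuousOn isOpen_univ
      have hLG : φ ∈ LG := by
        refine ⟨hcont, ?_⟩
        obtain ⟨-, C, hC⟩ := hf m
        refine ⟨|C| + (|A 0| + |H 0|), fun y => ?_⟩
        have h1 := hφge 0 y
        have h2 := hφle y
        have h3 := (le_abs_self _).trans (hC y)
        simp only [Pi.zero_apply, sub_zero] at h1
        have h4 : |A 0 + H 0 * y| ≤ |A 0| + |H 0| * |y| := by
          rw [← abs_mul]; exact abs_add_le _ _
        have h5 := le_abs_self (A 0 + H 0 * y)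
        have p1 := abs_nonneg C
        have p2 := le_abs_self C
        have p3 := abs_nonneg (A 0)
        have p4 := abs_nonneg (H 0)
        have p5 := abs_nonneg y
        have q1 : C * (1 + |y|) ≤ |C| * (1 + |y|) :=
          mul_le_mul_of_nonneg_right p2 (by linarith)
        have q2 : 0 ≤ |C| * (1 + |y|) := by positivity
        have q3 : 0 ≤ |A 0| * |y| := by positivity
        rw [abs_le]
        constructor
        · nlinarith
        · nlinarith [mul_nonneg p4 p5]
      have ih' := ih (fun t => if t = n then f n + φ else f t) (by
        intro t
        split_ifs
        · exact Submodule.add_mem _ (hf n) hLG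
        · exact hf t) z' hz' (by
        intro ω
        have h1 := hφge ω (ω n)
        have h2 : ∑ t ∈ J, (if t = n then f n + φ else f t) (ω t)
            = ∑ t ∈ J, (f t (ω t) + if t = n then φ (ω n) else 0) := by
          refine Finset.sum_congr rfl fun t ht => ?_
          split_ifs with h
          · subst h; rfl
          · simp
        rw [h2, Finset.sum_add_distrib, Finset.sum_ite_eq' J n, if_pos hnJ]
        simp only [hA] at h1
        linarith)
      have h3 : ∑ t ∈ J, ∫ x, (if t = n then f n + φ else f t) x ∂(ν t)
            = ∑ t ∈ J, (∫ x, f t x ∂(ν t) + if t = n then ∫ x, φ x ∂(ν n) else 0) := by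
          refine Finset.sum_congr rfl fun t ht => ?_
          split_ifs with h
          · subst h
            exact integral_add (LG.integrable hν (hf _) _) (LG.integrable hν hLG _)
          · simp
      rw [h3, Finset.sum_add_distrib, Finset.sum_ite_eq' J n, if_pos hnJ] at ih'
      rw [Finset.sum_insert hmJ]
      have h4 := hν.cx n m hnm.le φ hconv (LG.integrable hν hLG _) (LG.integrable hν hLG _)
      have h5 : ∫ x, φ x ∂(ν m) ≤ ∫ x, f m x ∂(ν m) :=
        integral_mono (LG.integrable hν hLG _) (LG.integrable hν (hf m) _) hφle
      linarith

/-! ### Truncations -/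

/-- Truncation at level `K`. -/
def trK (K x : ℝ) : ℝ := max (-K) (min x K)

/-- The excess beyond level `K`. -/
def exK (K x : ℝ) : ℝ := max (|x| - K) 0

lemma trK_cont (K : ℝ) : Continuous (trK K) := by unfold trK; fun_prop

lemma exK_cont (K : ℝ) : Continuous (exK K) := by unfold exK; fun_prop

lemma exK_nonneg (K x : ℝ) : 0 ≤ exK K x := le_max_right _ _

lemma trK_abs_le {K : ℝ} (hK : 0 ≤ K) (x : ℝ) : |trK K x| ≤ K := by
  unfold trK
  rw [abs_le]
  exact ⟨le_max_left _ _, max_le (by linarith) (min_le_right _ _)⟩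

lemma trK_sub_abs {K : ℝ} (hK : 0 ≤ K) (x : ℝ) : |x - trK K x| = exK K x := by
  unfold trK exK
  rcases le_total x K with h1 | h1 <;> rcases le_total x (-K) with h2 | h2
  · rw [min_eq_left h1, max_eq_left h2, abs_of_nonpos (by linarith : x - -K ≤ 0),
      abs_of_nonpos (by linarith : x ≤ 0), max_eq_left (by linarith)]
    ring
  · rw [min_eq_left h1, max_eq_right h2, sub_self, abs_zero, max_eq_right]
    have := abs_le.2 ⟨h2, h1⟩
    linarith
  · have : K = 0 := by linarith
    subst this
    have : x = 0 := by linarith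
    subst this
    simp
  · rw [min_eq_right h1, max_eq_right (by linarith), abs_of_nonneg (by linarith : 0 ≤ x - K),
      abs_of_nonneg (by linarith : 0 ≤ x), max_eq_left (by linarith)]

lemma exK_le_abs {K : ℝ} (hK : 0 ≤ K) (x : ℝ) : exK K x ≤ |x| :=
  max_le (by linarith [abs_nonneg x]) (abs_nonneg x)

lemma exK_LG {K : ℝ} (hK : 0 ≤ K) : exK K ∈ LG :=
  ⟨exK_cont K, 1, fun x => by
    rw [abs_of_nonneg (exK_nonneg K x)]; linarith [exK_le_abs hK x]⟩

lemma exK_convex (K : ℝ) : ConvexOn ℝ univ (exK K) := by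
  have h1 : ConvexOn ℝ univ (fun x : ℝ => |x| - K) := by
    have := (convexOn_norm (convex_univ : Convex ℝ (univ : Set ℝ))).add_const (-K)
    exact this
  exact h1.sup (convexOn_const 0 convex_univ)

/-- The tail function of the terminal law. -/
noncomputable def tailK (ν : ℝ → Measure ℝ) (K : ℝ) : ℝ := ∫ x, exK K x ∂(ν 1)

lemma Pk.tail_le {ν : ℝ → Measure ℝ} (h : Pk ν) {K : ℝ} (hK : 0 ≤ K) (t : ℝ) :
    ∫ x, exK K x ∂(ν t) ≤ tailK ν K :=
  h.top t _ (exK_convex K) (LG.integrable h (exK_LG hK) _) (LG.integrable h (exK_LG hK) _)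

lemma Pk.tail_tendsto {ν : ℝ → Measure ℝ} (h : Pk ν) :
    Tendsto (fun K : ℕ => tailK ν K) atTop (𝓝 0) := by
  have : Tendsto (fun K : ℕ => ∫ x, exK K x ∂(ν 1)) atTop (𝓝 (∫ x, (0 : ℝ) ∂(ν 1))) := by
    refine tendsto_integral_of_dominated_convergence (fun x => |x|)
      (fun K => (exK_cont _).aestronglyMeasurable) (h.int 1).abs
      (fun K => Eventually.of_forall fun x => ?_) (Eventually.of_forall fun x => ?_)
    · rw [Real.norm_eq_abs, abs_of_nonneg (exK_nonneg _ x)]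
      exact exK_le_abs (Nat.cast_nonneg K) x
    · refine tendsto_const_nhds.congr' ?_
      obtain ⟨N, hN⟩ := exists_nat_ge |x|
      filter_upwards [eventually_ge_atTop N] with K hK
      have : (N : ℝ) ≤ K := by exact_mod_cast hK
      unfold exK
      rw [max_eq_right (by linarith)]
  simpa [tailK] using this

lemma tailK_nonneg (ν : ℝ → Measure ℝ) (K : ℝ) : 0 ≤ tailK ν K :=
  integral_nonneg fun x => exK_nonneg K x

/-! ### Finitely additive martingale functionals -/

/-- A finitely additive martingale law with marginals `ν`. -/
structure PosMart {Ω : Type*} (X : ℝ → Ω → ℝ) (ν : ℝ → Measure ℝ) (G : (Ω → ℝ) →ₗ[ℝ] ℝ) :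
    Prop where
  pos : ∀ F : Ω → ℝ, 0 ≤ F → (∃ C, ∀ ω, F ω ≤ C) → 0 ≤ G F
  one : G (fun _ => 1) = 1
  marg : ∀ (t : ℝ) (f : BoundedContinuousFunction ℝ ℝ), G (fun ω => f (X t ω)) = ∫ x, f x ∂(ν t)
  mart : ∀ (n : ℕ) (r : Fin n → ℝ) (s t : ℝ), (∀ i, r i ≤ s) → s ≤ t →
    ∀ (h : BoundedContinuousFunction (Fin n → ℝ) ℝ) (K : ℕ),
      |G (fun ω => h (fun i => X (r i) ω) * (trK K (X t ω) - trK K (X s ω)))|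
        ≤ 2 * ‖h‖ * tailK ν K

lemma gains_mono {J J' : Set ℝ} (h : J ⊆ J') : gains J ≤ gains J' := by
  refine Submodule.span_mono ?_
  rintro z ⟨s, hs, t, ht, hst, k, hk, rfl⟩
  exact ⟨s, h hs, t, h ht, hst, k, hk, rfl⟩

lemma gains_finite {z : (ℝ → ℝ) → ℝ} (hz : z ∈ gains univ) :
    ∃ J : Finset ℝ, z ∈ gains (J : Set ℝ) := by
  classical
  induction hz using Submodule.span_induction with
  | mem z hz =>
    obtain ⟨s, hs, t, ht, hst, h, hh, rfl⟩ := hz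
    exact ⟨{s, t}, Submodule.subset_span ⟨s, by simp, t, by simp, hst, h, hh, rfl⟩⟩
  | zero => exact ⟨∅, Submodule.zero_mem _⟩
  | add a b _ _ ha hb =>
    obtain ⟨J, hJ⟩ := ha
    obtain ⟨J', hJ'⟩ := hb
    refine ⟨J ∪ J', Submodule.add_mem _ (gains_mono ?_ hJ) (gains_mono ?_ hJ')⟩ <;> simp
  | smul c a _ ha =>
    obtain ⟨J, hJ⟩ := ha
    exact ⟨J, Submodule.smul_mem _ _ hJ⟩

/-- Evaluation of a static position at time `t`. -/
def statEval (t : ℝ) : LG →ₗ[ℝ] ((ℝ → ℝ) → ℝ) where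
  toFun f := fun ω => (f : ℝ → ℝ) (ω t)
  map_add' _ _ := rfl
  map_smul' _ _ := rfl

/-- The price of a static position at time `t`. -/
noncomputable def statPrice {ν : ℝ → Measure ℝ} (h : Pk ν) (t : ℝ) : LG →ₗ[ℝ] ℝ where
  toFun f := ∫ x, (f : ℝ → ℝ) x ∂(ν t)
  map_add' f g := integral_add (LG.integrable h f.2 t) (LG.integrable h g.2 t)
  map_smul' c f := integral_const_mul c _

lemma bcf_LG (f : BoundedContinuousFunction ℝ ℝ) : (f : ℝ → ℝ) ∈ LG :=
  ⟨f.continuous, ‖f‖, fun x => by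
    have h1 := f.norm_coe_le_norm x
    rw [Real.norm_eq_abs] at h1
    nlinarith [norm_nonneg f, abs_nonneg x, mul_nonneg (norm_nonneg f) (abs_nonneg x)]⟩

lemma exists_posMart {ν : ℝ → Measure ℝ} (hν : Pk ν) :
    ∃ G : ((ℝ → ℝ) → ℝ) →ₗ[ℝ] ℝ, PosMart (fun t (ω : ℝ → ℝ) => ω t) ν G := by
  classical
  let Φ : ((ℝ →₀ LG) × gains univ) →ₗ[ℝ] ((ℝ → ℝ) → ℝ) :=
    (Finsupp.lsum ℝ statEval).coprod (gains univ).subtype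
  let ℓ : ((ℝ →₀ LG) × gains univ) →ₗ[ℝ] ℝ :=
    (Finsupp.lsum ℝ (statPrice hν)) ∘ₗ LinearMap.fst ℝ _ _
  have hΦ : ∀ f z ω, Φ (f, z) ω = ∑ t ∈ f.support, (f t : ℝ → ℝ) (ω t) + (z : (ℝ → ℝ) → ℝ) ω := by
    intro f z ω
    simp [Φ, Finsupp.sum, statEval, Finset.sum_apply]
  have hℓ : ∀ f z, ℓ (f, z) = ∑ t ∈ f.support, ∫ x, (f t : ℝ → ℝ) x ∂(ν t) := by
    intro f z
    simp [ℓ, Finsupp.sum, statPrice]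
  have hΦpos : ∀ τ, 0 ≤ Φ τ → 0 ≤ ℓ τ := by
    rintro ⟨f, z⟩ h
    obtain ⟨J, hJ⟩ := gains_finite z.2
    have h1 : ∑ t ∈ f.support, ∫ x, (f t : ℝ → ℝ) x ∂(ν t)
        = ∑ t ∈ f.support ∪ J, ∫ x, (f t : ℝ → ℝ) x ∂(ν t) := by
      refine Finset.sum_subset Finset.subset_union_left fun t _ ht => ?_
      rw [Finsupp.notMem_support_iff.1 ht]; simp
    rw [hℓ, h1]
    refine no_arbitrage hν _ (fun t => (f t : ℝ → ℝ)) (fun t => (f t).2) z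
      (gains_mono (by simp) hJ) fun ω => ?_
    have h2 := h ω
    rw [hΦ] at h2
    have h3 : ∑ t ∈ f.support, (f t : ℝ → ℝ) (ω t)
        = ∑ t ∈ f.support ∪ J, (f t : ℝ → ℝ) (ω t) := by
      refine Finset.sum_subset Finset.subset_union_left fun t _ ht => ?_
      rw [Finsupp.notMem_support_iff.1 ht]; simp
    rw [← h3]; exact h2
  obtain ⟨G, hG, hpos⟩ := pos_extension (Ω := ℝ → ℝ) (T := (ℝ →₀ LG) × gains univ) Φ ℓ hΦpos
  have hstat : ∀ (t : ℝ) (f : LG), Φ (Finsupp.single t f, 0) = fun ω => (f : ℝ → ℝ) (ω t) := by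
    intro t f
    ext ω
    have : ((Finsupp.single t f).sum fun i f => (fun ω : ℝ → ℝ => (f : ℝ → ℝ) (ω i)))
        = fun ω => (f : ℝ → ℝ) (ω t) := Finsupp.sum_single_index rfl
    simpa [Φ, statEval] using congrFun this ω
  have hstat' : ∀ (t : ℝ) (f : LG), G (fun ω => (f : ℝ → ℝ) (ω t)) = ∫ x, (f : ℝ → ℝ) x ∂(ν t) := by
    intro t f
    rw [← hstat, hG]
    simp [ℓ, statPrice]
  have hgain : ∀ z : gains univ, G z = 0 := by
    intro z
    have : Φ (0, z) = z := by simp [Φ]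
    rw [← this, hG]; simp [ℓ]
  have hprob := hν.prob
  have hconst : ∀ c : ℝ, Continuous (fun _ : ℝ => c) ∧ ∃ C, ∀ x : ℝ, |c| ≤ C * (1 + |x|) :=
    fun c => ⟨continuous_const, |c|, fun x => by
      nlinarith [abs_nonneg c, abs_nonneg x, mul_nonneg (abs_nonneg c) (abs_nonneg x)]⟩
  refine ⟨G, ?_, ?_, ?_, ?_⟩
  · rintro F hF ⟨C, hC⟩
    refine hpos F hF ⟨(Finsupp.single 0 ⟨fun _ => C, hconst C⟩, 0), ?_⟩
    rw [hstat]
    exact hC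
  · have := hstat' 0 ⟨fun _ => 1, hconst 1⟩
    simpa using this
  · intro t f
    exact hstat' t ⟨f, bcf_LG f⟩
  · intro n r s t hr hst h K
    set F1 : (ℝ → ℝ) → ℝ := fun ω => h (fun i => ω (r i)) * (ω t - ω s)
    set F2 : (ℝ → ℝ) → ℝ :=
      fun ω => h (fun i => ω (r i)) * (trK K (ω t) - trK K (ω s)) with hF2
    set E : (ℝ → ℝ) → ℝ := fun ω => ‖h‖ * exK K (ω t) + ‖h‖ * exK K (ω s) with hE
    have hK : (0 : ℝ) ≤ K := Nat.cast_nonneg K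
    have hF1 : G F1 = 0 := by
      refine hgain ⟨F1, Submodule.subset_span ⟨s, trivial, t, trivial, hst,
        fun ω => h (fun i => ω (r i)), ?_, rfl⟩⟩
      intro x y hxy
      simp only
      congr 1
      ext i
      exact hxy _ (hr i)
    have hGE' : Φ (Finsupp.single t ⟨‖h‖ • exK K, Submodule.smul_mem _ _ (exK_LG hK)⟩ +
        Finsupp.single s ⟨‖h‖ • exK K, Submodule.smul_mem _ _ (exK_LG hK)⟩, 0) = E := by
      have := hstat t ⟨‖h‖ • exK K, Submodule.smul_mem _ _ (exK_LG hK)⟩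
      have h2 := hstat s ⟨‖h‖ • exK K, Submodule.smul_mem _ _ (exK_LG hK)⟩
      have h3 := congrArg₂ (· + ·) this h2
      simp only at h3
      rw [← map_add, Prod.mk_add_mk, add_zero] at h3
      rw [h3]
      ext ω
      simp [hE]
    have hGE : G E ≤ 2 * ‖h‖ * tailK ν K := by
      have h1 := hstat' t ⟨‖h‖ • exK K, Submodule.smul_mem _ _ (exK_LG hK)⟩
      have h2 := hstat' s ⟨‖h‖ • exK K, Submodule.smul_mem _ _ (exK_LG hK)⟩
      have h3 : E = (fun ω => (‖h‖ • exK K) (ω t)) + (fun ω => (‖h‖ • exK K) (ω s)) := rfl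
      rw [h3, map_add, h1, h2]
      simp only [Pi.smul_apply, smul_eq_mul, integral_const_mul]
      have := mul_le_mul_of_nonneg_left (hν.tail_le hK t) (norm_nonneg h)
      have := mul_le_mul_of_nonneg_left (hν.tail_le hK s) (norm_nonneg h)
      linarith
    have hdiff : ∀ ω, |F2 ω - F1 ω| ≤ E ω := by
      intro ω
      have e1 : F2 ω - F1 ω = h (fun i => ω (r i)) *
          ((ω s - trK K (ω s)) - (ω t - trK K (ω t))) := by simp only [F1, F2]; ring
      rw [e1, abs_mul]
      have a1 := h.norm_coe_le_norm (fun i => ω (r i))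
      rw [Real.norm_eq_abs] at a1
      have a2 : |(ω s - trK K (ω s)) - (ω t - trK K (ω t))| ≤ exK K (ω s) + exK K (ω t) := by
        rw [← trK_sub_abs hK, ← trK_sub_abs hK]
        exact abs_sub _ _
      calc _ ≤ ‖h‖ * (exK K (ω s) + exK K (ω t)) :=
            mul_le_mul a1 a2 (abs_nonneg _) (norm_nonneg _)
        _ = E ω := by simp only [hE]; ring
    have b1 : 0 ≤ G (E - (F2 - F1)) := by
      refine hpos _ (fun ω => ?_) ⟨(2 : ℝ) • _, le_of_le_of_eq ?_ (by rw [map_smul, hGE'])⟩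
      · have := (abs_le.1 (hdiff ω)).2
        simp only [Pi.zero_apply, Pi.sub_apply]; linarith
      · intro ω
        have := (abs_le.1 (hdiff ω)).1
        simp only [Pi.smul_apply, Pi.sub_apply, smul_eq_mul]; linarith
    have b2 : 0 ≤ G (E + (F2 - F1)) := by
      refine hpos _ (fun ω => ?_) ⟨(2 : ℝ) • _, le_of_le_of_eq ?_ (by rw [map_smul, hGE'])⟩
      · have := (abs_le.1 (hdiff ω)).1
        simp only [Pi.zero_apply, Pi.sub_apply, Pi.add_apply]; linarith
      · intro ω
        have := (abs_le.1 (hdiff ω)).2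
        simp only [Pi.smul_apply, Pi.sub_apply, Pi.add_apply, smul_eq_mul]; linarith
    rw [map_sub, map_sub, hF1] at b1
    rw [map_add, map_sub, hF1] at b2
    rw [abs_le]
    constructor <;> linarith

/-! ### Countably additive representation -/

lemma exists_ultra_ext {Ω : Type*} (φ : Ω → ℝ) (C : ℝ) (hφ : ∀ ω, |φ ω| ≤ C) :
    ∃ F : C(Ultrafilter Ω, ℝ), (∀ ω, F (pure ω) = φ ω) ∧
      (∀ u : Ultrafilter Ω, Tendsto φ u (𝓝 (F u))) ∧ ∀ u, |F u| ≤ C := by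
  let φ' : Ω → Icc (-C) C := fun ω => ⟨φ ω, abs_le.1 (hφ ω)⟩
  let F : C(Ultrafilter Ω, ℝ) := ⟨fun u => ((Ultrafilter.extend φ' u : Icc (-C) C) : ℝ),
    continuous_subtype_val.comp (continuous_ultrafilter_extend φ')⟩
  have h1 : ∀ ω, F (pure ω) = φ ω := by
    intro ω
    simp [F, φ', ultrafilter_extend_pure]
  refine ⟨F, h1, fun u => ?_, fun u => abs_le.2 (Ultrafilter.extend φ' u).2⟩
  have h2 : Tendsto (F ∘ pure) u (𝓝 (F u)) :=
    (F.continuous.tendsto u).comp (Ultrafilter.tendsto_pure_self u)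
  exact h2.congr h1

/-- Compactly supported cut-off on the line. -/
noncomputable def bump (k : ℕ) : BoundedContinuousFunction ℝ ℝ :=
  BoundedContinuousFunction.ofNormedAddCommGroup (fun x => max 0 (min 1 ((k : ℝ) + 1 - |x|)))
    (by fun_prop) 1 (fun x => by
      rw [Real.norm_eq_abs, abs_of_nonneg (le_max_left _ _)]
      exact max_le zero_le_one (min_le_left _ _))

lemma bump_apply (k : ℕ) (x : ℝ) : bump k x = max 0 (min 1 ((k : ℝ) + 1 - |x|)) := rfl

lemma bump_le (k : ℕ) (x : ℝ) : |bump k x| ≤ 1 := by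
  rw [bump_apply, abs_of_nonneg (le_max_left _ _)]
  exact max_le zero_le_one (min_le_left _ _)

lemma bump_tendsto (m : Measure ℝ) [IsProbabilityMeasure m] :
    Tendsto (fun k : ℕ => ∫ x, bump k x ∂m) atTop (𝓝 1) := by
  have : Tendsto (fun K : ℕ => ∫ x, bump K x ∂m) atTop (𝓝 (∫ x, (1 : ℝ) ∂m)) := by
    refine tendsto_integral_of_dominated_convergence (fun x => 1)
      (fun K => (bump K).continuous.aestronglyMeasurable) (integrable_const _)
      (fun K => Eventually.of_forall fun x => bump_le K x) (Eventually.of_forall fun x => ?_)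
    refine tendsto_const_nhds.congr' ?_
    obtain ⟨N, hN⟩ := exists_nat_ge |x|
    filter_upwards [eventually_ge_atTop N] with K hK
    have : (N : ℝ) ≤ K := by exact_mod_cast hK
    rw [bump_apply, min_eq_left (by linarith), max_eq_right zero_le_one]
  simpa using this

lemma exists_riesz {Ω : Type*} (G : (Ω → ℝ) →ₗ[ℝ] ℝ)
    (pos : ∀ F : Ω → ℝ, 0 ≤ F → (∃ C, ∀ ω, F ω ≤ C) → 0 ≤ G F) (one : G (fun _ => 1) = 1) :
    ∃ Q : @Measure (Ultrafilter Ω) (borel _), IsProbabilityMeasure Q ∧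
      ∀ F : C(Ultrafilter Ω, ℝ), ∫ u, F u ∂Q = G (fun ω => F (pure ω)) := by
  let : MeasurableSpace (Ultrafilter Ω) := borel _
  have : BorelSpace (Ultrafilter Ω) := ⟨rfl⟩
  let Λ₀ : CompactlySupportedContinuousMap (Ultrafilter Ω) ℝ →ₗ[ℝ] ℝ :=
    { toFun := fun F => G (fun ω => F (pure ω))
      map_add' := fun F F' => map_add G (fun ω => F (pure ω)) (fun ω => F' (pure ω))
      map_smul' := fun c F => map_smul G c (fun ω => F (pure ω)) }
  let Λ : CompactlySupportedContinuousMap (Ultrafilter Ω) ℝ →ₚ[ℝ] ℝ :=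
    PositiveLinearMap.mk₀ Λ₀ (fun F hF => by
      refine pos _ (fun ω => hF (pure ω)) ?_
      obtain ⟨C, hC⟩ := (isCompact_range F.continuous).bddAbove
      exact ⟨C, fun ω => hC ⟨_, rfl⟩⟩)
  have key : ∀ F : C(Ultrafilter Ω, ℝ), ∫ u, F u ∂(RealRMK.rieszMeasure Λ)
      = G (fun ω => F (pure ω)) := fun F =>
    RealRMK.integral_rieszMeasure Λ (CompactlySupportedContinuousMap.continuousMapEquiv F)
  refine ⟨RealRMK.rieszMeasure Λ, ⟨?_⟩, key⟩
  have h1 := key (ContinuousMap.const _ 1)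
  have h2 : (RealRMK.rieszMeasure Λ).real univ = 1 := by simpa [one] using h1
  rw [Measure.real, ENNReal.toReal_eq_one_iff] at h2
  exact h2

lemma exists_repr {Ω : Type*} {X : ℝ → Ω → ℝ} {ν : ℝ → Measure ℝ} {G : (Ω → ℝ) →ₗ[ℝ] ℝ}
    (hν : Pk ν) (hG : PosMart X ν G) :
    ∃ Q : @Measure (Ultrafilter Ω) (borel _), ∃ Y : ℝ → Ultrafilter Ω → ℝ,
      IsProbabilityMeasure Q ∧ (∀ t, @Measurable _ _ (borel _) _ (Y t)) ∧
      ∀ (n : ℕ) (r : Fin n → ℝ) (f : BoundedContinuousFunction (Fin n → ℝ) ℝ),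
        ∫ u, f (fun i => Y (r i) u) ∂Q = G (fun ω => f (fun i => X (r i) ω)) := by
  let : MeasurableSpace (Ultrafilter Ω) := borel _
  have : BorelSpace (Ultrafilter Ω) := ⟨rfl⟩
  obtain ⟨Q, hQ, hQi⟩ := exists_riesz G hG.pos hG.one
  have hb : ∀ t ω, |X t ω / (1 + |X t ω|)| ≤ 1 := by
    intro t ω
    have : 0 < 1 + |X t ω| := by positivity
    rw [abs_div, abs_of_pos this, div_le_one this]
    linarith
  choose F hF1 hF2 hF3 using fun t => exists_ultra_ext (fun ω => X t ω / (1 + |X t ω|)) 1 (hb t)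
  let Y : ℝ → Ultrafilter Ω → ℝ := fun t u => F t u / (1 - |F t u|)
  have hX : ∀ t ω, X t ω = (X t ω / (1 + |X t ω|)) / (1 - |X t ω / (1 + |X t ω|)|) := by
    intro t ω
    have : 0 < 1 + |X t ω| := by positivity
    rw [abs_div, abs_of_pos this]
    field_simp
    ring_nf
  have hlim : ∀ t u, |F t u| ≠ 1 → Tendsto (X t) u (𝓝 (Y t u)) := by
    intro t u h
    have h0 : (1 - |F t u|) ≠ 0 := fun h' => h (by linarith)
    have := (hF2 t u).div ((tendsto_const_nhds (x := (1:ℝ))).sub (hF2 t u).abs) h0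
    exact this.congr fun ω => (hX t ω).symm
  have hinf : ∀ t u, |F t u| = 1 → ∀ k : ℕ, ∀ᶠ ω in (u : Filter Ω), (k : ℝ) + 1 ≤ |X t ω| := by
    intro t u h k
    have h1 := (hF2 t u).abs
    rw [h] at h1
    have hk : (k + 1 : ℝ) / (1 + (k + 1)) < 1 := by
      rw [div_lt_one (by positivity)]; linarith
    filter_upwards [h1.eventually (lt_mem_nhds hk)] with ω hω
    have h2 : 0 < 1 + |X t ω| := by positivity
    rw [abs_div, abs_of_pos h2, div_lt_div_iff₀ (by positivity) h2] at hω
    nlinarith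
  have hae : ∀ t, ∀ᵐ u ∂Q, |F t u| ≠ 1 := by
    intro t
    have := hν.prob t
    have hm : MeasurableSet {u | |F t u| = 1} :=
      (isClosed_eq (F t).continuous.abs continuous_const).measurableSet
    have hle : ∀ k : ℕ, ∫ x, bump k x ∂(ν t) ≤ 1 - Q.real {u | |F t u| = 1} := by
      intro k
      obtain ⟨B, hB1, hB2, hB3⟩ := exists_ultra_ext (fun ω => bump k (X t ω)) 1
        (fun ω => bump_le k _)
      have e1 : ∫ u, B u ∂Q = ∫ x, bump k x ∂(ν t) := by
        rw [hQi, ← hG.marg]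
        congr 1
        ext ω
        exact hB1 ω
      rw [← e1, ← probReal_compl_eq_one_sub hm, ← integral_indicator_one hm.compl]
      refine integral_mono
        (Integrable.of_bound B.continuous.aestronglyMeasurable 1 (Eventually.of_forall hB3))
        ((integrable_const (1 : ℝ)).indicator hm.compl) fun u => ?_
      by_cases hu : |F t u| = 1
      · have h0 : B u = 0 := by
          refine tendsto_nhds_unique (hB2 u) (tendsto_const_nhds.congr' ?_)
          filter_upwards [hinf t u hu k] with ω hω
          rw [bump_apply, max_eq_left]
          exact (min_le_right _ _).trans (by linarith)
        rw [h0]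
        exact indicator_nonneg (fun _ _ => zero_le_one) u
      · rw [indicator_of_mem (show u ∈ {u | |F t u| = 1}ᶜ from hu)]
        exact (abs_le.1 (hB3 u)).2
    have h1 := le_of_tendsto' (bump_tendsto (ν t)) hle
    have h2 : Q.real {u | |F t u| = 1} = 0 := le_antisymm (by linarith) measureReal_nonneg
    rw [ae_iff]
    simp only [not_not]
    exact (measureReal_eq_zero_iff).1 h2
  refine ⟨Q, Y, hQ, fun t => ?_, fun n r f => ?_⟩
  · have := (F t).continuous.measurable
    exact this.div (measurable_const.sub (continuous_abs.measurable.comp this))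
  · obtain ⟨B, hB1, hB2, hB3⟩ := exists_ultra_ext (fun ω => f (fun i => X (r i) ω)) ‖f‖
      (fun ω => f.norm_coe_le_norm _)
    have e1 : ∫ u, B u ∂Q = G (fun ω => f (fun i => X (r i) ω)) := by
      rw [hQi]
      congr 1
      ext ω
      exact hB1 ω
    rw [← e1]
    refine integral_congr_ae ?_
    filter_upwards [ae_all_iff.2 fun i => hae (r i)] with u hu
    have h1 : Tendsto (fun ω => f (fun i => X (r i) ω)) u (𝓝 (f (fun i => Y (r i) u))) :=
      (f.continuous.tendsto _).comp (tendsto_pi_nhds.2 fun i => hlim (r i) u (hu i))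
    exact tendsto_nhds_unique h1 (hB2 u)

/-! ### Martingale processes -/

lemma trK_le_abs {K : ℝ} (hK : 0 ≤ K) (x : ℝ) : |trK K x| ≤ |x| := by
  unfold trK
  have h1 := neg_abs_le x
  have h2 := le_abs_self x
  have h3 := abs_nonneg x
  rw [abs_le]
  refine ⟨?_, max_le (by linarith) ((min_le_left _ _).trans h2)⟩
  rcases le_total x K with h | h
  · rw [min_eq_left h]; exact h1.trans (le_max_right _ _)
  · rw [min_eq_right h]; exact le_max_of_le_right (by linarith)

lemma trK_tendsto (x : ℝ) : Tendsto (fun K : ℕ => trK K x) atTop (𝓝 x) := by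
  refine tendsto_const_nhds.congr' ?_
  obtain ⟨N, hN⟩ := exists_nat_ge |x|
  filter_upwards [eventually_ge_atTop N] with K hK
  have h1 : (N : ℝ) ≤ K := by exact_mod_cast hK
  have h2 := abs_le.1 (hN.trans h1)
  unfold trK
  rw [min_eq_left h2.2, max_eq_right h2.1]

/-- A martingale-type process with marginals `ν`. -/
structure PM {E : Type*} [MeasurableSpace E] (Q : Measure E) (Y : ℝ → E → ℝ)
    (ν : ℝ → Measure ℝ) : Prop where
  prob : IsProbabilityMeasure Q
  meas : ∀ t, Measurable (Y t)
  law : ∀ t, Q.map (Y t) = ν t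
  mart : ∀ (n : ℕ) (r : Fin n → ℝ) (s t : ℝ), (∀ i, r i ≤ s) → s ≤ t →
    ∀ h : BoundedContinuousFunction (Fin n → ℝ) ℝ,
      ∫ e, h (fun i => Y (r i) e) * (Y t e - Y s e) ∂Q = 0

lemma PM.comp_int {E : Type*} [MeasurableSpace E] {Q : Measure E} {Y : ℝ → E → ℝ}
    {ν : ℝ → Measure ℝ} (h : PM Q Y ν) (hν : Pk ν) {f : ℝ → ℝ} (hf : f ∈ LG) (t : ℝ) :
    Integrable (fun e => f (Y t e)) Q := by
  have h1 := LG.integrable hν hf t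
  rw [← h.law] at h1
  exact h1.comp_measurable (h.meas t)

lemma PM.integral {E : Type*} [MeasurableSpace E] {Q : Measure E} {Y : ℝ → E → ℝ}
    {ν : ℝ → Measure ℝ} (h : PM Q Y ν) {f : ℝ → ℝ} (hf : Continuous f) (t : ℝ) :
    ∫ e, f (Y t e) ∂Q = ∫ x, f x ∂(ν t) := by
  rw [← h.law, integral_map (h.meas t).aemeasurable hf.aestronglyMeasurable]

lemma id_LG : (fun x : ℝ => x) ∈ LG :=
  ⟨continuous_id, 1, fun x => by linarith⟩

/-- The truncated martingale test function as a bounded continuous function. -/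
noncomputable def testBCF {n : ℕ} (h : BoundedContinuousFunction (Fin n → ℝ) ℝ) (K : ℕ) :
    BoundedContinuousFunction (Fin (n + 2) → ℝ) ℝ :=
  BoundedContinuousFunction.ofNormedAddCommGroup
    (fun x => h (fun i => x i.succ.succ) * (trK K (x 0) - trK K (x 1)))
    (by
      have h1 := h.continuous
      have h2 := trK_cont K
      exact (h1.comp (by fun_prop)).mul
        ((h2.comp (continuous_apply _)).sub (h2.comp (continuous_apply _))))
    (‖h‖ * (2 * K)) (fun x => by
      rw [norm_mul]
      have hK : (0 : ℝ) ≤ K := Nat.cast_nonneg K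
      refine mul_le_mul (h.norm_coe_le_norm _) ?_ (norm_nonneg _) (norm_nonneg _)
      rw [Real.norm_eq_abs]
      have := abs_sub (trK K (x 0)) (trK K (x 1))
      linarith [trK_abs_le hK (x 0), trK_abs_le hK (x 1)])

lemma exists_PM {Ω : Type*} {X : ℝ → Ω → ℝ} {ν : ℝ → Measure ℝ} {G : (Ω → ℝ) →ₗ[ℝ] ℝ}
    (hν : Pk ν) (hG : PosMart X ν G) :
    ∃ Q : @Measure (Ultrafilter Ω) (borel _), ∃ Y : ℝ → Ultrafilter Ω → ℝ,
      @PM _ (borel _) Q Y ν ∧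
      ∀ (n : ℕ) (r : Fin n → ℝ) (f : BoundedContinuousFunction (Fin n → ℝ) ℝ),
        ∫ u, f (fun i => Y (r i) u) ∂Q = G (fun ω => f (fun i => X (r i) ω)) := by
  obtain ⟨Q, Y, hQ, hY, hf⟩ := exists_repr hν hG
  let : MeasurableSpace (Ultrafilter Ω) := borel _
  refine ⟨Q, Y, ?_, hf⟩
  have hlaw : ∀ t, Q.map (Y t) = ν t := by
    intro t
    have := hν.prob t
    have : IsProbabilityMeasure (Q.map (Y t)) := Measure.isProbabilityMeasure_map (hY t).aemeasurable
    refine ext_of_forall_integral_eq_of_IsFiniteMeasure fun f => ?_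
    rw [integral_map (hY t).aemeasurable f.continuous.aestronglyMeasurable, ← hG.marg]
    exact hf 1 (fun _ => t) (f.compContinuous ⟨fun x => x 0, by fun_prop⟩)
  have hYint : ∀ t, Integrable (Y t) Q := by
    intro t
    have h1 := hν.int t
    rw [← hlaw] at h1
    exact h1.comp_measurable (hY t)
  refine ⟨hQ, hY, hlaw, ?_⟩
  intro n r s t hr hst h
  have h1 : Tendsto (fun K : ℕ => ∫ e, h (fun i => Y (r i) e) * (trK K (Y t e) - trK K (Y s e)) ∂Q)
      atTop (𝓝 (∫ e, h (fun i => Y (r i) e) * (Y t e - Y s e) ∂Q)) := by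
    have hhm : Measurable fun e => h (fun i => Y (r i) e) :=
      h.continuous.measurable.comp (measurable_pi_lambda _ fun i => hY (r i))
    refine tendsto_integral_of_dominated_convergence (fun e => ‖h‖ * (|Y t e| + |Y s e|))
      (fun K => (hhm.mul (((trK_cont K).measurable.comp (hY t)).sub
        ((trK_cont K).measurable.comp (hY s)))).aestronglyMeasurable)
      (((hYint t).abs.add (hYint s).abs).const_mul _)
      (fun K => Eventually.of_forall fun e => ?_) (Eventually.of_forall fun e => ?_)
    · rw [norm_mul]
      refine mul_le_mul (h.norm_coe_le_norm _) ?_ (norm_nonneg _) (norm_nonneg _)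
      have hK : (0 : ℝ) ≤ K := Nat.cast_nonneg K
      exact (abs_sub _ _).trans (add_le_add (trK_le_abs hK _) (trK_le_abs hK _))
    · exact ((trK_tendsto _).sub (trK_tendsto _)).const_mul _
  have h2 : ∀ K : ℕ, |∫ e, h (fun i => Y (r i) e) * (trK K (Y t e) - trK K (Y s e)) ∂Q|
      ≤ 2 * ‖h‖ * tailK ν K := by
    intro K
    have e1 := hf (n + 2) (Fin.cons t (Fin.cons s r)) (testBCF h K)
    have e2 : ∫ e, h (fun i => Y (r i) e) * (trK K (Y t e) - trK K (Y s e)) ∂Q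
      = G (fun ω => h (fun i => X (r i) ω) * (trK K (X t ω) - trK K (X s ω))) := e1
    rw [e2]
    exact hG.mart n r s t hr hst h K
  have h3 : Tendsto (fun K : ℕ => 2 * ‖h‖ * tailK ν K) atTop (𝓝 0) := by
    simpa using hν.tail_tendsto.const_mul (2 * ‖h‖)
  exact tendsto_nhds_unique h1 (squeeze_zero_norm h2 h3)

lemma setIntegral_eq_zero_of_cyl {E : Type*} [m0 : MeasurableSpace E] {Q : Measure E}
    [IsFiniteMeasure Q] {Y : ℝ → E → ℝ} {R : Set ℝ} (hY : ∀ t ∈ R, Measurable (Y t)) {D : E → ℝ}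
    (hDm : Measurable D) (hD : Integrable D Q)
    (hc : ∀ (n : ℕ) (r : Fin n → ℝ), (∀ i, r i ∈ R) →
      ∀ h : BoundedContinuousFunction (Fin n → ℝ) ℝ, ∫ e, h (fun i => Y (r i) e) * D e ∂Q = 0)
    {A : Set E} (hA : MeasurableSet[⨆ t ∈ R, MeasurableSpace.comap (Y t) inferInstance] A) :
    ∫ e in A, D e ∂Q = 0 := by
  classical
  set m1 := Q.withDensity fun e => ENNReal.ofReal (D e) with hm1
  set m2 := Q.withDensity fun e => ENNReal.ofReal (-D e) with hm2
  have f1 : IsFiniteMeasure m1 := isFiniteMeasure_withDensity_ofReal hD.2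
  have f2 : IsFiniteMeasure m2 := isFiniteMeasure_withDensity_ofReal hD.neg.2
  have hmap : ∀ (n : ℕ) (r : Fin n → ℝ), (∀ i, r i ∈ R) →
      m1.map (fun e i => Y (r i) e) = m2.map (fun e i => Y (r i) e) := by
    intro n r hr
    have hm : Measurable (fun e i => Y (r i) e) := measurable_pi_lambda _ fun i => hY _ (hr i)
    refine ext_of_forall_integral_eq_of_IsFiniteMeasure fun h => ?_
    rw [integral_map hm.aemeasurable h.continuous.aestronglyMeasurable,
      integral_map hm.aemeasurable h.continuous.aestronglyMeasurable]
    have key : ∀ D' : E → ℝ, Measurable D' →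
        ∫ e, h (fun i => Y (r i) e) ∂(Q.withDensity fun e => ENNReal.ofReal (D' e))
        = ∫ e, h (fun i => Y (r i) e) * max (D' e) 0 ∂Q := by
      intro D' hD'
      have := integral_withDensity_eq_integral_smul (μ := Q) (f := fun e => (D' e).toNNReal)
        hD'.real_toNNReal (fun e => h (fun i => Y (r i) e))
      refine this.trans (integral_congr_ae (Eventually.of_forall fun e => ?_))
      simp only [NNReal.smul_def, smul_eq_mul, Real.coe_toNNReal']
      ring
    have hi : ∀ D' : E → ℝ, Integrable D' Q →
        Integrable (fun e => h (fun i => Y (r i) e) * max (D' e) 0) Q := by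
      intro D' hD'
      exact hD'.pos_part.bdd_mul (h.continuous.measurable.comp hm).aestronglyMeasurable
        (Eventually.of_forall fun e => h.norm_coe_le_norm _)
    rw [hm1, hm2, key D hDm, key (fun e => - D e) hDm.neg, ← sub_eq_zero,
      ← integral_sub (hi D hD) (hi (fun e => - D e) hD.neg)]
    refine Eq.trans ?_ (hc n r hr h)
    refine integral_congr_ae (Eventually.of_forall fun e => ?_)
    simp only
    rw [← mul_sub]
    congr 1
    rcases le_total 0 (D e) with h0 | h0
    · rw [max_eq_left h0, max_eq_right (by linarith)]; ring
    · rw [max_eq_right h0, max_eq_left (by linarith)]; ring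
  have hle : (⨆ t ∈ R, MeasurableSpace.comap (Y t) inferInstance) ≤ m0 :=
    iSup₂_le fun t ht => (hY t ht).comap_le
  have hgen := generateFrom_piiUnionInter_measurableSet
    (fun t => MeasurableSpace.comap (Y t) inferInstance) R
  have hA' : m1 A = m2 A := by
    refine ext_on_measurableSpace_of_generate_finite m0 _ ?_ hle hgen.symm
      (isPiSystem_piiUnionInter _ (fun t => @MeasurableSpace.isPiSystem_measurableSet _ (_)) R)
      ?_ hA
    · rintro _ ⟨J, hJ, f, hf, rfl⟩
      choose! B hB hB' using hf
      let r : Fin J.card → ℝ := fun i => (J.equivFin.symm i : ℝ)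
      have hr : ∀ i, r i ∈ J := fun i => (J.equivFin.symm i).2
      have hm : Measurable (fun e i => Y (r i) e) :=
        measurable_pi_lambda _ fun i => hY _ (hJ (hr i))
      have e1 : (⋂ x ∈ J, f x) = (fun e i => Y (r i) e) ⁻¹' (univ.pi fun i => B (r i)) := by
        ext e
        simp only [mem_iInter, mem_preimage, mem_univ_pi]
        constructor
        · intro h i
          have := h (r i) (hr i)
          rw [← hB' _ (hr i)] at this
          exact this
        · intro h x hx
          rw [← hB' _ hx]
          have := h (J.equivFin ⟨x, hx⟩)
          simpa [r] using this
      have hms : MeasurableSet (univ.pi fun i => B (r i)) :=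
        MeasurableSet.univ_pi fun i => hB _ (hr i)
      rw [e1, ← Measure.map_apply hm hms, ← Measure.map_apply hm hms,
        hmap _ r fun i => hJ (hr i)]
    · have := congrArg (fun m => m univ) (hmap 0 Fin.elim0 (fun i => i.elim0))
      have hm : Measurable (fun (e : E) (i : Fin 0) => Y (Fin.elim0 i) e) :=
        measurable_pi_lambda _ fun i => i.elim0
      simpa [Measure.map_apply hm] using this
  have hAm : MeasurableSet A := hle _ hA
  rw [integral_eq_lintegral_pos_part_sub_lintegral_neg_part hD.integrableOn]
  rw [hm1, hm2, withDensity_apply _ hAm, withDensity_apply _ hAm] at hA'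
  rw [hA', sub_self]

/-! ### Regularity of paths along dyadic times: deterministic part -/

/-- Nonnegative dyadic numbers. -/
def dy : Set ℝ := {x | ∃ k n : ℕ, x = k / 2 ^ n}

lemma dy_eventually {x : ℝ} (hx : x ∈ dy) :
    ∃ n0 : ℕ, ∀ n ≥ n0, ∃ k : ℕ, x = k / 2 ^ n := by
  obtain ⟨k, n0, rfl⟩ := hx
  refine ⟨n0, fun n hn => ⟨k * 2 ^ (n - n0), ?_⟩⟩
  obtain ⟨m, rfl⟩ := Nat.exists_eq_add_of_le hn
  simp only [Nat.add_sub_cancel_left]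
  push_cast
  rw [pow_add]
  field_simp

/-- `x` makes at least `M` upcrossings of `(a,b)` along dyadics strictly between `c` and `d`. -/
def UC (x : ℝ → ℝ) (a b : ℝ) : ℕ → ℝ → ℝ → Prop
  | 0, c, d => c < d
  | M + 1, c, d => ∃ p ∈ dy, ∃ p' ∈ dy, p < p' ∧ p' < d ∧ x p < a ∧ b < x p' ∧ UC x a b M c p

lemma UC.mono_right {x : ℝ → ℝ} {a b : ℝ} {M : ℕ} {c d d' : ℝ} (h : UC x a b M c d)
    (hd : d ≤ d') : UC x a b M c d' := by
  cases M with
  | zero => exact lt_of_lt_of_le (show c < d from h) hd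
  | succ M =>
    obtain ⟨p, hp, p', hp', h1, h2, h3⟩ := h
    exact ⟨p, hp, p', hp', h1, h2.trans_le hd, h3⟩

lemma UC.mono_left {x : ℝ → ℝ} {a b : ℝ} {M : ℕ} {c c' d : ℝ} (h : UC x a b M c d)
    (hc : c' ≤ c) : UC x a b M c' d := by
  induction M generalizing d with
  | zero => exact lt_of_le_of_lt hc (show c < d from h)
  | succ M ih =>
    obtain ⟨p, hp, p', hp', h1, h2, h3, h4, h5⟩ := h
    exact ⟨p, hp, p', hp', h1, h2, h3, h4, ih h5⟩

lemma UC.lt {x : ℝ → ℝ} {a b : ℝ} {M : ℕ} {c d : ℝ} (h : UC x a b M c d) : c < d := by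
  induction M generalizing d with
  | zero => exact h
  | succ M ih =>
    obtain ⟨p, hp, p', hp', h1, h2, h3, h4, h5⟩ := h
    exact (ih h5).trans (h1.trans h2)

lemma UC.prepend {x : ℝ → ℝ} {a b : ℝ} {M : ℕ} {c d e q q' : ℝ} (h : UC x a b M c d)
    (hq : q ∈ dy) (hq' : q' ∈ dy) (heq : e < q) (hqq : q < q') (hqc : q' ≤ c) (hxq : x q < a)
    (hxq' : b < x q') : UC x a b (M + 1) e d := by
  induction M generalizing d with
  | zero => exact ⟨q, hq, q', hq', hqq, hqc.trans_lt h, hxq, hxq', heq⟩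
  | succ M ih =>
    obtain ⟨p, hp, p', hp', h1, h2, h3, h4, h5⟩ := h
    exact ⟨p, hp, p', hp', h1, h2, h3, h4, ih h5⟩

lemma UC_right {x : ℝ → ℝ} {a b t : ℝ} (ha : ∃ᶠ q in 𝓝[Ioi t ∩ dy] t, x q < a)
    (hb : ∃ᶠ q in 𝓝[Ioi t ∩ dy] t, b < x q) (M : ℕ) {d : ℝ} (hd : t < d) :
    ∃ c, t < c ∧ UC x a b M c d := by
  have aux : ∀ {p : ℝ → Prop}, (∃ᶠ q in 𝓝[Ioi t ∩ dy] t, p q) → ∀ c, t < c →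
      ∃ q ∈ dy, t < q ∧ q < c ∧ p q := by
    intro p hp c hc
    have h1 : ∀ᶠ q in 𝓝[Ioi t ∩ dy] t, q ∈ Ioi t ∩ dy := self_mem_nhdsWithin
    have h2 : ∀ᶠ q in 𝓝[Ioi t ∩ dy] t, q < c := mem_nhdsWithin_of_mem_nhds (Iio_mem_nhds hc)
    obtain ⟨q, ⟨hq1, hq2⟩, hq3⟩ := ((hp.and_eventually h1).and_eventually h2).exists
    exact ⟨q, hq2.2, hq2.1, hq3, hq1⟩
  induction M with
  | zero => exact ⟨(t + d) / 2, by linarith, show (t + d) / 2 < d by linarith⟩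
  | succ M ih =>
    obtain ⟨c, hc, h⟩ := ih
    obtain ⟨q', hq'd, hq't, hq'c, hxq'⟩ := aux hb c hc
    obtain ⟨q, hqd, hqt, hqq, hxq⟩ := aux ha q' hq't
    exact ⟨(t + q) / 2, by linarith,
      h.prepend hqd hq'd (by linarith) hqq hq'c.le hxq hxq'⟩

lemma UC_left {x : ℝ → ℝ} {a b t : ℝ} (ha : ∃ᶠ q in 𝓝[Iio t ∩ dy] t, x q < a)
    (hb : ∃ᶠ q in 𝓝[Iio t ∩ dy] t, b < x q) (M : ℕ) {c : ℝ} (hc : c < t) :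
    ∃ d, d < t ∧ UC x a b M c d := by
  have aux : ∀ {p : ℝ → Prop}, (∃ᶠ q in 𝓝[Iio t ∩ dy] t, p q) → ∀ c, c < t →
      ∃ q ∈ dy, q < t ∧ c < q ∧ p q := by
    intro p hp c hc
    have h1 : ∀ᶠ q in 𝓝[Iio t ∩ dy] t, q ∈ Iio t ∩ dy := self_mem_nhdsWithin
    have h2 : ∀ᶠ q in 𝓝[Iio t ∩ dy] t, c < q := mem_nhdsWithin_of_mem_nhds (Ioi_mem_nhds hc)
    obtain ⟨q, ⟨hq1, hq2⟩, hq3⟩ := ((hp.and_eventually h1).and_eventually h2).exists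
    exact ⟨q, hq2.2, hq2.1, hq3, hq1⟩
  induction M with
  | zero => exact ⟨(c + t) / 2, by linarith, show c < (c + t) / 2 by linarith⟩
  | succ M ih =>
    obtain ⟨d, hd, h⟩ := ih
    obtain ⟨q, hqd, hqt, hqq, hxq⟩ := aux ha d hd
    obtain ⟨q', hq'd, hq't, hq'c, hxq'⟩ := aux hb q hqt
    exact ⟨(q' + t) / 2, by linarith, q, hqd, q', hq'd, hq'c, by linarith, hxq, hxq',
      h.mono_right hqq.le⟩

/-- Existence of one-sided limits along dyadics on `[0,2]`. -/
def Reg (x : ℝ → ℝ) : Prop :=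
  (∀ t ∈ Ico (0 : ℝ) 2, ∃ L, Tendsto x (𝓝[Ioi t ∩ dy] t) (𝓝 L)) ∧
  (∀ t ∈ Ioc (0 : ℝ) 2, ∃ L, Tendsto x (𝓝[Iio t ∩ dy] t) (𝓝 L))

lemma reg_of_UC {x : ℝ → ℝ} (hb : ∃ C, ∀ q ∈ dy, q ≤ 2 → |x q| ≤ C)
    (hu : ∀ a b : ℚ, a < b → ∃ M, ¬ UC x a b M 0 2) : Reg x := by
  obtain ⟨C, hC⟩ := hb
  have hdense : Dense (range ((↑) : ℚ → ℝ)) := Rat.denseRange_cast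
  have bd : ∀ f : Filter ℝ, (∀ᶠ q in f, q ∈ dy ∧ q ≤ 2) →
      f.IsBoundedUnder (· ≤ ·) x ∧ f.IsBoundedUnder (· ≥ ·) x := by
    intro f hf
    constructor
    · refine ⟨C, ?_⟩
      rw [eventually_map]
      filter_upwards [hf] with q hq
      exact (abs_le.1 (hC q hq.1 hq.2)).2
    · refine ⟨-C, ?_⟩
      rw [eventually_map]
      filter_upwards [hf] with q hq
      exact (abs_le.1 (hC q hq.1 hq.2)).1
  constructor
  · intro t ht
    have h1 : ∀ᶠ q in 𝓝[Ioi t ∩ dy] t, q ∈ Ioi t ∩ dy := self_mem_nhdsWithin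
    have h2 : ∀ᶠ q in 𝓝[Ioi t ∩ dy] t, q < 2 := mem_nhdsWithin_of_mem_nhds (Iio_mem_nhds ht.2)
    obtain ⟨b1, b2⟩ := bd (𝓝[Ioi t ∩ dy] t) (by
      filter_upwards [h1, h2] with q hq hq'
      exact ⟨hq.2, hq'.le⟩)
    refine tendsto_of_no_upcrossings hdense ?_ b1 b2
    rintro _ ⟨a, rfl⟩ _ ⟨b, rfl⟩ hab ⟨h3, h4⟩
    obtain ⟨M, hM⟩ := hu a b (by exact_mod_cast hab)
    obtain ⟨c, hc, h5⟩ := UC_right h3 h4 M ht.2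
    exact hM (h5.mono_left (ht.1.trans hc.le))
  · intro t ht
    have h1 : ∀ᶠ q in 𝓝[Iio t ∩ dy] t, q ∈ Iio t ∩ dy := self_mem_nhdsWithin
    obtain ⟨b1, b2⟩ := bd (𝓝[Iio t ∩ dy] t) (by
      filter_upwards [h1] with q hq
      exact ⟨hq.2, (le_of_lt hq.1).trans ht.2⟩)
    refine tendsto_of_no_upcrossings hdense ?_ b1 b2
    rintro _ ⟨a, rfl⟩ _ ⟨b, rfl⟩ hab ⟨h3, h4⟩
    obtain ⟨M, hM⟩ := hu a b (by exact_mod_cast hab)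
    obtain ⟨c, hc, h5⟩ := UC_left h3 h4 M ht.1
    exact hM (h5.mono_right (hc.le.trans ht.2))

lemma UC.upcrossings {E : Type*} {Y : ℝ → E → ℝ} {a b : ℝ} (hab : a < b) {e : E} {M : ℕ} {d : ℝ}
    (h : UC (fun t => Y t e) a b M 0 d) :
    ∃ n0 : ℕ, ∀ n ≥ n0, ∀ N : ℕ, d ≤ N / 2 ^ n →
      M ≤ upcrossingsBefore a b (fun (k : ℕ) e => Y (k / 2 ^ n) e) N e := by
  induction M generalizing d with
  | zero => exact ⟨0, fun _ _ _ _ => Nat.zero_le _⟩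
  | succ M ih =>
    obtain ⟨p, hp, p', hp', h1, h2, h3, h4, h5⟩ := h
    obtain ⟨n0, hn0⟩ := ih h5
    obtain ⟨n1, hn1⟩ := dy_eventually hp
    obtain ⟨n2, hn2⟩ := dy_eventually hp'
    refine ⟨max n0 (max n1 n2), fun n hn N hN => ?_⟩
    obtain ⟨k, hk⟩ := hn1 n (by omega)
    obtain ⟨k', hk'⟩ := hn2 n (by omega)
    have hM := hn0 n (by omega) k hk.le
    have hpow : (0 : ℝ) < 2 ^ n := by positivity
    have hkk : k < k' := by
      rw [hk, hk', div_lt_div_iff_of_pos_right hpow] at h1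
      exact_mod_cast h1
    have hkN : k' < N := by
      have := h2.trans_le hN
      rw [hk', div_lt_div_iff_of_pos_right hpow] at this
      exact_mod_cast this
    have hlt := upcrossingsBefore_lt_of_exists_upcrossing (f := fun (k : ℕ) e => Y (k / 2 ^ n) e)
      (ω := e) hab (le_refl k) (by simpa [← hk] using h3) hkk.le (by simpa [← hk'] using h4)
    have hmono := upcrossingsBefore_mono (f := fun (k : ℕ) e => Y (k / 2 ^ n) e) hab
      (show k' + 1 ≤ N from hkN) e
    simp only at hmono
    omega

/-! ### Regularity of paths along dyadic times: probabilistic part -/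

section
variable {E : Type*} [MeasurableSpace E] {Q : Measure E} {Y : ℝ → E → ℝ} {ν : ℝ → Measure ℝ}

/-- The natural filtration along the grid `ℕ / 2^n`. -/
def gridFilt (hY : ∀ t, Measurable (Y t)) (n : ℕ) : Filtration ℕ ‹MeasurableSpace E› where
  seq k := ⨆ t ∈ Iic ((k : ℝ) / 2 ^ n), MeasurableSpace.comap (Y t) inferInstance
  mono' := by
    intro k k' hk
    refine biSup_mono fun t ht => mem_Iic.2 (le_trans (mem_Iic.1 ht) ?_)
    have : (k : ℝ) ≤ k' := by exact_mod_cast hk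
    gcongr
  le' k := iSup₂_le fun t _ => (hY t).comap_le

lemma PM.int (h : PM Q Y ν) (hν : Pk ν) (t : ℝ) : Integrable (Y t) Q :=
  h.comp_int hν id_LG t

lemma PM.grid_mart (h : PM Q Y ν) (hν : Pk ν) (n : ℕ) :
    Martingale (fun (k : ℕ) e => Y (k / 2 ^ n) e) (gridFilt h.meas n) Q := by
  have := h.prob
  refine martingale_of_setIntegral_eq_succ ?_ (fun k => h.int hν _) ?_
  · intro k
    refine Measurable.stronglyMeasurable ?_
    refine Measurable.mono (comap_measurable (Y (k / 2 ^ n))) ?_ le_rfl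
    exact le_iSup₂_of_le (f := fun t (_ : t ∈ Iic ((k : ℝ) / 2 ^ n)) =>
      MeasurableSpace.comap (Y t) inferInstance) ((k : ℝ) / 2 ^ n) (mem_Iic.2 le_rfl) le_rfl
  · intro k A hA
    have hst : (k : ℝ) / 2 ^ n ≤ ((k + 1 : ℕ) : ℝ) / 2 ^ n := by
      push_cast
      gcongr
      linarith
    have := setIntegral_eq_zero_of_cyl (Q := Q) (Y := Y) (R := Iic ((k : ℝ) / 2 ^ n))
      (fun t _ => h.meas t)
      (D := fun e => Y (((k + 1 : ℕ) : ℝ) / 2 ^ n) e - Y ((k : ℝ) / 2 ^ n) e)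
      ((h.meas _).sub (h.meas _)) ((h.int hν _).sub (h.int hν _))
      (fun m r hr f => h.mart m r _ _ hr hst f) hA
    rw [integral_sub (h.int hν _).integrableOn (h.int hν _).integrableOn] at this
    linarith

lemma PM.ae_no_UC (h : PM Q Y ν) (hν : Pk ν) {a b : ℝ} (hab : a < b) :
    ∀ᵐ e ∂Q, ∃ M, ¬ UC (fun t => Y t e) a b M 0 2 := by
  have := h.prob
  let U : ℕ → E → ℕ := fun n => upcrossingsBefore a b (fun (k : ℕ) e => Y (k / 2 ^ n) e) (2 ^ (n + 1))
  have hUm : ∀ n, Measurable (U n) := fun n =>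
    (h.grid_mart hν n).stronglyAdapted.measurable_upcrossingsBefore hab
  have hUi : ∀ n, Integrable (fun e => (U n e : ℝ)) Q := fun n =>
    (h.grid_mart hν n).stronglyAdapted.integrable_upcrossingsBefore hab
  have hpos : 0 < b - a := by linarith
  have hb : ∀ n, ∫⁻ e, ((U n e : ℕ) : ENNReal) ∂Q
      ≤ ENNReal.ofReal ((∫ e, (Y 2 e - a)⁺ ∂Q) / (b - a)) := by
    intro n
    have h1 := (h.grid_mart hν n).submartingale.mul_integral_upcrossingsBefore_le_integral_pos_part
      a b (2 ^ (n + 1))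
    have h2 : (((2 ^ (n + 1) : ℕ) : ℝ) / 2 ^ n) = 2 := by
      push_cast
      rw [pow_succ]
      field_simp
    rw [h2] at h1
    have h3 : ∫ e, (U n e : ℝ) ∂Q ≤ (∫ e, (Y 2 e - a)⁺ ∂Q) / (b - a) := by
      rw [le_div_iff₀ hpos, mul_comm]
      exact h1
    refine le_trans (le_of_eq ?_) (ENNReal.ofReal_le_ofReal h3)
    rw [ofReal_integral_eq_lintegral_ofReal (hUi n)
      (Eventually.of_forall fun e => Nat.cast_nonneg _)]
    refine lintegral_congr fun e => ?_
    rw [ENNReal.ofReal_natCast]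
  have hfat : ∫⁻ e, liminf (fun n => ((U n e : ℕ) : ENNReal)) atTop ∂Q
      ≤ ENNReal.ofReal ((∫ e, (Y 2 e - a)⁺ ∂Q) / (b - a)) := by
    refine (lintegral_liminf_le fun n => measurable_from_top.comp (hUm n)).trans ?_
    refine (liminf_le_liminf (v := fun _ => ENNReal.ofReal ((∫ e, (Y 2 e - a)⁺ ∂Q) / (b - a)))
      (Eventually.of_forall hb)).trans ?_
    simp
  have hfin : ∀ᵐ e ∂Q, liminf (fun n => ((U n e : ℕ) : ENNReal)) atTop < ⊤ :=
    ae_lt_top (Measurable.liminf fun n => measurable_from_top.comp (hUm n))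
      (ne_top_of_le_ne_top ENNReal.ofReal_ne_top hfat)
  filter_upwards [hfin] with e he
  by_contra hcon
  push Not at hcon
  refine absurd he (not_lt.2 (top_le_iff.2 ?_))
  refine ENNReal.eq_top_of_forall_nnreal_le fun r => ?_
  obtain ⟨M, hM⟩ := exists_nat_ge r
  refine le_trans (b := ((M : ℕ) : ENNReal)) (by exact_mod_cast hM) ?_
  obtain ⟨n0, hn0⟩ := (hcon M).upcrossings hab
  refine le_liminf_of_le (by isBoundedDefault) ?_
  filter_upwards [eventually_ge_atTop n0] with n hn
  have := hn0 n hn (2 ^ (n + 1)) (by push_cast; rw [pow_succ, mul_comm]; field_simp; norm_num)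
  exact Nat.cast_le.2 this

lemma PM.ae_bdd (h : PM Q Y ν) (hν : Pk ν) :
    ∀ᵐ e ∂Q, ∃ C, ∀ q ∈ dy, q ≤ 2 → |Y q e| ≤ C := by
  have := h.prob
  let A : ℕ → ℕ → Set E := fun l n => {e | ∃ k ∈ Finset.range (2 ^ (n + 1) + 1),
    ((l : ℝ) + 1) ≤ |Y (k / 2 ^ n) e|}
  let c : ENNReal := ENNReal.ofReal (∫ e, |Y 2 e| ∂Q)
  have hA : ∀ l n, Q (A l n) ≤ c / (l + 1) := by
    intro l n
    have hm := h.grid_mart hν n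
    have hsub : Submartingale (fun (k : ℕ) e => |Y (k / 2 ^ n) e|) (gridFilt h.meas n) Q :=
      hm.submartingale.sup hm.neg.submartingale
    have h1 := maximal_ineq hsub (fun k e => abs_nonneg _) (ε := (l : NNReal) + 1) (2 ^ (n + 1))
    have h2 : (((2 ^ (n + 1) : ℕ) : ℝ) / 2 ^ n) = 2 := by
      push_cast
      rw [pow_succ]
      field_simp
    have h3 : A l n = {ω | (((l : NNReal) + 1 : NNReal) : ℝ) ≤ (Finset.range (2 ^ (n + 1) + 1)).sup'
        Finset.nonempty_range_add_one fun k => |Y (k / 2 ^ n) ω|} := by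
      ext e
      simp [A, Finset.le_sup'_iff]
    rw [← h3, h2] at h1
    rw [ENNReal.le_div_iff_mul_le (by simp) (by simp), mul_comm]
    refine le_trans (by simpa using h1) (ENNReal.ofReal_le_ofReal ?_)
    exact setIntegral_le_integral (h.int hν 2).abs (Eventually.of_forall fun e => abs_nonneg _)
  have hmono : ∀ l, Monotone (A l) := by
    intro l
    refine monotone_nat_of_le_succ fun n => ?_
    rintro e ⟨k, hk, hke⟩
    refine ⟨2 * k, ?_, ?_⟩
    · rw [Finset.mem_range] at hk ⊢
      rw [pow_succ 2 (n + 1)]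
      omega
    · have : ((2 * k : ℕ) : ℝ) / 2 ^ (n + 1) = k / 2 ^ n := by
        push_cast
        rw [pow_succ]
        field_simp
      rw [this]
      exact hke
  have hU : ∀ l, Q (⋃ n, A l n) ≤ c / (l + 1) := by
    intro l
    rw [(hmono l).measure_iUnion]
    exact iSup_le (hA l)
  have hI : Q (⋂ l, ⋃ n, A l n) = 0 := by
    refine le_antisymm ?_ (zero_le)
    have ht : Tendsto (fun l : ℕ => c / ((l : ENNReal) + 1)) atTop (𝓝 0) := by
      have h1 : Tendsto (fun l : ℕ => c / ((l + 1 : ℕ) : ENNReal)) atTop (𝓝 (c / ⊤)) :=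
        (ENNReal.Tendsto.const_div (ENNReal.tendsto_nat_nhds_top.comp (tendsto_add_atTop_nat 1))
          (Or.inr ENNReal.ofReal_ne_top))
      simpa using h1
    exact ge_of_tendsto' ht fun l => (measure_mono (iInter_subset _ l)).trans (hU l)
  have hae : ∀ᵐ e ∂Q, e ∉ ⋂ l, ⋃ n, A l n := measure_eq_zero_iff_ae_notMem.1 hI
  filter_upwards [hae] with e he
  simp only [mem_iInter, mem_iUnion, not_forall, not_exists] at he
  obtain ⟨l, hl⟩ := he
  refine ⟨(l : ℝ) + 1, fun q hq hq2 => ?_⟩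
  obtain ⟨k, n, rfl⟩ := hq
  by_contra hcon
  refine hl n ⟨k, ?_, (not_le.1 hcon).le⟩
  rw [div_le_iff₀ (by positivity)] at hq2
  have : k ≤ 2 * 2 ^ n := by exact_mod_cast hq2
  rw [Finset.mem_range, pow_succ]
  omega

lemma PM.ae_reg (h : PM Q Y ν) (hν : Pk ν) : ∀ᵐ e ∂Q, Reg (fun t => Y t e) := by
  have h1 : ∀ᵐ e ∂Q, ∀ p : ℚ × ℚ, p.1 < p.2 → ∃ M, ¬ UC (fun t => Y t e) p.1 p.2 M 0 2 := by
    rw [ae_all_iff]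
    intro p
    by_cases hp : p.1 < p.2
    · filter_upwards [h.ae_no_UC hν (show ((p.1 : ℚ) : ℝ) < p.2 by exact_mod_cast hp)] with e he
      exact fun _ => he
    · exact Eventually.of_forall fun e he => absurd he hp
  filter_upwards [h1, h.ae_bdd hν] with e he hb
  exact reg_of_UC hb fun a b hab => he (a, b) hab

end

/-! ### Right-continuous versions -/

/-- Dyadic approximation from the right. -/
noncomputable def qn (t : ℝ) (n : ℕ) : ℝ := ((⌊t * 2 ^ n⌋₊ + 1 : ℕ) : ℝ) / 2 ^ n

lemma qn_mem (t : ℝ) (n : ℕ) : qn t n ∈ dy := ⟨_, n, rfl⟩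

lemma qn_gt (t : ℝ) (n : ℕ) : t < qn t n := by
  unfold qn
  rw [lt_div_iff₀ (by positivity)]
  push_cast
  exact Nat.lt_floor_add_one _

lemma qn_le {t : ℝ} (ht : 0 ≤ t) (n : ℕ) : qn t n ≤ t + (1 / 2) ^ n := by
  unfold qn
  rw [div_le_iff₀ (by positivity)]
  push_cast
  have h1 : (⌊t * 2 ^ n⌋₊ : ℝ) ≤ t * 2 ^ n := Nat.floor_le (by positivity)
  have h2 : ((1 : ℝ) / 2) ^ n * 2 ^ n = 1 := by rw [← mul_pow]; norm_num
  nlinarith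

lemma qn_tendsto {t : ℝ} (ht : 0 ≤ t) : Tendsto (qn t) atTop (𝓝 t) := by
  have h1 : Tendsto (fun n : ℕ => t + ((1 : ℝ) / 2) ^ n) atTop (𝓝 (t + 0)) :=
    (tendsto_pow_atTop_nhds_zero_of_lt_one (by norm_num) (by norm_num)).const_add t
  rw [add_zero] at h1
  exact tendsto_of_tendsto_of_tendsto_of_le_of_le tendsto_const_nhds h1
    (fun n => (qn_gt t n).le) (fun n => qn_le ht n)

lemma qn_tendsto_dy {t : ℝ} (ht : 0 ≤ t) : Tendsto (qn t) atTop (𝓝[Ioi t ∩ dy] t) :=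
  tendsto_nhdsWithin_iff.2 ⟨qn_tendsto ht, Eventually.of_forall fun n => ⟨qn_gt t n, qn_mem t n⟩⟩

lemma dy_neBot {t : ℝ} (ht : 0 ≤ t) : (𝓝[Ioi t ∩ dy] t).NeBot := (qn_tendsto_dy ht).neBot

/-- The right limit along dyadics. -/
noncomputable def rl (x : ℝ → ℝ) (t : ℝ) : ℝ := limUnder (𝓝[Ioi t ∩ dy] t) x

lemma rl_tendsto {x : ℝ → ℝ} (hx : Reg x) {t : ℝ} (ht : t ∈ Ico (0 : ℝ) 2) :
    Tendsto x (𝓝[Ioi t ∩ dy] t) (𝓝 (rl x t)) := by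
  have := dy_neBot ht.1
  exact tendsto_nhds_limUnder (hx.1 t ht)

lemma rl_mem {x : ℝ → ℝ} (hx : Reg x) {U V : Set ℝ} (hU : IsOpen U) (hV : IsClosed V)
    (h : ∀ q ∈ U, q ∈ dy → x q ∈ V) {s : ℝ} (hs : s ∈ U) (hs' : s ∈ Ico (0 : ℝ) 2) :
    rl x s ∈ V := by
  have := dy_neBot hs'.1
  refine hV.mem_of_tendsto (rl_tendsto hx hs') ?_
  have h1 : ∀ᶠ q in 𝓝[Ioi s ∩ dy] s, q ∈ Ioi s ∩ dy := self_mem_nhdsWithin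
  have h2 : ∀ᶠ q in 𝓝[Ioi s ∩ dy] s, q ∈ U := mem_nhdsWithin_of_mem_nhds (hU.mem_nhds hs)
  filter_upwards [h1, h2] with q hq hq'
  exact h q hq' hq.2

lemma rl_cadlag {x : ℝ → ℝ} (hx : Reg x) : CadlagOn01 (rl x) := by
  constructor
  · intro t ht
    have ht2 : t ∈ Ico (0 : ℝ) 2 := ⟨ht.1, by linarith [ht.2]⟩
    rw [(closed_nhds_basis (rl x t)).tendsto_right_iff]
    rintro V ⟨hV, hVc⟩
    obtain ⟨O, hO, htO, hOV⟩ := mem_nhdsWithin.1 (rl_tendsto hx ht2 hV)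
    have h1 : ∀ᶠ s in 𝓝[>] t, s ∈ O := mem_nhdsWithin_of_mem_nhds (hO.mem_nhds htO)
    have h2 : ∀ᶠ s in 𝓝[>] t, s < 2 := mem_nhdsWithin_of_mem_nhds (Iio_mem_nhds ht2.2)
    filter_upwards [h1, h2, self_mem_nhdsWithin] with s hs1 hs2 hs3
    exact rl_mem hx (hO.inter isOpen_Ioi) hVc (fun q hq hqd => hOV ⟨hq.1, hq.2, hqd⟩) ⟨hs1, hs3⟩
      ⟨ht.1.trans (le_of_lt hs3), hs2⟩
  · intro t ht
    have ht2 : t ∈ Ioc (0 : ℝ) 2 := ⟨ht.1, by linarith [ht.2]⟩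
    obtain ⟨L, hL⟩ := hx.2 t ht2
    refine ⟨L, ?_⟩
    rw [(closed_nhds_basis L).tendsto_right_iff]
    rintro V ⟨hV, hVc⟩
    obtain ⟨O, hO, htO, hOV⟩ := mem_nhdsWithin.1 (hL hV)
    have h1 : ∀ᶠ s in 𝓝[<] t, s ∈ O := mem_nhdsWithin_of_mem_nhds (hO.mem_nhds htO)
    have h2 : ∀ᶠ s in 𝓝[<] t, 0 < s := mem_nhdsWithin_of_mem_nhds (Ioi_mem_nhds ht2.1)
    filter_upwards [h1, h2, self_mem_nhdsWithin] with s hs1 hs2 hs3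
    exact rl_mem hx (hO.inter isOpen_Iio) hVc (fun q hq hqd => hOV ⟨hq.1, hq.2, hqd⟩) ⟨hs1, hs3⟩
      ⟨hs2.le, lt_of_lt_of_le hs3 ht2.2⟩

lemma tendsto_of_tail {a : ℕ → ℝ} {τ : ℕ → ℝ} {b : ℕ → ℕ → ℝ}
    (h : ∀ K n, |a n| ≤ |b K n| + 2 * τ K) (hb : ∀ K, Tendsto (b K) atTop (𝓝 0))
    (hτ : Tendsto τ atTop (𝓝 0)) : Tendsto a atTop (𝓝 0) := by
  rw [Metric.tendsto_atTop]
  intro ε hε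
  obtain ⟨K, hK⟩ := (hτ.eventually (gt_mem_nhds (show 0 < ε / 4 by linarith))).exists
  obtain ⟨N, hN⟩ := Metric.tendsto_atTop.1 (hb K) (ε / 2) (by linarith)
  refine ⟨N, fun n hn => ?_⟩
  have h1 := hN n hn
  have h2 := h K n
  rw [Real.dist_eq, sub_zero] at h1 ⊢
  linarith

/-- The strictly convex test function. -/
noncomputable def phi (x : ℝ) : ℝ := √(1 + x ^ 2)

lemma phi_cont : Continuous phi := by unfold phi; fun_prop

lemma phi_sq (x : ℝ) : phi x ^ 2 = 1 + x ^ 2 := Real.sq_sqrt (by positivity)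

lemma phi_ge (x : ℝ) : 1 ≤ phi x := Real.one_le_sqrt.2 (by nlinarith [sq_nonneg x])

lemma abs_le_phi (x : ℝ) : |x| ≤ phi x := by
  refine Real.abs_le_sqrt (by linarith)

lemma phi_le (x : ℝ) : phi x ≤ 1 + |x| := by
  refine Real.sqrt_le_iff.2 ⟨by positivity, ?_⟩
  nlinarith [sq_abs x, abs_nonneg x]

lemma phi_LG : phi ∈ LG :=
  ⟨phi_cont, 1, fun x => by
    rw [abs_of_nonneg (by linarith [phi_ge x])]; linarith [phi_le x]⟩

/-- The derivative of `phi` as a bounded continuous function. -/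
noncomputable def phi' : BoundedContinuousFunction (Fin 1 → ℝ) ℝ :=
  BoundedContinuousFunction.ofNormedAddCommGroup (fun x => x 0 / phi (x 0))
    (by
      have := phi_cont
      refine Continuous.div (by fun_prop) (by fun_prop) fun x => ?_
      linarith [phi_ge (x 0)]) 1 (fun x => by
      have := phi_ge (x 0)
      rw [Real.norm_eq_abs, abs_div, abs_of_pos (by linarith : 0 < phi (x 0)),
        div_le_one (by linarith)]
      exact abs_le_phi _)

/-- The Bregman gap of `phi`. -/
noncomputable def gap (y x : ℝ) : ℝ := phi y - phi x - x / phi x * (y - x)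

lemma gap_eq (y x : ℝ) : gap y x = (phi x * phi y - (1 + x * y)) / phi x := by
  have h1 := phi_ge x
  have h2 := phi_sq x
  unfold gap
  rw [eq_div_iff (by linarith)]
  have h3 : x / phi x * (y - x) * phi x = x * (y - x) := by
    field_simp
  rw [sub_mul, h3]
  nlinarith

lemma gap_nonneg (y x : ℝ) : 0 ≤ gap y x := by
  rw [gap_eq]
  have h1 := phi_ge x
  have h2 := phi_ge y
  refine div_nonneg ?_ (by linarith)
  have h3 : (1 + x * y) ^ 2 ≤ (phi x * phi y) ^ 2 := by
    rw [mul_pow, phi_sq, phi_sq]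
    nlinarith [sq_nonneg (x - y)]
  have h4 := abs_le_of_sq_le_sq h3 (by nlinarith)
  linarith [le_abs_self (1 + x * y)]

lemma gap_eq_zero {y x : ℝ} (h : gap y x = 0) : y = x := by
  rw [gap_eq] at h
  have h1 := phi_ge x
  have h3 : phi x * phi y = 1 + x * y := by
    rcases div_eq_zero_iff.1 h with h | h <;> linarith
  have h4 : (phi x * phi y) ^ 2 = (1 + x * y) ^ 2 := by rw [h3]
  rw [mul_pow, phi_sq, phi_sq] at h4
  have h5 : (x - y) ^ 2 = 0 := by linarith [h4, show (1 + x^2) * (1 + y^2) - (1 + x*y)^2 = (x-y)^2 by ring]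
  have := pow_eq_zero_iff (two_ne_zero) |>.1 h5
  linarith

lemma gap_cont : Continuous fun p : ℝ × ℝ => gap p.1 p.2 := by
  unfold gap
  have h1 := phi_cont
  have h2 : Continuous fun p : ℝ × ℝ => p.2 / phi p.2 :=
    Continuous.div (by fun_prop) (by fun_prop) fun p => by linarith [phi_ge p.2]
  fun_prop

lemma gap_tendsto {u : ℕ → ℝ} {z y : ℝ} (h : Tendsto u atTop (𝓝 z)) :
    Tendsto (fun n => gap (u n) y) atTop (𝓝 (gap z y)) := by
  have h1 : Continuous fun x : ℝ => gap x y :=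
    gap_cont.comp (continuous_id.prodMk continuous_const)
  exact (h1.tendsto z).comp h

lemma Pk.phi_tendsto {ν : ℝ → Measure ℝ} (hν : Pk ν) {t : ℝ} {u : ℕ → ℝ}
    (hu : Tendsto u atTop (𝓝[>] t)) :
    Tendsto (fun n => ∫ x, phi x ∂(ν (u n)) - ∫ x, phi x ∂(ν t)) atTop (𝓝 0) := by
  have hK0 : ∀ K : ℕ, (0 : ℝ) ≤ K := fun K => Nat.cast_nonneg K
  let f : ℕ → BoundedContinuousFunction ℝ ℝ := fun K =>
    BoundedContinuousFunction.ofNormedAddCommGroup (fun x => phi x - exK K x)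
      (phi_cont.sub (exK_cont K)) (1 + K) (fun x => by
        have h1 := phi_le x
        have h2 := abs_le_phi x
        have h3 := exK_le_abs (hK0 K) x
        have h4 : |x| - K ≤ exK K x := le_max_left _ _
        rw [Real.norm_eq_abs, abs_le]
        constructor <;> linarith [hK0 K])
  have hf : ∀ K v, ∫ x, f K x ∂(ν v) = ∫ x, phi x ∂(ν v) - ∫ x, exK K x ∂(ν v) := fun K v =>
    integral_sub (LG.integrable hν phi_LG v) (LG.integrable hν (exK_LG (hK0 K)) v)
  refine tendsto_of_tail (τ := fun K => tailK ν K)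
    (b := fun K n => ∫ x, f K x ∂(ν (u n)) - ∫ x, f K x ∂(ν t)) ?_ ?_ hν.tail_tendsto
  · intro K n
    rw [hf, hf]
    have h1 := hν.tail_le (hK0 K) (u n)
    have h2 := hν.tail_le (hK0 K) t
    have h3 : 0 ≤ ∫ x, exK K x ∂(ν (u n)) := integral_nonneg fun x => exK_nonneg K x
    have h4 : 0 ≤ ∫ x, exK K x ∂(ν t) := integral_nonneg fun x => exK_nonneg K x
    set p := ∫ x, phi x ∂(ν (u n))
    set p' := ∫ x, phi x ∂(ν t)
    set r := ∫ x, exK K x ∂(ν (u n))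
    set r' := ∫ x, exK K x ∂(ν t)
    have h5 : p - p' = (p - r - (p' - r')) + (r - r') := by ring
    have h6 : |r - r'| ≤ 2 * tailK ν K := by rw [abs_le]; constructor <;> linarith
    rw [h5]
    exact (abs_add_le _ _).trans (by linarith)
  · intro K
    have := ((hν.rc t (f K)).comp hu).sub_const (∫ x, f K x ∂(ν t))
    simpa using this

section
variable {E : Type*} [MeasurableSpace E] {Q : Measure E} {Y : ℝ → E → ℝ} {ν : ℝ → Measure ℝ}

lemma PM.rl_ae_aux (h : PM Q Y ν) (hν : Pk ν) {t : ℝ}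
    (ht : t ∈ Ico (0 : ℝ) 2) {Z : E → ℝ} (hmeas : Measurable Z)
    (hlim : ∀ e, Tendsto (fun n => Y (qn t n) e) atTop (𝓝 (Z e))) : Z =ᵐ[Q] Y t := by
  have := h.prob
  have hgc := gap_cont
  have hgm : ∀ n, Measurable fun e => ENNReal.ofReal (gap (Y (qn t n) e) (Y t e)) := fun n =>
    (hgc.measurable.comp ((h.meas _).prodMk (h.meas t))).ennreal_ofReal
  have hgi : ∀ n, ∫⁻ e, ENNReal.ofReal (gap (Y (qn t n) e) (Y t e)) ∂Q
      = ENNReal.ofReal (∫ x, phi x ∂(ν (qn t n)) - ∫ x, phi x ∂(ν t)) := by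
    intro n
    have i1 := h.comp_int hν phi_LG (qn t n)
    have i2 := h.comp_int hν phi_LG t
    have i3 : Integrable (fun e => phi' (fun _ : Fin 1 => Y t e) * (Y (qn t n) e - Y t e)) Q := by
      refine ((h.int hν _).sub (h.int hν t)).bdd_mul (c := ‖phi'‖) ?_
        (Eventually.of_forall fun e => phi'.norm_coe_le_norm _)
      exact (phi'.continuous.measurable.comp
        (measurable_pi_lambda _ fun _ => h.meas t)).aestronglyMeasurable
    have e1 := h.mart 1 (fun _ => t) t (qn t n) (fun _ => le_rfl) (qn_gt t n).le phi'
    have e2 : ∫ e, gap (Y (qn t n) e) (Y t e) ∂Q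
        = ∫ x, phi x ∂(ν (qn t n)) - ∫ x, phi x ∂(ν t) := by
      have e3 : ∫ e, gap (Y (qn t n) e) (Y t e) ∂Q
          = ∫ e, (phi (Y (qn t n) e) - phi (Y t e)) ∂Q
            - ∫ e, phi' (fun _ : Fin 1 => Y t e) * (Y (qn t n) e - Y t e) ∂Q :=
        integral_sub (i1.sub i2) i3
      rw [e3, e1, sub_zero, integral_sub i1 i2, h.integral phi_cont, h.integral phi_cont]
    have ig : Integrable (fun e => gap (Y (qn t n) e) (Y t e)) Q := (i1.sub i2).sub i3
    rw [← e2, ofReal_integral_eq_lintegral_ofReal ig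
      (Eventually.of_forall fun e => gap_nonneg _ _)]
  have hfat : ∫⁻ e, ENNReal.ofReal (gap (Z e) (Y t e)) ∂Q = 0 := by
    have hpt : ∀ e, ENNReal.ofReal (gap (Z e) (Y t e))
        = liminf (fun n => ENNReal.ofReal (gap (Y (qn t n) e) (Y t e))) atTop := by
      intro e
      refine (Tendsto.liminf_eq ?_).symm
      have h2 := gap_tendsto (y := Y t e) (hlim e)
      exact ENNReal.tendsto_ofReal h2
    simp_rw [hpt]
    refine le_antisymm ((lintegral_liminf_le hgm).trans ?_) zero_le
    simp_rw [hgi]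
    refine le_of_eq (Tendsto.liminf_eq ?_)
    have hu : Tendsto (qn t) atTop (𝓝[>] t) :=
      tendsto_nhdsWithin_iff.2 ⟨qn_tendsto ht.1, Eventually.of_forall fun n => qn_gt t n⟩
    simpa using ENNReal.tendsto_ofReal (hν.phi_tendsto hu)
  have hzm : Measurable fun e => ENNReal.ofReal (gap (Z e) (Y t e)) :=
    (hgc.measurable.comp (hmeas.prodMk (h.meas t))).ennreal_ofReal
  rw [lintegral_eq_zero_iff hzm] at hfat
  filter_upwards [hfat] with e he
  refine gap_eq_zero (le_antisymm ?_ (gap_nonneg _ _))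
  simpa using he

lemma PM.rl_ae (h : PM Q Y ν) (hν : Pk ν) (hR : ∀ e, Reg (fun t => Y t e)) {t : ℝ}
    (ht : t ∈ Ico (0 : ℝ) 2) : (fun e => rl (fun t => Y t e) t) =ᵐ[Q] Y t := by
  have := h.prob
  have hlim : ∀ e, Tendsto (fun n => Y (qn t n) e) atTop (𝓝 (rl (fun t => Y t e) t)) := fun e =>
    (rl_tendsto (hR e) ht).comp (qn_tendsto_dy ht.1)
  have hmeas : Measurable (fun e => rl (fun t => Y t e) t) :=
    measurable_of_tendsto_metrizable (fun n => h.meas (qn t n)) (tendsto_pi_nhds.2 hlim)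
  exact h.rl_ae_aux hν ht hmeas hlim

lemma PM.exists_reg (h : PM Q Y ν) (hν : Pk ν) :
    ∃ Y' : ℝ → E → ℝ, PM Q Y' ν ∧ (∀ e, Reg (fun t => Y' t e)) ∧ ∀ t, Y' t =ᵐ[Q] Y t := by
  classical
  obtain ⟨S, hS, hSm, hSr⟩ := (h.ae_reg hν).exists_measurable_mem
  have hae : ∀ t, S.indicator (Y t) =ᵐ[Q] Y t := by
    intro t
    filter_upwards [hS] with e he
    exact indicator_of_mem he _
  refine ⟨fun t => S.indicator (Y t), ⟨h.prob, fun t => (h.meas t).indicator hSm, fun t => ?_, ?_⟩,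
    fun e => ?_, hae⟩
  · rw [Measure.map_congr (hae t), h.law]
  · intro n r s t hr hst f
    rw [← h.mart n r s t hr hst f]
    refine integral_congr_ae ?_
    filter_upwards [hS] with e he
    simp only [indicator_of_mem he]
  · by_cases he : e ∈ S
    · simp only [indicator_of_mem he]
      exact hSr e he
    · simp only [indicator_of_notMem he]
      exact ⟨fun t _ => ⟨0, tendsto_const_nhds⟩, fun t _ => ⟨0, tendsto_const_nhds⟩⟩

end

/-! ### Laws on the path space -/

/-- Clamp to `[0,1]`. -/
noncomputable def cl (t : ℝ) : ℝ := max 0 (min 1 t)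

lemma cl_mem (t : ℝ) : cl t ∈ Icc (0 : ℝ) 1 :=
  ⟨le_max_left _ _, max_le zero_le_one (min_le_left _ _)⟩

lemma cl_of_mem {t : ℝ} (ht : t ∈ Icc (0 : ℝ) 1) : cl t = t := by
  unfold cl
  rw [min_eq_right ht.2, max_eq_right ht.1]

lemma cl_mono : Monotone cl := fun _ _ h => max_le_max le_rfl (min_le_min le_rfl h)

lemma eval_meas {t : ℝ} (ht : t ∈ Icc (0 : ℝ) 1) : Measurable fun g : Dspace => g.1 t := by
  rw [measurable_iff_comap_le]
  exact le_iSup₂_of_le (f := fun t (_ : t ∈ Icc (0 : ℝ) 1) =>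
    MeasurableSpace.comap (fun g : Dspace => g.1 t) inferInstance) t ht le_rfl

lemma measurable_to_D {E : Type*} [MeasurableSpace E] {Ψ : E → Dspace}
    (h : ∀ t ∈ Icc (0 : ℝ) 1, Measurable fun e => (Ψ e).1 t) : Measurable Ψ := by
  rw [measurable_iff_le_map]
  refine iSup₂_le fun t ht => ?_
  rw [← measurable_iff_le_map, measurable_comap_iff]
  exact h t ht

/-- The clamped coordinate process. -/
noncomputable def Sc (t : ℝ) (g : Dspace) : ℝ := g.1 (cl t)

lemma Sc_meas (t : ℝ) : Measurable (Sc t) := eval_meas (cl_mem t)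

lemma PM.exists_D {E : Type*} [MeasurableSpace E] {Q : Measure E} {Y : ℝ → E → ℝ}
    {ν : ℝ → Measure ℝ} (h : PM Q Y ν) (hν : Pk ν) (hcl : ∀ t, ν (cl t) = ν t) :
    ∃ P : Measure Dspace, PM P Sc ν ∧
      ∀ (n : ℕ) (r : Fin n → ℝ) (f : BoundedContinuousFunction (Fin n → ℝ) ℝ),
        ∫ g, f (fun i => Sc (r i) g) ∂P = ∫ e, f (fun i => Y (cl (r i)) e) ∂Q := by
  obtain ⟨Y', h', hR, hY⟩ := h.exists_reg hν
  have hm2 : ∀ t, cl t ∈ Ico (0 : ℝ) 2 := fun t =>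
    ⟨(cl_mem t).1, (cl_mem t).2.trans_lt (by norm_num)⟩
  let Ψ : E → Dspace := fun e => ⟨rl (fun t => Y' t e), rl_cadlag (hR e)⟩
  have hΨ : Measurable Ψ := by
    refine measurable_to_D fun t ht => ?_
    refine measurable_of_tendsto_metrizable (fun n => h'.meas (qn t n)) (tendsto_pi_nhds.2 ?_)
    intro e
    exact (rl_tendsto (hR e) ⟨ht.1, ht.2.trans_lt (by norm_num)⟩).comp (qn_tendsto_dy ht.1)
  have hΨae : ∀ t, (fun e => Sc t (Ψ e)) =ᵐ[Q] Y' (cl t) := fun t => h'.rl_ae hν hR (hm2 t)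
  have hΨall : ∀ (n : ℕ) (r : Fin n → ℝ),
      ∀ᵐ e ∂Q, (fun i => Sc (r i) (Ψ e)) = fun i => Y' (cl (r i)) e := by
    intro n r
    have : ∀ᵐ e ∂Q, ∀ i, Sc (r i) (Ψ e) = Y' (cl (r i)) e :=
      ae_all_iff.2 fun i => hΨae (r i)
    filter_upwards [this] with e he
    exact funext he
  have hprob := h.prob
  refine ⟨Q.map Ψ, ⟨Measure.isProbabilityMeasure_map hΨ.aemeasurable, Sc_meas, fun t => ?_, ?_⟩, ?_⟩
  · rw [Measure.map_map (Sc_meas t) hΨ, ← hcl, ← h'.law]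
    exact Measure.map_congr (hΨae t)
  · intro n r s t hr hst f
    rw [integral_map hΨ.aemeasurable]
    · rw [← h'.mart n (fun i => cl (r i)) (cl s) (cl t) (fun i => cl_mono (hr i)) (cl_mono hst) f]
      refine integral_congr_ae ?_
      filter_upwards [hΨall n r, hΨae s, hΨae t] with e h1 h2 h3
      rw [h1, h2, h3]
    · refine Measurable.aestronglyMeasurable ?_
      exact (f.continuous.measurable.comp (measurable_pi_lambda _ fun i => Sc_meas _)).mul
        ((Sc_meas t).sub (Sc_meas s))
  · intro n r f
    rw [integral_map hΨ.aemeasurable]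
    · refine integral_congr_ae ?_
      have : ∀ᵐ e ∂Q, ∀ i, Y' (cl (r i)) e = Y (cl (r i)) e := ae_all_iff.2 fun i => hY _
      filter_upwards [hΨall n r, this] with e h1 h2
      rw [h1, funext h2]
    · refine Measurable.aestronglyMeasurable ?_
      exact (f.continuous.measurable.comp (measurable_pi_lambda _ fun i => Sc_meas _))

/-! ### Martingale measures on the path space -/

lemma PM.trunc_bound {E : Type*} [MeasurableSpace E] {Q : Measure E} {Y : ℝ → E → ℝ}
    {ν : ℝ → Measure ℝ} (h : PM Q Y ν) (hν : Pk ν) {w : E → ℝ} (hw : Measurable w) {C : ℝ}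
    (hC : ∀ e, |w e| ≤ C) (hC0 : 0 ≤ C) (s t : ℝ) (K : ℕ) :
    |∫ e, w e * (Y t e - Y s e) ∂Q - ∫ e, w e * (trK K (Y t e) - trK K (Y s e)) ∂Q|
      ≤ 2 * C * tailK ν K := by
  have := h.prob
  have hK : (0 : ℝ) ≤ K := Nat.cast_nonneg K
  have hb : ∀ {D : E → ℝ}, Integrable D Q → Integrable (fun e => w e * D e) Q := fun hD =>
    hD.bdd_mul (c := C) hw.aestronglyMeasurable (Eventually.of_forall hC)
  have htr : trK (K : ℝ) ∈ LG := ⟨trK_cont _, 1, fun x => by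
    linarith [trK_le_abs hK x]⟩
  have i1 : Integrable (fun e => Y t e - Y s e) Q := (h.int hν t).sub (h.int hν s)
  have i2 : Integrable (fun e => trK K (Y t e) - trK K (Y s e)) Q :=
    (h.comp_int hν htr t).sub (h.comp_int hν htr s)
  have j1 := h.comp_int hν (exK_LG hK) t
  have j2 := h.comp_int hν (exK_LG hK) s
  rw [← integral_sub (hb i1) (hb i2)]
  have hbound : ∫ e, C * (exK K (Y t e) + exK K (Y s e)) ∂Q ≤ 2 * C * tailK ν K := by
    rw [integral_const_mul, integral_add j1 j2, h.integral (exK_cont _), h.integral (exK_cont _)]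
    have h1 := mul_le_mul_of_nonneg_left (hν.tail_le hK t) hC0
    have h2 := mul_le_mul_of_nonneg_left (hν.tail_le hK s) hC0
    linarith
  refine le_trans ?_ hbound
  rw [← Real.norm_eq_abs]
  refine norm_integral_le_of_norm_le ((j1.add j2).const_mul C) (Eventually.of_forall fun e => ?_)
  have e1 := trK_sub_abs hK (Y t e)
  have e2 := trK_sub_abs hK (Y s e)
  have e3 : w e * (Y t e - Y s e) - w e * (trK K (Y t e) - trK K (Y s e))
      = w e * ((Y t e - trK K (Y t e)) - (Y s e - trK K (Y s e))) := by ring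
  rw [e3, Real.norm_eq_abs, abs_mul]
  refine mul_le_mul (hC e) ?_ (abs_nonneg _) hC0
  refine (abs_sub _ _).trans ?_
  rw [e1, e2]

lemma FD_meas {r u : ℝ} (hr : 0 ≤ r) (hu : r ≤ u) : Measurable[FD u] fun g : Dspace => g.1 r := by
  rw [measurable_iff_comap_le]
  exact le_iSup₂_of_le (f := fun t (_ : t ∈ Icc (0 : ℝ) u) =>
    MeasurableSpace.comap (fun g : Dspace => g.1 t) inferInstance) r ⟨hr, hu⟩ le_rfl

lemma FDplus_meas {r s : ℝ} (hr : 0 ≤ r) (hu : r ≤ s) :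
    Measurable[FDplus s] fun g : Dspace => g.1 r := by
  by_cases h1 : s = 1
  · have : FDplus s = FD 1 := if_pos h1
    rw [this]
    exact FD_meas hr (h1 ▸ hu)
  · have : FDplus s = ⨅ t ∈ Ioc s (1 : ℝ), FD t := if_neg h1
    rw [this, measurable_iff_comap_le]
    refine le_iInf₂ fun u hu' => ?_
    rw [← measurable_iff_comap_le]
    exact FD_meas hr (hu.trans hu'.1.le)

lemma FDplus_le {s : ℝ} (hs : s ≤ 1) : FDplus s ≤ (inferInstance : MeasurableSpace Dspace) := by
  unfold FDplus
  split_ifs with h1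
  · exact le_rfl
  · exact iInf₂_le (1 : ℝ) ⟨lt_of_le_of_ne hs h1, le_rfl⟩

section
variable {μ : ℝ → ProbabilityMeasure ℝ} {P : Measure Dspace}

lemma MI.toPM (hP : P ∈ MI μ) : PM P Sc (fun t => (μ (cl t) : Measure ℝ)) := by
  obtain ⟨hp, hlaw, hYint, hm⟩ := hP
  refine ⟨hp, Sc_meas, fun t => hlaw _ (cl_mem t), ?_⟩
  intro n r s t hr hst f
  have hle := FDplus_le (cl_mem s).2
  have hmart := hm (cl s) (cl t) (cl_mem s).1 (cl_mono hst) (cl_mem t).2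
  have i1 : Integrable (Sc t) P := hYint _ (cl_mem t)
  have i2 : Integrable (Sc s) P := hYint _ (cl_mem s)
  have hw : Measurable[FDplus (cl s)] fun g : Dspace => f (fun i => Sc (r i) g) :=
    f.continuous.measurable.comp (@measurable_pi_lambda _ _ _ (FDplus (cl s)) _ _ fun i =>
      FDplus_meas (cl_mem (r i)).1 (cl_mono (hr i)))
  have hb : ∀ {D : Dspace → ℝ}, Integrable D P →
      Integrable (fun g => f (fun i => Sc (r i) g) * D g) P := fun hD =>
    hD.bdd_mul (c := ‖f‖) (hw.mono hle le_rfl).aestronglyMeasurable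
      (Eventually.of_forall fun g => f.norm_coe_le_norm _)
  have e1 : ∫ g, f (fun i => Sc (r i) g) * Sc t g ∂P = ∫ g, f (fun i => Sc (r i) g) * Sc s g ∂P := by
    rw [← integral_condExp hle]
    refine integral_congr_ae ?_
    have := condExp_mul_of_stronglyMeasurable_left (m := FDplus (cl s)) (μ := P)
      hw.stronglyMeasurable (hb i1) i1
    refine this.trans ?_
    filter_upwards [hmart] with g hg
    have hg' : (P[Sc t | FDplus (cl s)]) g = Sc s g := hg
    simp only [Pi.mul_apply, hg']
  simp_rw [mul_sub]
  rw [integral_sub (hb i1) (hb i2)]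
  exact sub_eq_zero.2 e1

lemma PM.setInt_zero {ν : ℝ → Measure ℝ} (h : PM P Sc ν) (hν : Pk ν) {u t : ℝ}
    (hut : u ≤ t) (ht : t ≤ 1) (hu : 0 ≤ u) {A : Set Dspace} (hA : MeasurableSet[FD u] A) :
    ∫ g in A, (Sc t g - Sc u g) ∂P = 0 := by
  have := h.prob
  refine setIntegral_eq_zero_of_cyl (Y := fun r (g : Dspace) => g.1 r) (R := Icc 0 u)
    (fun r hr => eval_meas ⟨hr.1, hr.2.trans (hut.trans ht)⟩) ((h.meas t).sub (h.meas u))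
    ((h.int hν t).sub (h.int hν u)) ?_ hA
  intro n r hr f
  rw [← h.mart n r u t (fun i => (hr i).2) hut f]
  congr 1
  ext g
  have : (fun i => Sc (r i) g) = fun i => g.1 (r i) := by
    ext i
    unfold Sc
    rw [cl_of_mem ⟨(hr i).1, (hr i).2.trans (hut.trans ht)⟩]
  rw [this]
  rfl

lemma PM.setInt_lim {ν : ℝ → Measure ℝ} (h : PM P Sc ν) (hν : Pk ν) {s : ℝ} (hs : s ∈ Ico (0 : ℝ) 1)
    {u : ℕ → ℝ} (hu : Tendsto u atTop (𝓝[>] s)) (hu1 : ∀ n, u n ∈ Icc (0 : ℝ) 1)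
    {A : Set Dspace} (hA : MeasurableSet A) :
    Tendsto (fun n => ∫ g in A, (Sc (u n) g - Sc s g) ∂P) atTop (𝓝 0) := by
  have := h.prob
  have hw : Measurable (A.indicator fun _ : Dspace => (1 : ℝ)) := measurable_const.indicator hA
  have hC : ∀ g, |A.indicator (fun _ : Dspace => (1 : ℝ)) g| ≤ 1 := by
    intro g
    by_cases hg : g ∈ A <;> simp [hg]
  have hrep : ∀ D : Dspace → ℝ, ∫ g in A, D g ∂P
      = ∫ g, A.indicator (fun _ => (1 : ℝ)) g * D g ∂P := by
    intro D
    rw [← integral_indicator hA]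
    congr 1
    ext g
    by_cases hg : g ∈ A <;> simp [hg]
  have hlim : ∀ g : Dspace, Tendsto (fun n => Sc (u n) g) atTop (𝓝 (Sc s g)) := by
    intro g
    have h1 := (g.2.1 s hs).comp hu
    have h2 : ∀ n, Sc (u n) g = g.1 (u n) := fun n => by unfold Sc; rw [cl_of_mem (hu1 n)]
    have h3 : Sc s g = g.1 s := by unfold Sc; rw [cl_of_mem ⟨hs.1, hs.2.le⟩]
    simp_rw [h2, h3]
    exact h1
  refine tendsto_of_tail (τ := fun K => tailK ν K)
    (b := fun K n => ∫ g, A.indicator (fun _ => (1 : ℝ)) g *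
      (trK K (Sc (u n) g) - trK K (Sc s g)) ∂P) ?_ ?_ hν.tail_tendsto
  · intro K n
    rw [hrep]
    have h1 := h.trunc_bound hν hw hC zero_le_one s (u n) K
    have h2 := abs_sub_abs_le_abs_sub (∫ g, A.indicator (fun _ => (1 : ℝ)) g *
      (Sc (u n) g - Sc s g) ∂P) (∫ g, A.indicator (fun _ => (1 : ℝ)) g *
      (trK K (Sc (u n) g) - trK K (Sc s g)) ∂P)
    linarith
  · intro K
    have hK : (0 : ℝ) ≤ K := Nat.cast_nonneg K
    have hz : ∫ g : Dspace, (0 : ℝ) ∂P = 0 := by simp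
    rw [← hz]
    refine tendsto_integral_of_dominated_convergence (fun _ => 2 * (K : ℝ)) (fun n => ?_)
      (integrable_const _) (fun n => Eventually.of_forall fun g => ?_)
      (Eventually.of_forall fun g => ?_)
    · exact (hw.mul (((trK_cont _).measurable.comp (h.meas _)).sub
        ((trK_cont _).measurable.comp (h.meas _)))).aestronglyMeasurable
    · rw [Real.norm_eq_abs, abs_mul]
      have h1 := trK_abs_le hK (Sc (u n) g)
      have h2 := trK_abs_le hK (Sc s g)
      have h3 := abs_sub (trK K (Sc (u n) g)) (trK K (Sc s g))
      have h4 := mul_le_mul (hC g) (h3.trans (add_le_add h1 h2)) (abs_nonneg _) zero_le_one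
      linarith
    · have h1 : Tendsto (fun n => trK K (Sc (u n) g)) atTop (𝓝 (trK K (Sc s g))) :=
        ((trK_cont _).tendsto _).comp (hlim g)
      have h2 := (h1.sub_const (trK K (Sc s g))).const_mul (A.indicator (fun _ => (1 : ℝ)) g)
      simpa using h2

lemma PM.toMI (hν : Pk fun t => (μ (cl t) : Measure ℝ))
    (h : PM P Sc (fun t => (μ (cl t) : Measure ℝ))) : P ∈ MI μ := by
  have hp := h.prob
  have hSc : ∀ t ∈ Icc (0 : ℝ) 1, (fun g : Dspace => g.1 t) = Sc t := by
    intro t ht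
    ext g
    unfold Sc
    rw [cl_of_mem ht]
  refine ⟨hp, fun t ht => ?_, fun t ht => ?_, ?_⟩
  · rw [hSc t ht, h.law t, cl_of_mem ht]
  · rw [hSc t ht]; exact h.int hν t
  intro s t hs hst ht
  have hs1 : s ∈ Icc (0 : ℝ) 1 := ⟨hs, hst.trans ht⟩
  have ht1 : t ∈ Icc (0 : ℝ) 1 := ⟨hs.trans hst, ht⟩
  have hle := FDplus_le hs1.2
  have hsm : StronglyMeasurable[FDplus s] fun g : Dspace => g.1 s :=
    (FDplus_meas hs le_rfl).stronglyMeasurable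
  have is : Integrable (fun g : Dspace => g.1 s) P := by rw [hSc s hs1]; exact h.int hν s
  have it : Integrable (fun g : Dspace => g.1 t) P := by rw [hSc t ht1]; exact h.int hν t
  rcases hst.eq_or_lt with rfl | hlt
  · rw [condExp_of_stronglyMeasurable hle hsm is]
  symm
  refine ae_eq_condExp_of_forall_setIntegral_eq hle it (fun _ _ _ => is.integrableOn) ?_
    hsm.aestronglyMeasurable
  intro A hA _
  have hsI : s ∈ Ico (0 : ℝ) 1 := ⟨hs, hlt.trans_le ht⟩
  let u : ℕ → ℝ := fun n => s + (t - s) * (1 / ((n : ℝ) + 1))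
  have hpos : ∀ n : ℕ, (0 : ℝ) < 1 / ((n : ℝ) + 1) := fun n => by positivity
  have hle1 : ∀ n : ℕ, 1 / ((n : ℝ) + 1) ≤ 1 := fun n => by
    rw [div_le_one (by positivity)]
    have : (0 : ℝ) ≤ n := Nat.cast_nonneg n
    linarith
  have hugt : ∀ n, s < u n := fun n => by
    have := mul_pos (sub_pos.2 hlt) (hpos n)
    show s < s + (t - s) * (1 / ((n : ℝ) + 1))
    linarith
  have hult : ∀ n, u n ≤ t := fun n => by
    have := mul_le_mul_of_nonneg_left (hle1 n) (sub_pos.2 hlt).le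
    show s + (t - s) * (1 / ((n : ℝ) + 1)) ≤ t
    linarith
  have hu1 : ∀ n, u n ∈ Icc (0 : ℝ) 1 := fun n => ⟨hs.trans (hugt n).le, (hult n).trans ht⟩
  have hu : Tendsto u atTop (𝓝[>] s) := by
    refine tendsto_nhdsWithin_iff.2 ⟨?_, Eventually.of_forall hugt⟩
    have := ((tendsto_one_div_add_atTop_nhds_zero_nat (𝕜 := ℝ)).const_mul (t - s)).const_add s
    rw [mul_zero, add_zero] at this
    exact this
  have hlim := h.setInt_lim hν hsI hu hu1 (hle A hA)
  have hc : ∀ n, ∫ g in A, (Sc (u n) g - Sc s g) ∂P = ∫ g in A, (Sc t g - Sc s g) ∂P := by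
    intro n
    have hAu : MeasurableSet[FD (u n)] A := by
      have h1 : FDplus s ≤ FD (u n) := by
        unfold FDplus
        rw [if_neg hsI.2.ne]
        exact iInf₂_le (u n) ⟨hugt n, (hu1 n).2⟩
      exact h1 A hA
    have h0 := h.setInt_zero hν (hult n) ht (hu1 n).1 hAu
    rw [integral_sub (h.int hν _).integrableOn (h.int hν _).integrableOn] at h0
    rw [integral_sub (h.int hν _).integrableOn (h.int hν _).integrableOn,
      integral_sub (h.int hν _).integrableOn (h.int hν _).integrableOn]
    linarith
  simp_rw [hc] at hlim
  have h0 := tendsto_nhds_unique tendsto_const_nhds hlim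
  rw [integral_sub (h.int hν _).integrableOn (h.int hν _).integrableOn] at h0
  rw [hSc s hs1, hSc t ht1]
  linarith

end

/-! ### Assembly -/

lemma pk_of_peacock (μ : ℝ → ProbabilityMeasure ℝ)
    (hmom : ∀ t ∈ Icc (0 : ℝ) 1, Integrable (fun x => |x|) (μ t : Measure ℝ))
    (hpeacock : ∀ s t : ℝ, 0 ≤ s → s ≤ t → t ≤ 1 →
      ConvexOrder (μ s : Measure ℝ) (μ t : Measure ℝ))
    (hrc : ∀ t ∈ Ico (0 : ℝ) 1, Tendsto μ (𝓝[>] t) (𝓝 (μ t))) :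
    Pk fun t => (μ (cl t) : Measure ℝ) := by
  refine ⟨fun t => inferInstance, fun t => ?_, fun s t hst => ?_, fun t => ?_, fun t f => ?_⟩
  · have h1 := hmom _ (cl_mem t)
    exact (integrable_norm_iff (f := fun x : ℝ => x) aestronglyMeasurable_id).1 h1
  · exact hpeacock _ _ (cl_mem s).1 (cl_mono hst) (cl_mem t).2
  · have h1 : cl 1 = 1 := cl_of_mem ⟨zero_le_one, le_rfl⟩
    simp only [h1]
    exact hpeacock _ _ (cl_mem t).1 (cl_mem t).2 le_rfl
  · rcases lt_or_ge t 0 with h0 | h0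
    · refine tendsto_const_nhds.congr' ?_
      have : ∀ᶠ u in 𝓝[>] t, u < 0 := mem_nhdsWithin_of_mem_nhds (Iio_mem_nhds h0)
      filter_upwards [this] with u hu
      have e1 : cl t = 0 := max_eq_left ((min_le_right _ _).trans h0.le)
      have e2 : cl u = 0 := max_eq_left ((min_le_right _ _).trans hu.le)
      simp only [e1, e2]
    rcases lt_or_ge t 1 with h1 | h1
    · have e := (ProbabilityMeasure.tendsto_iff_forall_integral_tendsto.1 (hrc t ⟨h0, h1⟩)) f
      simp only [cl_of_mem (⟨h0, h1.le⟩ : t ∈ Icc (0 : ℝ) 1)]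
      refine e.congr' ?_
      have : ∀ᶠ u in 𝓝[>] t, u < 1 := mem_nhdsWithin_of_mem_nhds (Iio_mem_nhds h1)
      filter_upwards [this, self_mem_nhdsWithin] with u hu hu'
      rw [cl_of_mem ⟨h0.trans (le_of_lt hu'), hu.le⟩]
    · refine tendsto_const_nhds.congr' ?_
      filter_upwards [self_mem_nhdsWithin] with u hu
      have e1 : cl t = 1 := by
        unfold cl
        rw [min_eq_left h1, max_eq_right zero_le_one]
      have e2 : cl u = 1 := by
        unfold cl
        rw [min_eq_left (h1.trans (le_of_lt hu)), max_eq_right zero_le_one]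
      simp only [e1, e2]

lemma cl_cl (t : ℝ) : cl (cl t) = cl t := cl_of_mem (cl_mem t)

/-- From a finitely additive martingale law to a martingale measure on path space. -/
lemma exists_MI {Ω : Type*} {X : ℝ → Ω → ℝ} {μ : ℝ → ProbabilityMeasure ℝ} {G : (Ω → ℝ) →ₗ[ℝ] ℝ}
    (hν : Pk fun t => (μ (cl t) : Measure ℝ)) (hG : PosMart X (fun t => (μ (cl t) : Measure ℝ)) G) :
    ∃ P ∈ MI μ, ∀ (n : ℕ) (r : Fin n → ℝ) (f : BoundedContinuousFunction (Fin n → ℝ) ℝ),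
        ∫ g, f (fun i => Sc (r i) g) ∂P = G (fun ω => f (fun i => X (cl (r i)) ω)) := by
  obtain ⟨Q, Y, hY, hf⟩ := exists_PM hν hG
  let : MeasurableSpace (Ultrafilter Ω) := borel _
  obtain ⟨P, hP, hPf⟩ := hY.exists_D hν (fun t => by rw [cl_cl])
  exact ⟨P, hP.toMI hν, fun n r f => (hPf n r f).trans (hf n _ f)⟩

/-- Bounded measurable functions. -/
def BM (E : Type*) [MeasurableSpace E] : Submodule ℝ (E → ℝ) where
  carrier := {F | Measurable F ∧ ∃ C, ∀ g, |F g| ≤ C}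
  zero_mem' := ⟨measurable_const, 0, by simp⟩
  add_mem' := by
    rintro f g ⟨hf, C, hC⟩ ⟨hg, C', hC'⟩
    exact ⟨hf.add hg, C + C', fun x => (abs_add_le _ _).trans (add_le_add (hC x) (hC' x))⟩
  smul_mem' := by
    rintro c f ⟨hf, C, hC⟩
    refine ⟨hf.const_smul c, |c| * C, fun x => ?_⟩
    rw [Pi.smul_apply, smul_eq_mul, abs_mul]
    exact mul_le_mul_of_nonneg_left (hC x) (abs_nonneg c)

lemma BM.integrable {E : Type*} [MeasurableSpace E] {F : E → ℝ} (hF : F ∈ BM E) (P : Measure E)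
    [IsProbabilityMeasure P] : Integrable F P := by
  obtain ⟨hm, C, hC⟩ := hF
  exact Integrable.of_bound hm.aestronglyMeasurable C (Eventually.of_forall hC)

lemma BM.exists_lim {E : Type*} [MeasurableSpace E] {F : E → ℝ} (hF : F ∈ BM E)
    (U : Ultrafilter (Measure E)) (hU : ∀ᶠ P in (U : Filter (Measure E)), IsProbabilityMeasure P) :
    ∃ L : ℝ, Tendsto (fun P => ∫ g, F g ∂P) U (𝓝 L) := by
  obtain ⟨hm, C, hC⟩ := hF
  have h1 : ∀ᶠ P in (U : Filter (Measure E)), (∫ g, F g ∂P) ∈ Icc (-C) C := by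
    filter_upwards [hU] with P hP
    have := norm_integral_le_of_norm_le_const (μ := P) (f := F) (C := C)
      (Eventually.of_forall hC)
    simp at this
    exact abs_le.1 this
  obtain ⟨L, _, hL⟩ := (isCompact_Icc (a := -C) (b := C)).ultrafilter_le_nhds
    (U.map fun P => ∫ g, F g ∂P) (le_principal_iff.2 h1)
  exact ⟨L, hL⟩

lemma exists_limit {E : Type*} [MeasurableSpace E]
    (U : Ultrafilter (Measure E)) (hU : ∀ᶠ P in (U : Filter (Measure E)), IsProbabilityMeasure P) :
    ∃ G : (E → ℝ) →ₗ[ℝ] ℝ,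
      (∀ F ∈ BM E, Tendsto (fun P => ∫ g, F g ∂P) U (𝓝 (G F))) ∧
      ∀ F : E → ℝ, 0 ≤ F → (∃ C, ∀ ω, F ω ≤ C) → 0 ≤ G F := by
  choose L hL using fun F : BM E => BM.exists_lim F.2 U hU
  let ℓ : BM E →ₗ[ℝ] ℝ :=
    { toFun := L
      map_add' := by
        intro F F'
        refine tendsto_nhds_unique (hL (F + F')) (((hL F).add (hL F')).congr' ?_)
        filter_upwards [hU] with P hP
        exact (integral_add (BM.integrable F.2 P) (BM.integrable F'.2 P)).symm
      map_smul' := by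
        intro c F
        refine tendsto_nhds_unique (hL (c • F)) (((hL F).const_mul c).congr' ?_)
        filter_upwards [hU] with P hP
        exact (integral_const_mul c _).symm }
  have hpos : ∀ τ : BM E, 0 ≤ (BM E).subtype τ → 0 ≤ ℓ τ := by
    intro τ hτ
    exact ge_of_tendsto (hL τ) (Eventually.of_forall fun P => integral_nonneg hτ)
  obtain ⟨G, hG, hGp⟩ := pos_extension (Ω := E) (T := BM E) (BM E).subtype ℓ hpos
  refine ⟨G, fun F hF => ?_, fun F hF hC => hGp F hF ?_⟩
  · have := hG ⟨F, hF⟩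
    have h2 : G F = L ⟨F, hF⟩ := this
    rw [h2]
    exact hL ⟨F, hF⟩
  · obtain ⟨C, hC⟩ := hC
    exact ⟨⟨fun _ => C, measurable_const, |C|, fun _ => le_rfl⟩, hC⟩

lemma bm_cyl {n : ℕ} (r : Fin n → ℝ) (f : BoundedContinuousFunction (Fin n → ℝ) ℝ) :
    (fun g : Dspace => f (fun i => Sc (r i) g)) ∈ BM Dspace :=
  ⟨f.continuous.measurable.comp (measurable_pi_lambda _ fun i => Sc_meas _), ‖f‖,
    fun _ => f.norm_coe_le_norm _⟩

lemma limit_posMart {μ : ℝ → ProbabilityMeasure ℝ} (hν : Pk fun t => (μ (cl t) : Measure ℝ))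
    (U : Ultrafilter (Measure Dspace)) (hU : ∀ᶠ P in (U : Filter (Measure Dspace)), P ∈ MI μ)
    (G : (Dspace → ℝ) →ₗ[ℝ] ℝ)
    (hG : ∀ F ∈ BM Dspace, Tendsto (fun P => ∫ g, F g ∂P) U (𝓝 (G F)))
    (hGp : ∀ F : Dspace → ℝ, 0 ≤ F → (∃ C, ∀ ω, F ω ≤ C) → 0 ≤ G F) :
    PosMart Sc (fun t => (μ (cl t) : Measure ℝ)) G := by
  refine ⟨hGp, ?_, ?_, ?_⟩
  · have h1 := hG (fun _ => 1) ⟨measurable_const, 1, by simp⟩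
    refine tendsto_nhds_unique h1 (tendsto_const_nhds.congr' ?_)
    filter_upwards [hU] with P hP
    have := hP.1
    simp
  · intro t f
    have h1 := hG (fun g => f (Sc t g))
      ⟨f.continuous.measurable.comp (Sc_meas t), ‖f‖, fun _ => f.norm_coe_le_norm _⟩
    refine tendsto_nhds_unique h1 (tendsto_const_nhds.congr' ?_)
    filter_upwards [hU] with P hP
    exact ((MI.toPM hP).integral f.continuous t).symm
  · intro n r s t hr hst h K
    have h1 := hG (fun ω => h (fun i => Sc (r i) ω) * (trK K (Sc t ω) - trK K (Sc s ω)))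
      (bm_cyl (Fin.cons t (Fin.cons s r)) (testBCF h K))
    refine le_of_tendsto h1.abs ?_
    filter_upwards [hU] with P hP
    have hPM := MI.toPM hP
    have h2 := hPM.trunc_bound hν (w := fun g => h (fun i => Sc (r i) g))
      (h.continuous.measurable.comp (measurable_pi_lambda _ fun i => Sc_meas _))
      (C := ‖h‖) (fun g => h.norm_coe_le_norm _) (norm_nonneg h) s t K
    rw [hPM.mart n r s t hr hst h, zero_sub, abs_neg] at h2
    exact h2


/-- for a right-continuous peacock `(μ_t)_{t∈[0,1]}`, the set of càdlàg
martingale measures with marginals `(μ_t)` is nonempty and compact for the topology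
induced by the functionals `ω ↦ f(S_{t₁}(ω), …, S_{t_n}(ω))`. -/
theorem MI_nonempty_compact
    (μ : ℝ → ProbabilityMeasure ℝ)
    (hmom : ∀ t ∈ Icc (0 : ℝ) 1, Integrable (fun x => |x|) (μ t : Measure ℝ))
    (hpeacock : ∀ s t : ℝ, 0 ≤ s → s ≤ t → t ≤ 1 →
      ConvexOrder (μ s : Measure ℝ) (μ t : Measure ℝ))
    (hrc : ∀ t ∈ Ico (0 : ℝ) 1, Tendsto μ (𝓝[>] t) (𝓝 (μ t))) :
    (MI μ).Nonempty ∧ @IsCompact _ cylTop (MI μ) := by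
  have hν := pk_of_peacock μ hmom hpeacock hrc
  constructor
  · obtain ⟨G, hG⟩ := exists_posMart hν
    obtain ⟨P, hP, -⟩ := exists_MI hν hG
    exact ⟨P, hP⟩
  · rw [@isCompact_iff_ultrafilter_le_nhds _ cylTop]
    intro U hU
    have hU' : ∀ᶠ P in (U : Filter (Measure Dspace)), P ∈ MI μ := le_principal_iff.1 hU
    obtain ⟨G, hG, hGp⟩ := exists_limit U (hU'.mono fun P hP => hP.1)
    obtain ⟨P, hP, hPf⟩ := exists_MI hν (limit_posMart hν U hU' G hG hGp)
    refine ⟨P, hP, ?_⟩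
    unfold cylTop
    simp only [nhds_iInf, nhds_induced]
    refine le_iInf fun n => le_iInf fun t => le_iInf fun ht => le_iInf fun f => ?_
    rw [← tendsto_iff_comap]
    have e : ∀ g : Dspace, (fun i => g.1 (t i)) = fun i => Sc (t i) g := by
      intro g
      ext i
      unfold Sc
      rw [cl_of_mem (ht i)]
    have e2 : ∀ g : Dspace, (fun i => Sc (cl (t i)) g) = fun i => Sc (t i) g := by
      intro g
      ext i
      rw [cl_of_mem (ht i)]
    simp only [e]
    rw [hPf n t f]
    simp only [e2]
    exact hG _ (bm_cyl t f)
end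

section
/- Let (T, <) be a total order and (μ_t)_{t∈T} a peacock (increasing in convex order, each μ_t with finite first moment). Then there exists a weakly continuous peacock (ν_s)_{s∈ℝ₊} and an increasing function f: T → ℝ₊ such that μ_t = ν_{f(t)} for all t ∈ T. If T has a maximal element, f can be taken with values in [0,1]. -/
open MeasureTheory Set Filter Topology

namespace PeacockAux

/-- Probability measures on the line with finite first moment. -/
abbrev S : Type := {m : ProbabilityMeasure ℝ // Integrable (fun x => |x|) (m : Measure ℝ)}

/-- Integral of a function against an element of `S`. -/
noncomputable def E (φ : ℝ → ℝ) (m : S) : ℝ := ∫ x, φ x ∂(m.1 : Measure ℝ)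

/-- Lipschitz functions (unspecified constant). -/
def Lip (φ : ℝ → ℝ) : Prop := ∃ K, LipschitzWith K φ

/-- Convex order tested on Lipschitz convex functions. -/
def R (m m' : S) : Prop := ∀ φ : ℝ → ℝ, ConvexOn ℝ univ φ → Lip φ → E φ m ≤ E φ m'

lemma R.trans {a b c : S} (h : R a b) (h' : R b c) : R a c :=
  fun φ h1 h2 => (h φ h1 h2).trans (h' φ h1 h2)

lemma R.refl (a : S) : R a a := fun _ _ _ => le_rfl

lemma Lip.integrable {φ : ℝ → ℝ} (h : Lip φ) (m : S) : Integrable φ (m.1 : Measure ℝ) := by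
  obtain ⟨K, hK⟩ := h
  refine Integrable.mono' ((integrable_const |φ 0|).add (m.2.const_mul (K : ℝ)))
    hK.continuous.aestronglyMeasurable (ae_of_all _ fun x => ?_)
  have h1 := hK.dist_le_mul x 0
  simp only [Real.dist_eq, sub_zero] at h1
  have h2 : |φ x| ≤ |φ x - φ 0| + |φ 0| := by
    simpa using abs_add_le (φ x - φ 0) (φ 0)
  simp only [Real.norm_eq_abs, Pi.add_apply]
  linarith

lemma R.of_convexOrder {a b : S} (h : ConvexOrder (a.1 : Measure ℝ) (b.1 : Measure ℝ)) : R a b :=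
  fun φ h1 h2 => h φ h1 (h2.integrable a) (h2.integrable b)

lemma Lip.max {f g : ℝ → ℝ} (hf : Lip f) (hg : Lip g) : Lip (fun x => max (f x) (g x)) := by
  obtain ⟨K, hK⟩ := hf
  obtain ⟨L, hL⟩ := hg
  exact ⟨_, hK.max hL⟩

lemma Lip.add {f g : ℝ → ℝ} (hf : Lip f) (hg : Lip g) : Lip (fun x => f x + g x) := by
  obtain ⟨K, hK⟩ := hf
  obtain ⟨L, hL⟩ := hg
  exact ⟨_, hK.add hL⟩

lemma Lip.neg {f : ℝ → ℝ} (hf : Lip f) : Lip (fun x => - f x) := by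
  obtain ⟨K, hK⟩ := hf
  exact ⟨_, hK.neg⟩

lemma Lip.const_mul {f : ℝ → ℝ} (hf : Lip f) (c : ℝ) : Lip (fun x => c * f x) := by
  obtain ⟨K, hK⟩ := hf
  refine ⟨‖c‖₊ * K, LipschitzWith.of_dist_le_mul fun x y => ?_⟩
  have := hK.dist_le_mul x y
  simp only [Real.dist_eq, NNReal.coe_mul, coe_nnnorm, Real.norm_eq_abs] at *
  rw [← mul_sub, abs_mul, mul_assoc]
  gcongr

lemma Lip.const (c : ℝ) : Lip (fun _ => c) := ⟨0, LipschitzWith.const c⟩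

lemma Lip.id : Lip (fun x => x) := ⟨1, LipschitzWith.id⟩

lemma Lip.abs : Lip (fun x => |x|) :=
  ⟨1, LipschitzWith.of_dist_le_mul fun x y => by
    simpa [Real.dist_eq] using abs_abs_sub_abs_le_abs_sub x y⟩

/-- Maximum of the first `n+1` affine functions. -/
noncomputable def affMax (l : ℕ → ℝ → ℝ) : ℕ → ℝ → ℝ
  | 0 => l 0
  | n + 1 => fun x => max (affMax l n x) (l (n + 1) x)

lemma affMax_mono (l : ℕ → ℝ → ℝ) (x : ℝ) : Monotone (fun n => affMax l n x) :=
  monotone_nat_of_le_succ fun _ => le_max_left _ _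

lemma le_affMax (l : ℕ → ℝ → ℝ) (n : ℕ) (x : ℝ) : l n x ≤ affMax l n x := by
  cases n with
  | zero => exact le_rfl
  | succ n => exact le_max_right _ _

lemma affMax_le {l : ℕ → ℝ → ℝ} {φ : ℝ → ℝ} (h : ∀ n x, l n x ≤ φ x) (n : ℕ) (x : ℝ) :
    affMax l n x ≤ φ x := by
  induction n with
  | zero => exact h 0 x
  | succ n ih => exact max_le ih (h _ x)

lemma affMax_lip {l : ℕ → ℝ → ℝ} (h : ∀ n, Lip (l n)) (n : ℕ) : Lip (affMax l n) := by
  induction n with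
  | zero => exact h 0
  | succ n ih => exact ih.max (h _)

lemma affMax_convex {l : ℕ → ℝ → ℝ} (h : ∀ n, ConvexOn ℝ univ (l n)) (n : ℕ) :
    ConvexOn ℝ univ (affMax l n) := by
  induction n with
  | zero => exact h 0
  | succ n ih => exact ih.sup (h _)

lemma R.convexOrder {a b : S} (h : R a b) : ConvexOrder (a.1 : Measure ℝ) (b.1 : Measure ℝ) := by
  intro φ hφ ha hb
  have hc : Continuous φ := hφ.locallyLipschitz.continuous
  obtain ⟨l, c, hle, hsup⟩ := hφ.real_univ_sSup_of_nat_affine_eq hc.lowerSemicontinuous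
  set g : ℕ → ℝ → ℝ := fun n x => l n x + c n with hg
  have hgφ : ∀ n x, g n x ≤ φ x := fun n x => hle n x
  have hgl : ∀ n, Lip (g n) := fun n => ⟨_, ((l n).lipschitz).add (LipschitzWith.const (c n))⟩
  have hgc : ∀ n, ConvexOn ℝ univ (g n) := fun n =>
    ((l n).toLinearMap.convexOn convex_univ).add (convexOn_const _ convex_univ)
  have hbd : ∀ x, BddAbove (range fun n => g n x) := fun x =>
    ⟨φ x, by rintro _ ⟨n, rfl⟩; exact hgφ n x⟩
  have hsup' : ∀ x, ⨆ n, g n x = φ x := by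
    intro x
    rw [← hsup, iSup_apply]
    rfl
  have hlim : ∀ x, Tendsto (fun n => affMax g n x) atTop (𝓝 (φ x)) := by
    intro x
    have hb' : BddAbove (range fun n => affMax g n x) :=
      ⟨φ x, by rintro _ ⟨n, rfl⟩; exact affMax_le hgφ n x⟩
    have := tendsto_atTop_ciSup (affMax_mono g x) hb'
    convert this using 2
    apply le_antisymm
    · rw [← hsup' x]
      exact ciSup_mono hb' fun n => le_affMax g n x
    · exact ciSup_le fun n => affMax_le hgφ n x
  have key : ∀ m : S, Integrable φ (m.1 : Measure ℝ) →
      Tendsto (fun n => E (affMax g n) m) atTop (𝓝 (∫ x, φ x ∂(m.1 : Measure ℝ))) := by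
    intro m hm
    refine tendsto_integral_of_dominated_convergence (fun x => |g 0 x| + |φ x|)
      (fun n => ((affMax_lip hgl n).integrable m).1)
      (((hgl 0).integrable m).abs.add hm.abs) (fun n => ae_of_all _ fun x => ?_)
      (ae_of_all _ hlim)
    have h1 : g 0 x ≤ affMax g n x := affMax_mono g x (Nat.zero_le n)
    have h2 := affMax_le hgφ n x
    rw [Real.norm_eq_abs, abs_le]
    constructor
    · have := neg_abs_le (g 0 x); have := abs_nonneg (φ x); linarith
    · have := le_abs_self (φ x); have := abs_nonneg (g 0 x); linarith
  exact le_of_tendsto_of_tendsto' (key a ha) (key b hb)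
    fun n => h _ (affMax_convex hgc n) (affMax_lip hgl n)

lemma lsc_aux {U : Ultrafilter S} {ℓ : ProbabilityMeasure ℝ}
    (hU : Tendsto (fun m : S => m.1) U (𝓝 ℓ)) {w : ℝ → ℝ} (hw : Continuous w)
    (h0 : ∀ x, 0 ≤ w x) (hl : Lip w) {A : ℝ} (hA : ∀ᶠ m in (U : Filter S), E w m ≤ A) :
    Integrable w (ℓ : Measure ℝ) ∧ ∫ x, w x ∂(ℓ : Measure ℝ) ≤ A := by
  rw [ProbabilityMeasure.tendsto_iff_forall_integral_tendsto] at hU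
  have hA0 : 0 ≤ A := by
    obtain ⟨m, hm⟩ := hA.exists
    exact (integral_nonneg h0).trans hm
  have hN : ∀ N : ℕ, ∫ x, min (w x) N ∂(ℓ : Measure ℝ) ≤ A := by
    intro N
    let F : BoundedContinuousFunction ℝ ℝ := BoundedContinuousFunction.ofNormedAddCommGroup
      (fun x => min (w x) N) (hw.min continuous_const) N (fun x => by
        rw [Real.norm_eq_abs, abs_of_nonneg (le_min (h0 x) (Nat.cast_nonneg N))]
        exact min_le_right _ _)
    refine le_of_tendsto (hU F) (hA.mono fun m hm => le_trans ?_ hm)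
    exact integral_mono (F.integrable _) (hl.integrable m) fun x => min_le_left _ _
  have hlin : ∫⁻ x, ENNReal.ofReal (w x) ∂(ℓ : Measure ℝ) ≤ ENNReal.ofReal A := by
    have hlim : ∀ x, Tendsto (fun N : ℕ => ENNReal.ofReal (min (w x) N)) atTop
        (𝓝 (ENNReal.ofReal (w x))) := by
      intro x
      refine tendsto_const_nhds.congr' ?_
      filter_upwards [eventually_ge_atTop ⌈w x⌉₊] with N hN
      rw [min_eq_left (Nat.ceil_le.1 hN)]
    have := lintegral_tendsto_of_tendsto_of_monotone (μ := (ℓ : Measure ℝ))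
      (f := fun (N : ℕ) x => ENNReal.ofReal (min (w x) N)) (F := fun x => ENNReal.ofReal (w x))
      (fun N => ((hw.min continuous_const).measurable.ennreal_ofReal).aemeasurable)
      (ae_of_all _ fun x a b hab => ENNReal.ofReal_le_ofReal
        (min_le_min le_rfl (Nat.cast_le.2 hab))) (ae_of_all _ hlim)
    refine le_of_tendsto' this fun N => ?_
    rw [← ofReal_integral_eq_lintegral_ofReal]
    · exact ENNReal.ofReal_le_ofReal (hN N)
    · refine Integrable.of_bound (hw.min continuous_const).aestronglyMeasurable N
        (ae_of_all _ fun x => ?_)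
      rw [Real.norm_eq_abs, abs_of_nonneg (le_min (h0 x) (Nat.cast_nonneg N))]
      exact min_le_right _ _
    · exact ae_of_all _ fun x => le_min (h0 x) (Nat.cast_nonneg N)
  have hwint : Integrable w (ℓ : Measure ℝ) := by
    refine ⟨hw.aestronglyMeasurable, ?_⟩
    rw [hasFiniteIntegral_iff_ofReal (ae_of_all _ h0)]
    exact hlin.trans_lt ENNReal.ofReal_lt_top
  refine ⟨hwint, ?_⟩
  rw [← ofReal_integral_eq_lintegral_ofReal hwint (ae_of_all _ h0)] at hlin
  exact (ENNReal.ofReal_le_ofReal_iff hA0).1 hlin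

/-- The tail function. -/
noncomputable def tail (r : ℝ) (x : ℝ) : ℝ := max (|x| - r) 0

lemma tail_lip (r : ℝ) : Lip (tail r) := (Lip.abs.add (Lip.const (-r))).max (Lip.const 0)

lemma convex_abs : ConvexOn ℝ univ (fun x : ℝ => |x|) :=
  convexOn_norm (E := ℝ) convex_univ

lemma tail_convex (r : ℝ) : ConvexOn ℝ univ (tail r) :=
  (convex_abs.add (convexOn_const (-r) convex_univ)).sup (convexOn_const 0 convex_univ)

lemma tail_tendsto (M : S) : Tendsto (fun n : ℕ => E (tail n) M) atTop (𝓝 0) := by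
  have : Tendsto (fun n : ℕ => E (tail n) M) atTop (𝓝 (∫ x, (0 : ℝ) ∂(M.1 : Measure ℝ))) := by
    refine tendsto_integral_of_dominated_convergence (fun x => |x|)
      (fun n => ((tail_lip n).integrable M).1) M.2 (fun n => ae_of_all _ fun x => ?_)
      (ae_of_all _ fun x => ?_)
    · have hn : (0 : ℝ) ≤ n := Nat.cast_nonneg n
      rw [tail, Real.norm_eq_abs, abs_of_nonneg (le_max_right _ _)]
      exact max_le (by linarith) (abs_nonneg x)
    · refine tendsto_const_nhds.congr' ?_
      filter_upwards [eventually_ge_atTop ⌈|x|⌉₊] with N hN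
      rw [tail, max_eq_right]
      have := Nat.ceil_le.1 hN
      linarith
  simpa using this

/-- Truncation. -/
noncomputable def clamp (r : ℝ) (x : ℝ) : ℝ := max (-r) (min x r)

lemma clamp_sub {r : ℝ} (hr : 0 ≤ r) (x : ℝ) : |x - clamp r x| ≤ tail r x := by
  unfold clamp tail
  rcases le_total x r with h | h <;> rcases le_total (-r) x with h' | h'
  · rw [min_eq_left h, max_eq_right h']; simp
  · rw [min_eq_left h, max_eq_left h', abs_of_nonpos (by linarith), abs_of_nonpos (by linarith)]
    exact le_trans (by linarith) (le_max_left _ _)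
  · rw [min_eq_right h, max_eq_right (by linarith), abs_of_nonneg (by linarith),
      abs_of_nonneg (by linarith)]
    exact le_max_left _ _
  · rw [min_eq_right h, max_eq_right (by linarith), abs_of_nonneg (by linarith),
      abs_of_nonneg (by linarith)]
    exact le_max_left _ _

lemma clamp_abs {r : ℝ} (hr : 0 ≤ r) (x : ℝ) : |clamp r x| ≤ r := by
  unfold clamp
  rw [abs_le]
  exact ⟨le_max_left _ _, max_le (by linarith) (min_le_right _ _)⟩

lemma trunc_err {φ : ℝ → ℝ} {K : NNReal} (hK : LipschitzWith K φ) {r : ℝ} (hr : 0 ≤ r) (m : S) :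
    |E φ m - E (fun x => φ (clamp r x)) m| ≤ K * E (tail r) m := by
  have hcl : LipschitzWith 1 (clamp r) := by
    unfold clamp
    exact (LipschitzWith.id.min_const r).const_max (-r)
  unfold E
  rw [← integral_sub (Lip.integrable ⟨K, hK⟩ m)
    (Lip.integrable (φ := fun x => φ (clamp r x)) ⟨_, hK.comp hcl⟩ m), ← integral_const_mul]
  refine (abs_integral_le_integral_abs).trans
    (integral_mono_of_nonneg (ae_of_all _ fun x => abs_nonneg _)
      (((tail_lip r).integrable m).const_mul _) (ae_of_all _ fun x => ?_))
  have h1 := hK.dist_le_mul x (clamp r x)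
  simp only [Real.dist_eq] at h1
  exact h1.trans (mul_le_mul_of_nonneg_left (clamp_sub hr x) K.2)

lemma tight_aux (M : S) : IsCompact (closure {m : ProbabilityMeasure ℝ | ∃ h, R ⟨m, h⟩ M}) := by
  apply isCompact_closure_of_isTightMeasureSet
  rw [isTightMeasureSet_iff_exists_isCompact_measure_compl_le]
  intro ε hε
  set A := E (fun x => |x|) M with hA
  have hA0 : 0 ≤ A := integral_nonneg fun x => abs_nonneg x
  have : ∃ δ : ℝ, 0 < δ ∧ ENNReal.ofReal δ ≤ ε := by
    obtain ⟨δ, h1, h2⟩ := ENNReal.lt_iff_exists_nnreal_btwn.1 hε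
    exact ⟨δ, by exact_mod_cast h1, by simpa using h2.le⟩
  obtain ⟨δ, hδ, hδε⟩ := this
  set r := A / δ + 1 with hr
  have hr0 : 0 < r := by positivity
  refine ⟨Icc (-r) r, isCompact_Icc, ?_⟩
  rintro _ ⟨m, ⟨hm, hR⟩, rfl⟩
  refine le_trans ?_ hδε
  have h1 := mul_meas_ge_le_integral_of_nonneg (μ := (m : Measure ℝ))
    (ae_of_all _ fun x => abs_nonneg x) hm r
  have h2 : ∫ x, |x| ∂(m : Measure ℝ) ≤ A := hR _ convex_abs Lip.abs
  have h3 : (m : Measure ℝ).real {x | r ≤ |x|} ≤ δ := by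
    have h4 : r * (m : Measure ℝ).real {x | r ≤ |x|} ≤ r * δ := by
      refine (h1.trans h2).trans ?_
      rw [hr, add_mul, div_mul_cancel₀ _ hδ.ne']
      linarith
    exact le_of_mul_le_mul_left h4 hr0
  calc (m : Measure ℝ) (Icc (-r) r)ᶜ ≤ (m : Measure ℝ) {x | r ≤ |x|} := by
        apply measure_mono
        intro x hx
        by_contra hc
        simp only [mem_ofPred_eq, not_le] at hc
        exact hx (abs_le.1 hc.le)
    _ = ENNReal.ofReal ((m : Measure ℝ).real {x | r ≤ |x|}) := by
        rw [ofReal_measureReal]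
    _ ≤ _ := ENNReal.ofReal_le_ofReal h3

lemma ultra_limit {U : Ultrafilter S} {M : S} (hM : ∀ᶠ m in (U : Filter S), R m M) :
    ∃ ℓ : S, Tendsto (fun m : S => m.1) U (𝓝 ℓ.1) ∧
      ∀ φ, Lip φ → Tendsto (fun m => E φ m) U (𝓝 (E φ ℓ)) := by
  obtain ⟨ℓ, -, hℓ⟩ := (tight_aux M).ultrafilter_le_nhds (U.map fun m : S => m.1) (by
    rw [le_principal_iff]
    change ∀ᶠ m in (U : Filter S), m.1 ∈ _
    exact hM.mono fun m hm => subset_closure ⟨m.2, hm⟩)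
  have hℓ : Tendsto (fun m : S => m.1) U (𝓝 ℓ) := hℓ
  have h1 := (lsc_aux hℓ continuous_abs (fun x => abs_nonneg x) Lip.abs
    (hM.mono fun m hm => hm _ convex_abs Lip.abs)).1
  refine ⟨⟨ℓ, h1⟩, hℓ, ?_⟩
  rintro φ ⟨K, hK⟩
  have htail : ∀ r, E (tail r) ⟨ℓ, h1⟩ ≤ E (tail r) M := fun r =>
    (lsc_aux hℓ (by obtain ⟨_, h⟩ := tail_lip r; exact h.continuous)
      (fun x => le_max_right _ _) (tail_lip r)
      (hM.mono fun m hm => hm _ (tail_convex r) (tail_lip r))).2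
  rw [Metric.tendsto_nhds]
  intro ε hε
  have hK1 : (0 : ℝ) < K + 1 := by have := K.2; positivity
  obtain ⟨n, hn⟩ := ((tail_tendsto M).eventually_lt_const
    (show 0 < ε / (4 * (K + 1)) by positivity)).exists
  have hn' : K * E (tail n) M ≤ ε / 4 := by
    have h0 : 0 ≤ E (tail n) M := integral_nonneg fun x => le_max_right _ _
    calc K * E (tail n) M ≤ (K + 1) * (ε / (4 * (K + 1))) := by gcongr; linarith
      _ = ε / 4 := by field_simp
  have hn0 : (0 : ℝ) ≤ n := Nat.cast_nonneg n
  let F : BoundedContinuousFunction ℝ ℝ := BoundedContinuousFunction.ofNormedAddCommGroup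
    (fun x => φ (clamp n x)) (hK.continuous.comp (by unfold clamp; fun_prop))
    (|φ 0| + K * n) (fun x => by
      have h1 := hK.dist_le_mul (clamp n x) 0
      simp only [Real.dist_eq, sub_zero] at h1
      have h2 : |φ (clamp n x)| ≤ |φ (clamp n x) - φ 0| + |φ 0| := by
        simpa using abs_add_le (φ (clamp n x) - φ 0) (φ 0)
      have h3 := mul_le_mul_of_nonneg_left (clamp_abs hn0 x) K.2
      rw [Real.norm_eq_abs]
      change _ ≤ (K : ℝ) * n at h3
      change (K : ℝ) * _ ≤ (K : ℝ) * n at h3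
      linarith)
  have hF := (ProbabilityMeasure.tendsto_iff_forall_integral_tendsto.1 hℓ) F
  rw [Metric.tendsto_nhds] at hF
  filter_upwards [hF (ε / 4) (by positivity), hM] with m hm1 hm2
  have e1 := trunc_err hK hn0 m
  have e2 := trunc_err hK hn0 ⟨ℓ, h1⟩
  have e3 : |E (fun x => φ (clamp n x)) m - E (fun x => φ (clamp n x)) ⟨ℓ, h1⟩| < ε / 4 := hm1
  have e4 : K * E (tail n) m ≤ K * E (tail n) M :=
    mul_le_mul_of_nonneg_left (hm2 _ (tail_convex _) (tail_lip _)) K.2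
  have e5 : K * E (tail n) ⟨ℓ, h1⟩ ≤ K * E (tail n) M :=
    mul_le_mul_of_nonneg_left (htail n) K.2
  rw [Real.dist_eq]
  rw [abs_le] at e1 e2
  rw [abs_lt] at e3 ⊢
  constructor <;> linarith

/-- The strictly convex gauge. -/
noncomputable def Psi (x : ℝ) : ℝ := √(1 + x ^ 2)

lemma Psi_pos (x : ℝ) : 0 < Psi x := Real.sqrt_pos.2 (by positivity)

lemma Psi_sq (x : ℝ) : Psi x ^ 2 = 1 + x ^ 2 := Real.sq_sqrt (by positivity)

lemma one_le_Psi (x : ℝ) : 1 ≤ Psi x := by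
  have := Psi_sq x
  nlinarith [Psi_pos x, sq_nonneg x]

lemma Psi_hasDeriv (x : ℝ) : HasDerivAt Psi (x / Psi x) x := by
  have h : HasDerivAt (fun x : ℝ => 1 + x ^ 2) (2 * x) x := by
    simpa using (hasDerivAt_pow 2 x).const_add 1
  have := h.sqrt (by positivity)
  have e : x / Psi x = 2 * x / (2 * √(1 + x ^ 2)) :=
    (mul_div_mul_left _ _ two_ne_zero).symm
  rw [e]
  exact this

lemma Psi_deriv : deriv Psi = fun x => x / Psi x := funext fun x => (Psi_hasDeriv x).deriv

lemma Psi_hasDeriv2 (x : ℝ) : HasDerivAt (fun x => x / Psi x) (1 / Psi x ^ 3) x := by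
  have := (hasDerivAt_id x).div (Psi_hasDeriv x) (Psi_pos x).ne'
  have h := Psi_sq x
  have h0 := Psi_pos x
  have e : 1 / Psi x ^ 3 = (1 * Psi x - x * (x / Psi x)) / Psi x ^ 2 := by
    field_simp
    linarith
  rw [e]
  exact this

lemma Psi_continuous : Continuous Psi := by unfold Psi; fun_prop

lemma Psi_lip : Lip Psi := by
  refine ⟨1, lipschitzWith_of_nnnorm_deriv_le (fun x => (Psi_hasDeriv x).differentiableAt) ?_⟩
  intro x
  rw [(Psi_hasDeriv x).deriv, ← NNReal.coe_le_coe]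
  simp only [coe_nnnorm, Real.norm_eq_abs, NNReal.coe_one]
  rw [abs_div, abs_of_pos (Psi_pos x), div_le_one (Psi_pos x)]
  apply abs_le_of_sq_le_sq _ (Psi_pos x).le
  rw [Psi_sq]; linarith

lemma Psi_comb_convex {φ : ℝ → ℝ} {K : ℝ} (h1 : Differentiable ℝ φ)
    (h2 : Differentiable ℝ (deriv φ)) (hK : ∀ x, - (deriv (deriv φ) x) * Psi x ^ 3 ≤ K) :
    ConvexOn ℝ univ (fun x => K * Psi x + φ x) := by
  have d1 : ∀ x, HasDerivAt (fun x => K * Psi x + φ x) (K * (x / Psi x) + deriv φ x) x :=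
    fun x => ((Psi_hasDeriv x).const_mul K).add (h1 x).hasDerivAt
  have e1 : deriv (fun x => K * Psi x + φ x) = fun x => K * (x / Psi x) + deriv φ x :=
    funext fun x => (d1 x).deriv
  have d2 : ∀ x, HasDerivAt (fun x => K * (x / Psi x) + deriv φ x)
      (K * (1 / Psi x ^ 3) + deriv (deriv φ) x) x :=
    fun x => ((Psi_hasDeriv2 x).const_mul K).add (h2 x).hasDerivAt
  apply convexOn_of_deriv2_nonneg' convex_univ
  · exact fun x _ => (d1 x).differentiableAt.differentiableWithinAt
  · rw [e1]
    exact fun x _ => (d2 x).differentiableAt.differentiableWithinAt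
  · intro x _
    simp only [Function.iterate_succ, Function.iterate_zero, Function.comp_apply, id]
    rw [e1, (d2 x).deriv]
    have hp : 0 < Psi x ^ 3 := pow_pos (Psi_pos x) 3
    have : - (deriv (deriv φ) x) ≤ K / Psi x ^ 3 := (le_div_iff₀ hp).2 (hK x)
    rw [mul_one_div]
    linarith

lemma Psi_convex : ConvexOn ℝ univ Psi := by
  have := Psi_comb_convex (φ := fun _ => 0) (K := 1) (by fun_prop) (by simp) (by simp)
  simpa using this

/-- The functional `∫ √(1+x²)`. -/
noncomputable def G (m : S) : ℝ := E Psi m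

lemma one_le_G (m : S) : 1 ≤ G m := by
  have : ∫ x, (1 : ℝ) ∂(m.1 : Measure ℝ) ≤ ∫ x, Psi x ∂(m.1 : Measure ℝ) :=
    integral_mono (integrable_const _) (Psi_lip.integrable m) one_le_Psi
  unfold G E
  simpa using this

lemma R.G_le {a b : S} (h : R a b) : G a ≤ G b := h _ Psi_convex Psi_lip

/-- Functions whose increments along the order are controlled by those of `G`. -/
def Test (φ : ℝ → ℝ) : Prop :=
  Lip φ ∧ ∃ K : ℝ, ∀ a b : S, R a b → |E φ b - E φ a| ≤ K * (G b - G a)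

lemma test_of_smooth {φ : ℝ → ℝ} (h : ContDiff ℝ 2 φ) (hc : HasCompactSupport (deriv φ)) :
    Test φ := by
  have h1 : ContDiff ℝ 1 (deriv φ) := ((contDiff_succ_iff_deriv (n := 1)).1 h).2.2
  have h2 : Continuous (deriv (deriv φ)) := h1.continuous_deriv le_rfl
  have hd : Differentiable ℝ φ := h.differentiable (by norm_num)
  have hd1 : Differentiable ℝ (deriv φ) := h1.differentiable (by norm_num)
  have hl : Lip φ := by
    obtain ⟨C, hC⟩ := hc.exists_bound_of_continuous h1.continuous
    refine ⟨C.toNNReal, lipschitzWith_of_nnnorm_deriv_le hd fun x => ?_⟩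
    rw [← NNReal.coe_le_coe]
    exact (hC x).trans (Real.le_coe_toNNReal C)
  obtain ⟨K, hK⟩ := (hc.deriv.mul_right (f' := fun x => Psi x ^ 3)).exists_bound_of_continuous
    (h2.mul (Psi_continuous.pow 3))
  refine ⟨hl, K, fun a b hab => ?_⟩
  have c1 : ConvexOn ℝ univ (fun x => K * Psi x + φ x) := by
    refine Psi_comb_convex hd hd1 fun x => ?_
    have := (abs_le.1 (hK x)).1
    simp only [Pi.mul_apply] at this
    linarith
  have c2 : ConvexOn ℝ univ (fun x => K * Psi x + -φ x) := by
    have e : deriv (fun x => - φ x) = fun x => - deriv φ x := by ext x; simp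
    refine Psi_comb_convex (φ := fun x => - φ x) hd.neg (by rw [e]; exact hd1.neg) fun x => ?_
    have := (abs_le.1 (hK x)).2
    simp only [Pi.mul_apply] at this
    rw [e]
    simp only [deriv.fun_neg]
    linarith
  have i1 := hab _ c1 ((Psi_lip.const_mul K).add hl)
  have i2 := hab _ c2 ((Psi_lip.const_mul K).add hl.neg)
  have ev : ∀ m : S, E (fun x => K * Psi x + φ x) m = K * G m + E φ m := fun m => by
    unfold G E
    rw [integral_add ((Psi_lip.integrable m).const_mul K) (hl.integrable m), integral_const_mul]
  have ev' : ∀ m : S, E (fun x => K * Psi x + -φ x) m = K * G m - E φ m := fun m => by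
    unfold G E
    rw [integral_add (g := fun x => -φ x) ((Psi_lip.integrable m).const_mul K)
      (hl.integrable m).neg, integral_const_mul, integral_neg]
    ring
  rw [ev, ev] at i1
  rw [ev', ev'] at i2
  rw [abs_le]
  constructor <;> linarith

/-- Smooth steps. -/
noncomputable def step (a : ℝ) (n : ℕ) (x : ℝ) : ℝ := Real.smoothTransition ((n + 1) * (x - a))

lemma step_test (a : ℝ) (n : ℕ) : Test (step a n) := by
  have hs : ContDiff ℝ 2 (step a n) := by
    unfold step
    exact Real.smoothTransition.contDiff.comp (by fun_prop)
  refine test_of_smooth hs ?_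
  refine HasCompactSupport.of_support_subset_isCompact (isCompact_Icc (a := a) (b := a + 1)) ?_
  intro x hx
  by_contra hc
  apply hx
  simp only [mem_Icc, not_and_or, not_le] at hc
  have hn : (0 : ℝ) ≤ n := Nat.cast_nonneg n
  rcases hc with hc | hc
  · have : step a n =ᶠ[𝓝 x] fun _ => 0 := by
      filter_upwards [eventually_lt_nhds hc] with y hy
      exact Real.smoothTransition.zero_of_nonpos (by nlinarith)
    rw [this.deriv_eq]; simp
  · have : step a n =ᶠ[𝓝 x] fun _ => 1 := by
      filter_upwards [eventually_gt_nhds hc] with y hy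
      exact Real.smoothTransition.one_of_one_le (by nlinarith)
    rw [this.deriv_eq]; simp

lemma ext_of_test {m m' : S} (h : ∀ φ, Test φ → E φ m = E φ m') : m = m' := by
  suffices hs : (m.1 : Measure ℝ) = (m'.1 : Measure ℝ) from Subtype.ext (Subtype.ext hs)
  have key : ∀ (a : ℝ) (m : S), Tendsto (fun n => E (step a n) m) atTop
      (𝓝 ((m.1 : Measure ℝ).real (Ioi a))) := by
    intro a m
    rw [← integral_indicator_one measurableSet_Ioi]
    refine tendsto_integral_of_dominated_convergence (fun _ => 1)
      (fun n => ((step_test a n).1.integrable m).1) (integrable_const _)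
      (fun n => ae_of_all _ fun x => ?_) (ae_of_all _ fun x => ?_)
    · rw [step, Real.norm_eq_abs, abs_of_nonneg (Real.smoothTransition.nonneg _)]
      exact Real.smoothTransition.le_one _
    · by_cases hx : a < x
      · rw [indicator_of_mem (mem_Ioi.2 hx)]
        refine tendsto_const_nhds.congr' ?_
        have hp : 0 < x - a := sub_pos.2 hx
        filter_upwards [eventually_ge_atTop ⌈1 / (x - a)⌉₊] with n hn
        have h1 := Nat.ceil_le.1 hn
        rw [div_le_iff₀ hp] at h1
        exact (Real.smoothTransition.one_of_one_le (by nlinarith)).symm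
      · rw [indicator_of_notMem (by simpa using hx)]
        refine tendsto_const_nhds.congr fun n => ?_
        have hn : (0 : ℝ) ≤ n := Nat.cast_nonneg n
        exact (Real.smoothTransition.zero_of_nonpos (by nlinarith)).symm
  refine Measure.ext_of_Iic _ _ fun a => ?_
  have e : (m.1 : Measure ℝ).real (Ioi a) = (m'.1 : Measure ℝ).real (Ioi a) := by
    refine tendsto_nhds_unique (key a m) ?_
    simp_rw [h _ (step_test a _)]
    exact key a m'
  have e' : (m.1 : Measure ℝ) (Ioi a) = (m'.1 : Measure ℝ) (Ioi a) :=
    (measureReal_eq_measureReal_iff).1 e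
  rw [← compl_Ioi, measure_compl measurableSet_Ioi (measure_ne_top _ _),
    measure_compl measurableSet_Ioi (measure_ne_top _ _), e']
  simp

lemma R.eq_of_G {a b : S} (h : R a b) (hG : G b ≤ G a) : a = b := by
  refine ext_of_test fun φ ⟨_, K, hK⟩ => ?_
  have h1 := hK a b h
  rw [le_antisymm hG h.G_le, sub_self, mul_zero] at h1
  exact (sub_eq_zero.1 (abs_nonpos_iff.1 h1)).symm

section chain

variable {C : Set S}

lemma mem_of_comparable (hC : IsMaxChain R C) {m : S} (h : ∀ c ∈ C, R m c ∨ R c m) : m ∈ C := by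
  have h1 := hC.1.insert (a := m) fun b hb _ => h b hb
  rw [hC.2 h1 (subset_insert m C)]
  exact mem_insert m C

lemma chain_total (hC : IsChain R C) {a b : S} (ha : a ∈ C) (hb : b ∈ C) : R a b ∨ R b a := by
  by_cases h : a = b
  · subst h; exact Or.inl (R.refl a)
  · exact hC ha hb h

lemma chain_R_of_G (hC : IsChain R C) {a b : S} (ha : a ∈ C) (hb : b ∈ C) (h : G a ≤ G b) :
    R a b := by
  rcases chain_total hC ha hb with h1 | h1
  · exact h1
  · rw [h1.eq_of_G h]; exact R.refl _

lemma exists_sup {L : Set S} (hL : IsChain R L) (hne : L.Nonempty) {M : S}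
    (hM : ∀ m ∈ L, R m M) :
    ∃ ℓ : S, (∀ m ∈ L, R m ℓ) ∧ (∀ M', (∀ m ∈ L, R m M') → R ℓ M') ∧
      ∀ c, (∀ m ∈ L, G m ≤ c) → G ℓ ≤ c := by
  have : Nonempty L := hne.to_subtype
  have hF : NeBot (⨅ m : L, 𝓟 {x | x ∈ L ∧ R m.1 x}) := by
    apply iInf_neBot_of_directed'
    · rintro ⟨a, ha⟩ ⟨b, hb⟩
      rcases chain_total hL ha hb with h | h
      · refine ⟨⟨b, hb⟩, ?_, ?_⟩ <;> simp only [ge_iff_le, principal_mono]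
        · exact fun x hx => ⟨hx.1, h.trans hx.2⟩
        · exact subset_rfl
      · refine ⟨⟨a, ha⟩, ?_, ?_⟩ <;> simp only [ge_iff_le, principal_mono]
        · exact subset_rfl
        · exact fun x hx => ⟨hx.1, h.trans hx.2⟩
    · rintro ⟨a, ha⟩
      exact principal_neBot_iff.2 ⟨a, ha, R.refl a⟩
  set U : Ultrafilter S := Ultrafilter.of (⨅ m : L, 𝓟 {x | x ∈ L ∧ R m.1 x}) with hU
  have hmem : ∀ m ∈ L, ∀ᶠ x in (U : Filter S), x ∈ L ∧ R m x := fun m hm =>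
    (Ultrafilter.of_le _) ((iInf_le (fun m : L => 𝓟 {x | x ∈ L ∧ R m.1 x}) ⟨m, hm⟩)
      (mem_principal_self _))
  have hin : ∀ᶠ x in (U : Filter S), x ∈ L := by
    obtain ⟨m, hm⟩ := hne
    exact (hmem m hm).mono fun x hx => hx.1
  obtain ⟨ℓ, -, hℓ⟩ := ultra_limit (U := U) (M := M) (hin.mono fun x hx => hM x hx)
  refine ⟨ℓ, fun m hm φ h1 h2 => ?_, fun M' hM' φ h1 h2 => ?_, fun c hc => ?_⟩
  · exact ge_of_tendsto (hℓ φ h2) ((hmem m hm).mono fun x hx => hx.2 φ h1 h2)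
  · exact le_of_tendsto (hℓ φ h2) (hin.mono fun x hx => hM' x hx φ h1 h2)
  · exact le_of_tendsto (hℓ Psi Psi_lip) (hin.mono fun x hx => hc x hx)

lemma exists_inf {L : Set S} (hL : IsChain R L) (hne : L.Nonempty) :
    ∃ ℓ : S, (∀ m ∈ L, R ℓ m) ∧ (∀ M', (∀ m ∈ L, R M' m) → R M' ℓ) ∧
      ∀ c, (∀ m ∈ L, c ≤ G m) → c ≤ G ℓ := by
  have : Nonempty L := hne.to_subtype
  have hF : NeBot (⨅ m : L, 𝓟 {x | x ∈ L ∧ R x m.1}) := by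
    apply iInf_neBot_of_directed'
    · rintro ⟨a, ha⟩ ⟨b, hb⟩
      rcases chain_total hL ha hb with h | h
      · refine ⟨⟨a, ha⟩, ?_, ?_⟩ <;> simp only [ge_iff_le, principal_mono]
        · exact subset_rfl
        · exact fun x hx => ⟨hx.1, hx.2.trans h⟩
      · refine ⟨⟨b, hb⟩, ?_, ?_⟩ <;> simp only [ge_iff_le, principal_mono]
        · exact fun x hx => ⟨hx.1, hx.2.trans h⟩
        · exact subset_rfl
    · rintro ⟨a, ha⟩
      exact principal_neBot_iff.2 ⟨a, ha, R.refl a⟩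
  set U : Ultrafilter S := Ultrafilter.of (⨅ m : L, 𝓟 {x | x ∈ L ∧ R x m.1}) with hU
  have hmem : ∀ m ∈ L, ∀ᶠ x in (U : Filter S), x ∈ L ∧ R x m := fun m hm =>
    (Ultrafilter.of_le _) ((iInf_le (fun m : L => 𝓟 {x | x ∈ L ∧ R x m.1}) ⟨m, hm⟩)
      (mem_principal_self _))
  obtain ⟨m₀, hm₀⟩ := hne
  have hin : ∀ᶠ x in (U : Filter S), x ∈ L := (hmem m₀ hm₀).mono fun x hx => hx.1
  obtain ⟨ℓ, -, hℓ⟩ := ultra_limit (U := U) (M := m₀) ((hmem m₀ hm₀).mono fun x hx => hx.2)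
  refine ⟨ℓ, fun m hm φ h1 h2 => ?_, fun M' hM' φ h1 h2 => ?_, fun c hc => ?_⟩
  · exact le_of_tendsto (hℓ φ h2) ((hmem m hm).mono fun x hx => hx.2 φ h1 h2)
  · exact ge_of_tendsto (hℓ φ h2) (hin.mono fun x hx => hM' x hx φ h1 h2)
  · exact ge_of_tendsto (hℓ Psi Psi_lip) (hin.mono fun x hx => hc x hx)

lemma exists_mix (a b : S) {θ : ℝ} (h0 : 0 ≤ θ) (h1 : θ ≤ 1) :
    ∃ m : S, ∀ φ, Lip φ → E φ m = (1 - θ) * E φ a + θ * E φ b := by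
  have h1' : 0 ≤ 1 - θ := sub_nonneg.2 h1
  set μ : Measure ℝ := ENNReal.ofReal (1 - θ) • (a.1 : Measure ℝ) +
    ENNReal.ofReal θ • (b.1 : Measure ℝ) with hμ
  have hp : IsProbabilityMeasure μ := by
    constructor
    simp only [hμ, Measure.coe_add, Measure.coe_smul, Pi.add_apply, Pi.smul_apply, measure_univ,
      smul_eq_mul, mul_one]
    rw [← ENNReal.ofReal_add h1' h0]
    simp
  have hi : ∀ φ, Lip φ → Integrable φ μ := fun φ hφ =>
    ((hφ.integrable a).smul_measure ENNReal.ofReal_ne_top).add_measure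
      ((hφ.integrable b).smul_measure ENNReal.ofReal_ne_top)
  refine ⟨⟨⟨μ, hp⟩, hi _ Lip.abs⟩, fun φ hφ => ?_⟩
  change ∫ x, φ x ∂μ = _
  rw [hμ, integral_add_measure ((hφ.integrable a).smul_measure ENNReal.ofReal_ne_top)
    ((hφ.integrable b).smul_measure ENNReal.ofReal_ne_top), integral_smul_measure,
    integral_smul_measure, ENNReal.toReal_ofReal h0, ENNReal.toReal_ofReal h1']
  rfl

lemma exists_level (hC : IsMaxChain R C) {a b : S} (ha : a ∈ C) (hb : b ∈ C) {c : ℝ}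
    (hac : G a ≤ c) (hcb : c ≤ G b) : ∃ m ∈ C, G m = c := by
  by_contra! hne
  have hL : IsChain R {m | m ∈ C ∧ G m ≤ c} := hC.1.mono fun _ h => h.1
  have hU : IsChain R {m | m ∈ C ∧ c ≤ G m} := hC.1.mono fun _ h => h.1
  obtain ⟨ℓ, l1, l2, l3⟩ := exists_sup hL ⟨a, ha, hac⟩ (M := b)
    fun m hm => chain_R_of_G hC.1 hm.1 hb (hm.2.trans hcb)
  obtain ⟨u, u1, u2, u3⟩ := exists_inf hU ⟨b, hb, hcb⟩
  have hLU : ∀ m ∈ C, G m ≤ c → ∀ m' ∈ C, c ≤ G m' → R m m' := fun m hm h m' hm' h' =>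
    chain_R_of_G hC.1 hm hm' (h.trans h')
  have hℓU : ∀ m ∈ C, c ≤ G m → R ℓ m := fun m hm h => l2 m fun m' hm' => hLU m' hm'.1 hm'.2 m hm h
  have huL : ∀ m ∈ C, G m ≤ c → R m u := fun m hm h => u2 m fun m' hm' => hLU m hm h m' hm'.1 hm'.2
  have hℓu : R ℓ u := u2 ℓ fun m hm => hℓU m hm.1 hm.2
  have hℓc : G ℓ ≤ c := l3 c fun m hm => hm.2
  have huc : c ≤ G u := u3 c fun m hm => hm.2
  have hℓC : ℓ ∈ C := mem_of_comparable hC fun m hm => by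
    rcases le_total (G m) c with h | h
    · exact Or.inr (l1 m ⟨hm, h⟩)
    · exact Or.inl (hℓU m hm h)
  have hℓc' : G ℓ < c := lt_of_le_of_ne hℓc (hne ℓ hℓC)
  have hd : 0 < G u - G ℓ := by linarith
  obtain ⟨m, hm⟩ := exists_mix ℓ u (θ := (c - G ℓ) / (G u - G ℓ))
    (div_nonneg (by linarith) hd.le) ((div_le_one hd).2 (by linarith))
  have hθ0 : 0 ≤ (c - G ℓ) / (G u - G ℓ) := div_nonneg (by linarith) hd.le
  have hθ1 : 0 ≤ 1 - (c - G ℓ) / (G u - G ℓ) :=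
    sub_nonneg.2 ((div_le_one hd).2 (by linarith))
  have hGm : G m = c := by
    have := hm Psi Psi_lip
    change G m = _ * G ℓ + _ * G u at this
    rw [this]
    field_simp
    ring
  refine hne m (mem_of_comparable hC fun x hx => ?_) hGm
  rcases le_total (G x) c with h | h
  · right
    intro φ h1 h2
    rw [hm φ h2]
    have e1 := mul_le_mul_of_nonneg_left (l1 x ⟨hx, h⟩ φ h1 h2) hθ1
    have e2 := mul_le_mul_of_nonneg_left (huL x hx h φ h1 h2) hθ0
    linarith
  · left
    intro φ h1 h2
    rw [hm φ h2]
    have e1 := mul_le_mul_of_nonneg_left (hℓU x hx h φ h1 h2) hθ1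
    have e2 := mul_le_mul_of_nonneg_left (u1 x ⟨hx, h⟩ φ h1 h2) hθ0
    linarith

lemma exists_least (hC : IsMaxChain R C) (hne : C.Nonempty) : ∃ a ∈ C, ∀ m ∈ C, G a ≤ G m := by
  obtain ⟨a, h1, -, -⟩ := exists_inf hC.1 hne
  exact ⟨a, mem_of_comparable hC fun c hc => Or.inl (h1 c hc), fun m hm => (h1 m hm).G_le⟩

/-- Continuity of a time-changed section of `G`. -/
lemma cont_section (hC : IsChain R C) {N : ℝ → S} {σ : ℝ → ℝ}
    (hN : ∀ s, 0 ≤ s → N s ∈ C ∧ G (N s) = σ s) (hσ : ContinuousOn σ (Ici 0))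
    (hmono : MonotoneOn σ (Ici 0)) :
    ContinuousOn (fun s => (N s).1) (Ici 0) := by
  intro s₀ hs₀
  rw [ContinuousWithinAt, tendsto_iff_ultrafilter]
  intro V hV
  have hs₀ : (0 : ℝ) ≤ s₀ := hs₀
  have hpos : ∀ᶠ s in (V : Filter ℝ), 0 ≤ s := hV self_mem_nhdsWithin
  have hlt : ∀ᶠ s in (V : Filter ℝ), s < s₀ + 1 :=
    hV (mem_nhdsWithin_of_mem_nhds (eventually_lt_nhds (by linarith)))
  have hσV : Tendsto σ V (𝓝 (σ s₀)) := (hσ s₀ hs₀).mono_left hV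
  obtain ⟨ℓ, h1, h2⟩ := ultra_limit (U := V.map N) (M := N (s₀ + 1)) (by
    change ∀ᶠ s in (V : Filter ℝ), R (N s) (N (s₀ + 1))
    filter_upwards [hpos, hlt] with s hs hs'
    have h1 : 0 ≤ s₀ + 1 := by linarith
    refine chain_R_of_G hC (hN s hs).1 (hN _ h1).1 ?_
    rw [(hN s hs).2, (hN _ h1).2]
    exact hmono hs h1 hs'.le)
  have h1' : Tendsto (fun s => (N s).1) V (𝓝 ℓ.1) := h1
  suffices hs : ℓ = N s₀ by rw [hs] at h1'; exact h1'
  refine ext_of_test fun φ ⟨hl, K, hK⟩ => ?_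
  have t1 : Tendsto (fun s => E φ (N s)) V (𝓝 (E φ ℓ)) := h2 φ hl
  refine tendsto_nhds_unique t1 ?_
  rw [tendsto_iff_dist_tendsto_zero]
  have t2 : Tendsto (fun s => K * |σ s - σ s₀|) V (𝓝 0) := by
    have := ((hσV.sub_const (σ s₀)).abs).const_mul K
    simpa using this
  refine squeeze_zero' (Eventually.of_forall fun s => dist_nonneg) ?_ t2
  filter_upwards [hpos] with s hs
  rw [Real.dist_eq, ← (hN s hs).2, ← (hN s₀ hs₀).2]
  rcases chain_total hC (hN s hs).1 (hN s₀ hs₀).1 with h | h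
  · have := hK _ _ h
    rw [abs_sub_comm, abs_sub_comm (G (N s)), abs_of_nonneg (sub_nonneg.2 h.G_le)]
    exact this
  · have := hK _ _ h
    rw [abs_of_nonneg (sub_nonneg.2 h.G_le)]
    exact this

end chain

lemma real_param {I : Set ℝ} {a : ℝ} (ha : a ∈ I) (ha0 : 0 ≤ a) (hmin : ∀ y ∈ I, a ≤ y)
    (hI : ∀ x ∈ I, ∀ y ∈ I, ∀ c, x ≤ c → c ≤ y → c ∈ I) :
    ∃ σ g : ℝ → ℝ, ContinuousOn σ (Ici 0) ∧ MonotoneOn σ (Ici 0) ∧ (∀ s, 0 ≤ s → σ s ∈ I) ∧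
      MonotoneOn g I ∧ (∀ y ∈ I, 0 ≤ g y) ∧ ∀ y ∈ I, σ (g y) = y := by
  by_cases hb : BddAbove I
  · by_cases hc : sSup I ∈ I
    · refine ⟨fun s => max a (min s (sSup I)), id, by fun_prop, ?_, ?_, monotone_id.monotoneOn _,
        fun y hy => ha0.trans (hmin y hy), ?_⟩
      · intro x _ y _ hxy
        exact max_le_max le_rfl (min_le_min hxy le_rfl)
      · intro s _
        exact hI a ha _ hc _ (le_max_left _ _) (max_le (le_csSup hb ha) (min_le_right _ _))
      · intro y hy
        simp only [id]
        rw [min_eq_left (le_csSup hb hy), max_eq_right (hmin y hy)]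
    · set c := sSup I with hcdef
      have hlt : ∀ y ∈ I, y < c := fun y hy =>
        lt_of_le_of_ne (le_csSup hb hy) fun h => hc (h ▸ hy)
      have hac : 0 < c - a := sub_pos.2 (hlt a ha)
      refine ⟨fun s => c - (c - a) / (1 + s), fun y => (c - a) / (c - y) - 1, ?_, ?_, ?_, ?_, ?_, ?_⟩
      · intro s hs
        have hs : (0 : ℝ) ≤ s := hs
        have : (1 : ℝ) + s ≠ 0 := by positivity
        exact ContinuousAt.continuousWithinAt (by fun_prop (disch := assumption))
      · intro x hx y _ hxy
        have hx : (0 : ℝ) ≤ x := hx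
        have : (c - a) / (1 + y) ≤ (c - a) / (1 + x) := by gcongr
        simp only
        linarith
      · intro s hs
        have h1 : 0 < (c - a) / (1 + s) := by positivity
        have h2 : (c - a) / (1 + s) ≤ c - a := div_le_self hac.le (by linarith)
        obtain ⟨y, hy, hy'⟩ := exists_lt_of_lt_csSup ⟨a, ha⟩
          (show c - (c - a) / (1 + s) < sSup I by linarith)
        exact hI a ha y hy _ (by linarith) hy'.le
      · intro x hx y hy hxy
        have h1 : 0 < c - y := sub_pos.2 (hlt y hy)
        have : (c - a) / (c - x) ≤ (c - a) / (c - y) := by gcongr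
        simp only
        linarith
      · intro y hy
        have h1 : 0 < c - y := sub_pos.2 (hlt y hy)
        have : 1 ≤ (c - a) / (c - y) := (one_le_div h1).2 (by have := hmin y hy; linarith)
        linarith
      · intro y hy
        have h1 : 0 < c - y := sub_pos.2 (hlt y hy)
        have e : 1 + ((c - a) / (c - y) - 1) = (c - a) / (c - y) := by ring
        simp only
        rw [e, div_div_cancel₀ hac.ne']
        ring
  · refine ⟨fun s => max a s, id, by fun_prop, ?_, ?_, monotone_id.monotoneOn _,
      fun y hy => ha0.trans (hmin y hy), fun y hy => max_eq_right (hmin y hy)⟩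
    · intro x _ y _ hxy
      exact max_le_max le_rfl hxy
    · intro s _
      rw [not_bddAbove_iff] at hb
      obtain ⟨y, hy, hy'⟩ := hb (max a s)
      exact hI a ha y hy _ (le_max_left _ _) hy'.le

/-- Assemble the peacock from a time parametrization. -/
lemma assemble {C : Set S} (hC : IsMaxChain R C) {T : Type*} [LinearOrder T]
    (μ : T → S) (hμ : ∀ t, μ t ∈ C) (hmono : ∀ s t, s ≤ t → R (μ s) (μ t))
    {σ g : ℝ → ℝ} (h1 : ContinuousOn σ (Ici 0)) (h2 : MonotoneOn σ (Ici 0))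
    (h3 : ∀ s, 0 ≤ s → ∃ m ∈ C, G m = σ s)
    (h4 : MonotoneOn g (range fun t => G (μ t))) (h5 : ∀ t, 0 ≤ g (G (μ t)))
    (h6 : ∀ t, σ (g (G (μ t))) = G (μ t)) :
    ∃ ν : ℝ → ProbabilityMeasure ℝ,
      ContinuousOn ν (Ici 0) ∧
      (∀ a b : ℝ, 0 ≤ a → a ≤ b → ConvexOrder (ν a : Measure ℝ) (ν b : Measure ℝ)) ∧
      Monotone (fun t => g (G (μ t))) ∧ (∀ t, (μ t).1 = ν (g (G (μ t)))) := by
  have h3' : ∀ s, ∃ m : S, 0 ≤ s → m ∈ C ∧ G m = σ s := by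
    intro s
    by_cases hs : 0 ≤ s
    · obtain ⟨m, hm⟩ := h3 s hs
      exact ⟨m, fun _ => hm⟩
    · obtain ⟨m, -⟩ := h3 0 le_rfl
      exact ⟨m, fun h => absurd h hs⟩
  choose N hN using h3'
  refine ⟨fun s => (N s).1, cont_section hC.1 hN h1 h2, ?_, ?_, ?_⟩
  · intro a b ha hab
    have hb := ha.trans hab
    apply R.convexOrder
    apply chain_R_of_G hC.1 (hN a ha).1 (hN b hb).1
    rw [(hN a ha).2, (hN b hb).2]
    exact h2 ha hb hab
  · intro s t hst
    exact h4 ⟨s, rfl⟩ ⟨t, rfl⟩ (hmono s t hst).G_le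
  · intro t
    have h := hN _ (h5 t)
    have e : G (N (g (G (μ t)))) = G (μ t) := h.2.trans (h6 t)
    rw [(chain_R_of_G hC.1 (hμ t) h.1 e.ge).eq_of_G e.le]
    congr 2
    exact ((chain_R_of_G hC.1 (hμ t) h.1 e.ge).eq_of_G e.le) ▸ rfl

end PeacockAux

open PeacockAux in
/-- every peacock `(μ_t)_{t∈T}` over a total order `T` can be embedded in a
weakly continuous peacock `(ν_s)_{s∈ℝ₊}` via an increasing time change `f : T → ℝ₊` with
`μ_t = ν_{f(t)}`; if `T` has a maximal element, `f` can be taken with values in `[0,1]`. -/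
theorem peacock_embeds_in_continuous_peacock
    {T : Type*} [LinearOrder T] (μ : T → ProbabilityMeasure ℝ)
    (hmom : ∀ t, Integrable (fun x => |x|) (μ t : Measure ℝ))
    (hpeacock : ∀ s t : T, s ≤ t → ConvexOrder (μ s : Measure ℝ) (μ t : Measure ℝ)) :
    (∃ (ν : ℝ → ProbabilityMeasure ℝ) (f : T → ℝ),
      ContinuousOn ν (Ici 0) ∧
      (∀ a b : ℝ, 0 ≤ a → a ≤ b → ConvexOrder (ν a : Measure ℝ) (ν b : Measure ℝ)) ∧
      Monotone f ∧ (∀ t, 0 ≤ f t) ∧ (∀ t, μ t = ν (f t))) ∧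
    ((∃ t₀ : T, ∀ t, t ≤ t₀) →
      ∃ (ν : ℝ → ProbabilityMeasure ℝ) (f : T → ℝ),
        ContinuousOn ν (Ici 0) ∧
        (∀ a b : ℝ, 0 ≤ a → a ≤ b → ConvexOrder (ν a : Measure ℝ) (ν b : Measure ℝ)) ∧
        Monotone f ∧ (∀ t, f t ∈ Icc (0 : ℝ) 1) ∧ (∀ t, μ t = ν (f t))) := by
  classical
  rcases isEmpty_or_nonempty T with hT | hT
  · have triv : ∃ ν : ℝ → ProbabilityMeasure ℝ, ContinuousOn ν (Ici 0) ∧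
        ∀ a b : ℝ, 0 ≤ a → a ≤ b → ConvexOrder (ν a : Measure ℝ) (ν b : Measure ℝ) :=
      ⟨fun _ => ⟨Measure.dirac 0, inferInstance⟩, continuousOn_const,
        fun a b _ _ φ _ _ _ => le_rfl⟩
    obtain ⟨ν, h1, h2⟩ := triv
    exact ⟨⟨ν, fun _ => 0, h1, h2, monotone_const, fun t => le_rfl, fun t => isEmptyElim t⟩,
      fun ⟨t, _⟩ => isEmptyElim t⟩
  let m : T → S := fun t => ⟨μ t, hmom t⟩
  have hm : ∀ s t, s ≤ t → R (m s) (m t) := fun s t h => R.of_convexOrder (hpeacock s t h)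
  have hch : IsChain R (range m) := by
    rintro _ ⟨s, rfl⟩ _ ⟨t, rfl⟩ _
    rcases le_total s t with h | h
    · exact Or.inl (hm s t h)
    · exact Or.inr (hm t s h)
  obtain ⟨C, hC, hsub⟩ := hch.exists_maxChain
  have hmC : ∀ t, m t ∈ C := fun t => hsub ⟨t, rfl⟩
  obtain ⟨t₁⟩ := hT
  obtain ⟨a, haC, hmin⟩ := exists_least hC ⟨_, hmC t₁⟩
  have ha1 := one_le_G a
  constructor
  · obtain ⟨σ, g, h1, h2, h3, h4, h5, h6⟩ := real_param (I := G '' C) (a := G a)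
      ⟨a, haC, rfl⟩ (by linarith) (by rintro _ ⟨y, hy, rfl⟩; exact hmin y hy) (by
        rintro _ ⟨x, hx, rfl⟩ _ ⟨y, hy, rfl⟩ c hxc hcy
        exact exists_level hC hx hy hxc hcy)
    obtain ⟨ν, k1, k2, k3, k4⟩ := assemble hC m hmC hm h1 h2 h3
      (h4.mono (by rintro _ ⟨t, rfl⟩; exact ⟨_, hmC t, rfl⟩))
      (fun t => h5 _ ⟨_, hmC t, rfl⟩) (fun t => h6 _ ⟨_, hmC t, rfl⟩)
    exact ⟨ν, _, k1, k2, k3, fun t => h5 _ ⟨_, hmC t, rfl⟩, k4⟩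
  · rintro ⟨t₀, ht₀⟩
    have hc1 := one_le_G (m t₀)
    have hc0 : 0 < G (m t₀) := by linarith
    have hle : ∀ t, G (m t) ≤ G (m t₀) := fun t => (hm t t₀ (ht₀ t)).G_le
    have hg0 : ∀ t, 0 ≤ G (m t) / G (m t₀) := fun t =>
      div_nonneg (by linarith [one_le_G (m t)]) hc0.le
    obtain ⟨ν, k1, k2, k3, k4⟩ := assemble hC m hmC hm
      (σ := fun s => max (G a) (min (s * G (m t₀)) (G (m t₀)))) (g := fun y => y / G (m t₀))
      (by fun_prop)
      (fun x _ y _ hxy => max_le_max le_rfl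
        (min_le_min (mul_le_mul_of_nonneg_right hxy hc0.le) le_rfl))
      (fun s _ => exists_level hC haC (hmC t₀) (le_max_left _ _)
        (max_le (hmin _ (hmC t₀)) (min_le_right _ _)))
      (fun x _ y _ hxy => div_le_div_of_nonneg_right hxy hc0.le)
      hg0
      (fun t => by
        rw [div_mul_cancel₀ _ hc0.ne', min_eq_left (hle t), max_eq_right (hmin _ (hmC t))])
    exact ⟨ν, _, k1, k2, k3, fun t => ⟨hg0 t, (div_le_one hc0).2 (hle t)⟩, k4⟩
end

section
/- A martingale coupling π ∈ M(μ,ν) with disintegration (π_x) is Lipschitz-Markov (W(π_x,π_{x'}) = |x−x'| for μ-a.e. x,x') if and only if for every 1-Lipschitz function f: ℝ → ℝ the map x ↦ ∫ f dπ_x is equal μ-a.e. to a 1-Lipschitz function. -/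
open MeasureTheory ProbabilityTheory

/-- The `L¹`-Wasserstein distance between two probability measures on `ℝ`. -/
noncomputable def W1 (α β : Measure ℝ) : ℝ :=
  sInf {r : ℝ | ∃ γ : Measure (ℝ × ℝ), IsProbabilityMeasure γ ∧
    γ.map Prod.fst = α ∧ γ.map Prod.snd = β ∧ r = ∫ p, |p.1 - p.2| ∂γ}

open Set Filter Topology

lemma exists_quantile (α : Measure ℝ) [IsProbabilityMeasure α] :
    ∃ Q : ℝ → ℝ, AEMeasurable Q (volume.restrict (Ioo (0:ℝ) 1)) ∧
      (∀ u ∈ Ioo (0:ℝ) 1, ∀ t, Q u ≤ t ↔ u ≤ cdf α t) ∧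
      (volume.restrict (Ioo (0:ℝ) 1)).map Q = α := by
  have gal : ∀ u ∈ Ioo (0:ℝ) 1, ∀ t, sInf {t | u ≤ cdf α t} ≤ t ↔ u ≤ cdf α t := by
    intro u hu t
    have hbdd : BddBelow {t | u ≤ cdf α t} := by
      obtain ⟨b, hb⟩ := ((tendsto_cdf_atBot α).eventually (gt_mem_nhds hu.1)).exists
      refine ⟨b, fun s hs => ?_⟩
      by_contra h
      have h1 := monotone_cdf α (not_le.mp h).le
      have h2 : u ≤ cdf α s := hs
      linarith
    have hne : {t | u ≤ cdf α t}.Nonempty := by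
      obtain ⟨b, hb⟩ := ((tendsto_cdf_atTop α).eventually (lt_mem_nhds hu.2)).exists
      exact ⟨b, hb.le⟩
    refine ⟨fun h => ?_, fun h => csInf_le hbdd h⟩
    have hmem : u ≤ cdf α (sInf {t | u ≤ cdf α t}) := by
      have hc := ((cdf α).right_continuous (sInf {t | u ≤ cdf α t})).mono Ioi_subset_Ici_self
      refine ge_of_tendsto hc ?_
      filter_upwards [self_mem_nhdsWithin] with s hs
      obtain ⟨r, hr, hrs⟩ := exists_lt_of_csInf_lt hne hs
      exact le_trans hr (monotone_cdf α hrs.le)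
    exact hmem.trans (monotone_cdf α h)
  have hmeas : AEMeasurable (fun u => sInf {t | u ≤ cdf α t})
      (volume.restrict (Ioo (0:ℝ) 1)) := by
    refine aemeasurable_restrict_of_monotoneOn measurableSet_Ioo ?_
    intro u hu v hv huv
    exact (gal u hu _).2 (huv.trans ((gal v hv _).1 le_rfl))
  refine ⟨_, hmeas, gal, ?_⟩
  have : IsProbabilityMeasure (volume.restrict (Ioo (0:ℝ) 1)) := ⟨by simp⟩
  have := Measure.isProbabilityMeasure_map hmeas
  refine Measure.ext_of_Iic _ _ fun t => ?_
  rw [Measure.map_apply_of_aemeasurable hmeas measurableSet_Iic, ← ofReal_cdf α t,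
    Measure.restrict_apply' measurableSet_Ioo]
  have h0 := cdf_nonneg α t
  have h1 := cdf_le_one α t
  apply le_antisymm
  · calc _ ≤ volume (Ioc 0 (cdf α t)) := by
          refine measure_mono ?_
          rintro u ⟨hu, hu'⟩
          exact ⟨hu'.1, (gal u hu' t).1 hu⟩
      _ = _ := by simp
  · calc _ = volume (Ioo 0 (cdf α t)) := by simp
      _ ≤ _ := by
          refine measure_mono ?_
          rintro u ⟨hu, hu'⟩
          have hu2 : u ∈ Ioo (0:ℝ) 1 := ⟨hu, hu'.trans_le h1⟩
          exact ⟨(gal u hu2 t).2 hu'.le, hu2⟩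

lemma lip_integrable {α : Measure ℝ} [IsProbabilityMeasure α]
    (hα : Integrable (fun y => |y|) α) {f : ℝ → ℝ} (hf : LipschitzWith 1 f) :
    Integrable f α := by
  refine Integrable.mono' (g := fun y => |f 0| + |y|) ((integrable_const _).add hα)
    hf.continuous.aestronglyMeasurable (Eventually.of_forall fun y => ?_)
  have := hf.dist_le_mul y 0
  simp only [Real.dist_eq, NNReal.coe_one, one_mul, sub_zero] at this
  rw [Real.norm_eq_abs]
  have h2 := abs_sub_abs_le_abs_sub (f y) (f 0)
  linarith

/-- easy half of duality -/
lemma lip_le_W1 {α β : Measure ℝ} [IsProbabilityMeasure α] [IsProbabilityMeasure β]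
    (hα : Integrable (fun y => |y|) α) (hβ : Integrable (fun y => |y|) β)
    {f : ℝ → ℝ} (hf : LipschitzWith 1 f) :
    |∫ y, f y ∂α - ∫ y, f y ∂β| ≤ W1 α β := by
  refine le_csInf ⟨_, α.prod β, inferInstance, ?_, ?_, rfl⟩ ?_
  · simp
  · simp
  rintro r ⟨γ, hγ, h1, h2, rfl⟩
  have key : ∀ {g : ℝ → ℝ}, LipschitzWith 1 g →
      Integrable (fun p : ℝ × ℝ => g p.1) γ ∧ Integrable (fun p : ℝ × ℝ => g p.2) γ := by
    intro g hg
    have ha := lip_integrable hα hg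
    have hb := lip_integrable hβ hg
    rw [← h1] at ha
    rw [← h2] at hb
    exact ⟨ha.comp_measurable measurable_fst, hb.comp_measurable measurable_snd⟩
  have e1 : ∫ y, f y ∂α = ∫ p, f p.1 ∂γ := by
    rw [← h1, integral_map measurable_fst.aemeasurable hf.continuous.aestronglyMeasurable]
  have e2 : ∫ y, f y ∂β = ∫ p, f p.2 ∂γ := by
    rw [← h2, integral_map measurable_snd.aemeasurable hf.continuous.aestronglyMeasurable]
  rw [e1, e2, ← integral_sub (key hf).1 (key hf).2]
  refine abs_integral_le_integral_abs.trans (integral_mono ?_ ?_ ?_)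
  · exact ((key hf).1.sub (key hf).2).abs
  · exact ((key LipschitzWith.id).1.sub (key LipschitzWith.id).2).abs
  · intro p
    have := hf.dist_le_mul p.1 p.2
    simpa [Real.dist_eq] using this

/-- hard half of duality -/
lemma W1_le_of_lip {α β : Measure ℝ} [IsProbabilityMeasure α] [IsProbabilityMeasure β]
    (hα : Integrable (fun y => |y|) α) (hβ : Integrable (fun y => |y|) β) {c : ℝ}
    (h : ∀ f : ℝ → ℝ, LipschitzWith 1 f → f 0 = 0 → ∫ y, f y ∂β - ∫ y, f y ∂α ≤ c) :
    W1 α β ≤ c := by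
  obtain ⟨A, hAm, hA, hAmap⟩ := exists_quantile α
  obtain ⟨B, hBm, hB, hBmap⟩ := exists_quantile β
  set P : Measure ℝ := volume.restrict (Ioo (0:ℝ) 1) with hP
  have hPp : IsProbabilityMeasure P := ⟨by simp [hP]⟩
  have hABm : AEMeasurable (fun u => (A u, B u)) P := hAm.prodMk hBm
  classical
  let s : ℝ → ℝ := fun t => if cdf β t < cdf α t then 1 else -1
  have hsm : Measurable s := Measurable.ite
    (measurableSet_lt (monotone_cdf β).measurable (monotone_cdf α).measurable)
    measurable_const measurable_const
  have hsb : ∀ t, ‖s t‖ ≤ 1 := by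
    intro t
    by_cases ht : cdf β t < cdf α t <;> simp [s, ht]
  have hsi : ∀ a b, IntervalIntegrable s volume a b := by
    intro a b
    refine (intervalIntegrable_const (c := (1:ℝ))).mono_fun hsm.aestronglyMeasurable
      (Eventually.of_forall fun t => ?_)
    simpa using hsb t
  let f : ℝ → ℝ := fun y => ∫ t in (0:ℝ)..y, s t
  have hfsub : ∀ a b, f b - f a = ∫ t in a..b, s t := fun a b =>
    intervalIntegral.integral_interval_sub_left (hsi _ _) (hsi _ _)
  have hf : LipschitzWith 1 f := by
    refine LipschitzWith.of_dist_le_mul fun x y => ?_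
    rw [Real.dist_eq, hfsub y x, Real.dist_eq]
    simpa using intervalIntegral.norm_integral_le_of_norm_le_const (a := y) (b := x)
      (fun t _ => hsb t)
  have key : ∀ u ∈ Ioo (0:ℝ) 1, |A u - B u| = f (B u) - f (A u) := by
    intro u hu
    rcases le_total (A u) (B u) with hab | hab
    · rw [hfsub, intervalIntegral.integral_of_le hab, integral_Ioc_eq_integral_Ioo,
        setIntegral_congr_fun (g := fun _ => (1:ℝ)) measurableSet_Ioo]
      · rw [abs_of_nonpos (by linarith)]
        simp [hab]
      · intro t ht
        have h1 := (hA u hu t).1 ht.1.le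
        have h2 : cdf β t < u := by
          by_contra h3
          exact absurd ((hB u hu t).2 (not_lt.mp h3)) (not_le.mpr ht.2)
        simp [s, h2.trans_le h1]
    · rw [hfsub, intervalIntegral.integral_symm, intervalIntegral.integral_of_le hab, integral_Ioc_eq_integral_Ioo,
        setIntegral_congr_fun (g := fun _ => (-1:ℝ)) measurableSet_Ioo]
      · rw [abs_of_nonneg (by linarith)]
        simp [hab]
      · intro t ht
        have h1 := (hB u hu t).1 ht.1.le
        have h2 : cdf α t < u := by
          by_contra h3
          exact absurd ((hA u hu t).2 (not_lt.mp h3)) (not_le.mpr ht.2)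
        simp [s, (h2.trans_le h1).le]
  have hcost : ∫ p, |p.1 - p.2| ∂(P.map fun u => (A u, B u)) = ∫ y, f y ∂β - ∫ y, f y ∂α := by
    have ia := lip_integrable hα hf
    have ib := lip_integrable hβ hf
    rw [← hAmap] at ia
    rw [← hBmap] at ib
    have ia' := ia.comp_aemeasurable hAm
    have ib' := ib.comp_aemeasurable hBm
    rw [integral_map hABm (by fun_prop)]
    conv_rhs => rw [← hAmap, ← hBmap]
    rw [integral_map hAm hf.continuous.aestronglyMeasurable,
      integral_map hBm hf.continuous.aestronglyMeasurable]
    have := integral_sub ib' ia'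
    simp only [Function.comp] at this
    rw [← this]
    exact setIntegral_congr_fun measurableSet_Ioo key
  refine le_trans (csInf_le ⟨0, ?_⟩ ⟨P.map fun u => (A u, B u), ?_, ?_, ?_, rfl⟩)
    (hcost.le.trans (h f hf (by simp [f])))
  · rintro r ⟨γ, -, -, -, rfl⟩
    exact integral_nonneg fun p => abs_nonneg _
  · exact Measure.isProbabilityMeasure_map hABm
  · rw [AEMeasurable.map_map_of_aemeasurable measurable_fst.aemeasurable hABm]
    exact hAmap
  · rw [AEMeasurable.map_map_of_aemeasurable measurable_snd.aemeasurable hABm]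
    exact hBmap

lemma exists_dense_lip : ∃ d : ℕ → ℝ → ℝ, (∀ n, LipschitzWith 1 (d n) ∧ d n 0 = 0) ∧
    ∀ f : ℝ → ℝ, LipschitzWith 1 f → f 0 = 0 →
      ∃ k : ℕ → ℕ, ∀ y, Tendsto (fun n => d (k n) y) atTop (𝓝 (f y)) := by
  let L : Set C(ℝ, ℝ) := {f | LipschitzWith 1 f ∧ f 0 = 0}
  have hne : Nonempty L := ⟨⟨0, by
    refine ⟨?_, rfl⟩
    exact (LipschitzWith.const (0:ℝ)).weaken zero_le_one⟩⟩
  refine ⟨fun n => ((TopologicalSpace.denseSeq L n : L) : C(ℝ, ℝ)),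
    fun n => (TopologicalSpace.denseSeq L n).2, fun f hf h0 => ?_⟩
  let F : L := ⟨⟨f, hf.continuous⟩, hf, h0⟩
  have hF : F ∈ closure (range (TopologicalSpace.denseSeq L)) :=
    TopologicalSpace.denseRange_denseSeq L F
  obtain ⟨x, hx, hlim⟩ := mem_closure_iff_seq_limit.1 hF
  choose k hk using hx
  refine ⟨k, fun y => ?_⟩
  have hc : Continuous fun G : L => (G : C(ℝ, ℝ)) y :=
    (continuous_eval_const y).comp continuous_subtype_val
  have := (hc.tendsto F).comp hlim
  simpa [Function.comp_def, ← hk, F] using this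

/-- a martingale coupling `π ∈ M(μ,ν)` with disintegration `(π_x)` is
Lipschitz-Markov (`W(π_x, π_{x'}) = |x − x'|` for all `x, x'` in a set of full
`μ`-measure) iff for every `1`-Lipschitz `f : ℝ → ℝ` the map `x ↦ ∫ f dπ_x` agrees
`μ`-a.e. with a `1`-Lipschitz function. -/
theorem lipschitz_markov_iff_lipschitz_conditional
    (μ ν : Measure ℝ) [IsProbabilityMeasure μ] [IsProbabilityMeasure ν]
    (hμ : Integrable (fun x => |x|) μ) (hν : Integrable (fun x => |x|) ν)
    (κ : Kernel ℝ ℝ) [IsMarkovKernel κ]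
    (π : Measure (ℝ × ℝ)) (hπ : π = μ.compProd κ)
    (hfst : π.map Prod.fst = μ) (hsnd : π.map Prod.snd = ν)
    (hbary : ∀ᵐ x ∂μ, ∫ y, y ∂(κ x) = x)
    (hκint : ∀ᵐ x ∂μ, Integrable (fun y => |y|) (κ x)) :
    (∃ X : Set ℝ, μ X = 1 ∧ ∀ x ∈ X, ∀ x' ∈ X, W1 (κ x) (κ x') = |x - x'|) ↔
    (∀ f : ℝ → ℝ, LipschitzWith 1 f →
      ∃ g : ℝ → ℝ, LipschitzWith 1 g ∧ ∀ᵐ x ∂μ, ∫ y, f y ∂(κ x) = g x) := by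
  constructor
  · rintro ⟨X, hX, hW⟩ f hf
    let h : ℝ → ℝ := fun x => ∫ y, f y ∂(κ x)
    have hh : Measurable h :=
      (hf.continuous.stronglyMeasurable.integral_kernel (κ := κ)).measurable
    let G : Set ℝ := {x | Integrable (fun y => |y|) (κ x)}
    have hlip : LipschitzOnWith 1 h (X ∩ G) := by
      refine LipschitzOnWith.of_dist_le_mul fun x hx x' hx' => ?_
      have := lip_le_W1 hx.2 hx'.2 hf
      rw [hW x hx.1 x' hx'.1] at this
      simpa [Real.dist_eq] using this
    obtain ⟨g, hg, hgh⟩ := hlip.extend_real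
    refine ⟨g, hg, ?_⟩
    have hE : MeasurableSet {x | h x = g x} := measurableSet_eq_fun hh hg.continuous.measurable
    have hG : μ Gᶜ = 0 := hκint
    have h1 : μ {x | h x = g x} = 1 := by
      refine le_antisymm prob_le_one ?_
      calc 1 = μ X := hX.symm
        _ ≤ μ ({x | h x = g x} ∪ Gᶜ) := by
            refine measure_mono fun x hx => ?_
            by_cases hxG : x ∈ G
            · exact Or.inl (hgh ⟨hx, hxG⟩)
            · exact Or.inr hxG
        _ ≤ μ {x | h x = g x} + μ Gᶜ := measure_union_le _ _
        _ = _ := by rw [hG, add_zero]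
    exact (prob_compl_eq_zero_iff hE).2 h1
  · intro H
    obtain ⟨d, hd, hdense⟩ := exists_dense_lip
    choose g hg hgd using fun n => H (d n) (hd n).1
    have hall : ∀ᵐ x ∂μ, ∀ n, ∫ y, d n y ∂(κ x) = g n x := ae_all_iff.2 hgd
    refine ⟨{x | (∫ y, y ∂(κ x) = x) ∧ Integrable (fun y => |y|) (κ x) ∧
      ∀ n, ∫ y, d n y ∂(κ x) = g n x}, ?_, ?_⟩
    · have hae := hbary.and (hκint.and hall)
      have := measure_eq_measure_of_null_sdiff (μ := μ) (subset_univ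
        {x | (∫ y, y ∂(κ x) = x) ∧ Integrable (fun y => |y|) (κ x) ∧
          ∀ n, ∫ y, d n y ∂(κ x) = g n x}) (by
            rw [← compl_eq_univ_sdiff]
            exact hae)
      rw [this, measure_univ]
    · rintro x ⟨hx1, hx2, hx3⟩ x' ⟨hx1', hx2', hx3'⟩
      apply le_antisymm
      · refine W1_le_of_lip hx2 hx2' fun f hf h0 => ?_
        obtain ⟨k, hk⟩ := hdense f hf h0
        have lim : ∀ z, Integrable (fun y => |y|) (κ z) →
            Tendsto (fun n => ∫ y, d (k n) y ∂(κ z)) atTop (𝓝 (∫ y, f y ∂(κ z))) := by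
          intro z hz
          refine tendsto_integral_of_dominated_convergence (fun y => |y|)
            (fun n => (hd (k n)).1.continuous.aestronglyMeasurable) hz
            (fun n => Eventually.of_forall fun y => ?_) (Eventually.of_forall hk)
          have := (hd (k n)).1.dist_le_mul y 0
          simpa [Real.dist_eq, (hd (k n)).2] using this
        refine le_of_tendsto ((lim x' hx2').sub (lim x hx2)) (Eventually.of_forall fun n => ?_)
        rw [hx3, hx3']
        have := (hg (k n)).dist_le_mul x' x
        simp only [Real.dist_eq, NNReal.coe_one, one_mul] at this
        rw [abs_sub_comm x x']
        exact (le_abs_self _).trans this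
      · have := lip_le_W1 hx2 hx2' LipschitzWith.id
        simpa [hx1, hx1'] using this
end
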